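/- Let n ≥ 2, fix signs ε_1,…,ε_n ∈ {1,−1}, let p ≥ 2 with np ≥ 6, and let (q,r) be an admissible pair with q > 2 and r > 2; let q', r' denote the conjugate exponents. There is a constant C > 0 such that for every F ∈ 𝒮(ℝ×ℝⁿ), every j ∈ ℤ, and every unit vector e ∈ S^{n−1}, 2^{−(n/2−1/p)j} ‖P_j ∫_0^t W_±(t−s)F(s)ds‖_{L^{p,∞}_e} ≤ C ‖P_j F‖_{L^{q'}_t L^{r'}_x}. -/

import Mathlib

open MeasureTheory Complex Filter
open scoped FourierTransform RealInnerProductSpace ENNReal NNReal Topology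

noncomputable section

namespace DNLS

/-- Euclidean space ℝⁿ. -/
abbrev Eucl (n : ℕ) := EuclideanSpace ℝ (Fin n)

/-- The quadratic symbol `|ξ|²_± = Σ εᵢ ξᵢ²`. -/
def quadSym {n : ℕ} (ε : Fin n → ℝ) (ξ : Eucl n) : ℝ := ∑ i, ε i * (ξ i) ^ 2

/-- The signed vector `e_± = (ε₁e₁, …, εₙeₙ)`. -/
def epm {n : ℕ} (ε : Fin n → ℝ) (e : Eucl n) : Eucl n := WithLp.toLp 2 (fun i => ε i * e i)

/-- Fourier multiplier operator with symbol `m`. -/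
def mulOp {n : ℕ} (m : Eucl n → ℂ) (f : Eucl n → ℂ) : Eucl n → ℂ :=
  𝓕⁻ (fun ξ => m ξ * 𝓕 f ξ)

/-- The propagator `W_±(t)`, with `(W_±(t)φ)^(ξ) = e^{-it|ξ|²_±} φ̂(ξ)`. -/
def prop {n : ℕ} (ε : Fin n → ℝ) (t : ℝ) (φ : Eucl n → ℂ) : Eucl n → ℂ :=
  mulOp (fun ξ => Complex.exp (-Complex.I * t * quadSym ε ξ)) φ

/-- Fourier multiplier operator acting in the space variable of a space-time function. -/
def mulOpT {n : ℕ} (m : Eucl n → ℂ) (u : ℝ × Eucl n → ℂ) : ℝ × Eucl n → ℂ :=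
  fun p => mulOp m (fun y => u (p.1, y)) p.2

/-- Hypotheses on the bump function χ : even, smooth, compactly supported in (-2,2),
equal to one on [-1,1]. -/
structure IsBump (χ : ℝ → ℝ) : Prop where
  smooth : ∀ k : ℕ, ContDiff ℝ k χ
  even : ∀ s, χ (-s) = χ s
  supp : ∀ s, 2 ≤ |s| → χ s = 0
  one : ∀ s, |s| ≤ 1 → χ s = 1

/-- `ψ(s) = χ(|s|) - χ(2|s|)`. -/
def psiR (χ : ℝ → ℝ) (s : ℝ) : ℝ := χ |s| - χ (2 * |s|)

/-- `ψ_{≥k}(s) = Σ_{m ≥ k} ψ(2^{-m} s)`. -/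
def psiGe (χ : ℝ → ℝ) (k : ℤ) (s : ℝ) : ℝ :=
  ∑' m : ℤ, if k ≤ m then psiR χ ((2 : ℝ) ^ (-m) * s) else 0

/-- Littlewood–Paley projection `P_j`. -/
def proj {n : ℕ} (χ : ℝ → ℝ) (j : ℤ) (f : Eucl n → ℂ) : Eucl n → ℂ :=
  mulOp (fun ξ => (psiR χ ((2 : ℝ) ^ (-j) * ‖ξ‖) : ℂ)) f

/-- Low-frequency projection `P_{≤0} = I - Σ_{j≥1} P_j`. -/
def lowProj {n : ℕ} (χ : ℝ → ℝ) (f : Eucl n → ℂ) : Eucl n → ℂ :=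
  mulOp (fun ξ => ((1 - psiGe χ 1 ‖ξ‖ : ℝ) : ℂ)) f

/-- Directional frequency cutoff `Q^{e}_{j,l}` with symbol `ψ_{≥ j-l}(ξ·e)`. -/
def qproj {n : ℕ} (χ : ℝ → ℝ) (e : Eucl n) (j l : ℤ) (f : Eucl n → ℂ) : Eucl n → ℂ :=
  mulOp (fun ξ => ((psiGe χ (j - l) (inner ℝ ξ e : ℝ) : ℝ) : ℂ)) f

/-- `P_j` acting in the space variable of a space-time function. -/
def projT {n : ℕ} (χ : ℝ → ℝ) (j : ℤ) (u : ℝ × Eucl n → ℂ) : ℝ × Eucl n → ℂ :=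
  fun p => proj χ j (fun y => u (p.1, y)) p.2

/-- `P_{≤0}` acting in the space variable of a space-time function. -/
def lowProjT {n : ℕ} (χ : ℝ → ℝ) (u : ℝ × Eucl n → ℂ) : ℝ × Eucl n → ℂ :=
  fun p => lowProj χ (fun y => u (p.1, y)) p.2

/-- `Q^{e}_{j,l}` acting in the space variable of a space-time function. -/
def qprojT {n : ℕ} (χ : ℝ → ℝ) (e : Eucl n) (j l : ℤ) (u : ℝ × Eucl n → ℂ) :
    ℝ × Eucl n → ℂ :=
  fun p => qproj χ e j l (fun y => u (p.1, y)) p.2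

/-- The hyperplane `P_e = {ξ : ξ·e = 0}`. -/
def hyperplane {n : ℕ} (e : Eucl n) : Submodule ℝ (Eucl n) := (ℝ ∙ e)ᗮ

/-- Inner part of the anisotropic norm: the `L^q` norm over `P_e × ℝ` of
`(t,v) ↦ u(t, re + v)`. -/
def innerQ {n : ℕ} (q : ℝ≥0∞) (e : Eucl n) (u : ℝ × Eucl n → ℂ) (r : ℝ) : ℝ≥0∞ :=
  eLpNorm (fun tv : ℝ × (hyperplane e) => u (tv.1, r • e + (tv.2 : Eucl n))) q volume

/-- The anisotropic norm `‖u‖_{L^{p,q}_e}`. -/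
def aniNorm {n : ℕ} (p q : ℝ≥0∞) (e : Eucl n) (u : ℝ × Eucl n → ℂ) : ℝ≥0∞ :=
  if p = ∞ then essSup (innerQ q e u) volume
  else (∫⁻ r : ℝ, innerQ q e u r ^ p.toReal) ^ (1 / p.toReal)

/-- The mixed space-time norm `‖u‖_{L^q_t L^r_x}`. -/
def mixNorm {n : ℕ} (q r : ℝ≥0∞) (u : ℝ × Eucl n → ℂ) : ℝ≥0∞ :=
  if q = ∞ then essSup (fun t => eLpNorm (fun x => u (t, x)) r volume) volume
  else (∫⁻ t : ℝ, eLpNorm (fun x => u (t, x)) r volume ^ q.toReal) ^ (1 / q.toReal)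

/-- `2^a` as an extended nonnegative real. -/
def tp (a : ℝ) : ℝ≥0∞ := ENNReal.ofReal ((2 : ℝ) ^ a)

/-- Homogeneous Besov norm `‖φ‖_{Ḃ^s_{2,1}}`. -/
def homBesov {n : ℕ} (χ : ℝ → ℝ) (s : ℝ) (φ : Eucl n → ℂ) : ℝ≥0∞ :=
  ∑' j : ℤ, tp (s * j) * eLpNorm (proj χ j φ) 2 volume

/-- Inhomogeneous Besov norm `‖φ‖_{B^s_{2,1}}`. -/
def besov {n : ℕ} (χ : ℝ → ℝ) (s : ℝ) (φ : Eucl n → ℂ) : ℝ≥0∞ :=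
  eLpNorm (lowProj χ φ) 2 volume
    + ∑' j : ℕ, tp (s * (j + 1)) * eLpNorm (proj χ (j + 1) φ) 2 volume

/-- The supremum over unit vectors, auxiliary notation. -/
def sphSup {n : ℕ} (g : Eucl n → ℝ≥0∞) : ℝ≥0∞ := ⨆ (e : Eucl n) (_ : ‖e‖ = 1), g e

/-- `‖P_j u‖_{M^m_j} = 2^{-(n/2-1/(m-1))j} sup_e ‖P_j u‖_{L^{m-1,∞}_e}`. -/
def MmJ {n : ℕ} (χ : ℝ → ℝ) (m : ℕ) (j : ℤ) (u : ℝ × Eucl n → ℂ) : ℝ≥0∞ :=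
  tp (-((n : ℝ) / 2 - 1 / ((m : ℝ) - 1)) * j)
    * sphSup (fun e => aniNorm ((m : ℝ≥0∞) - 1) ∞ e (projT χ j u))

/-- `‖P_j u‖_{S_j} = 2^{j/2} sup_e ‖P_j Q^{e_±}_{j,20} u‖_{L^{∞,2}_e}`. -/
def SJ {n : ℕ} (ε : Fin n → ℝ) (χ : ℝ → ℝ) (j : ℤ) (u : ℝ × Eucl n → ℂ) : ℝ≥0∞ :=
  tp ((j : ℝ) / 2)
    * sphSup (fun e => aniNorm ∞ 2 e (projT χ j (qprojT χ (epm ε e) j 20 u)))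

/-- `‖P_j u‖_{T_j} = ‖P_j u‖_{L^∞_t L²_x}`. -/
def TJ {n : ℕ} (χ : ℝ → ℝ) (j : ℤ) (u : ℝ × Eucl n → ℂ) : ℝ≥0∞ :=
  mixNorm ∞ 2 (projT χ j u)

/-- `‖P_j u‖_{Y^m_j}`. -/
def YmJ {n : ℕ} (ε : Fin n → ℝ) (χ : ℝ → ℝ) (m : ℕ) (j : ℤ) (u : ℝ × Eucl n → ℂ) : ℝ≥0∞ :=
  MmJ χ m j u + SJ ε χ j u + TJ χ j u

/-- The homogeneous resolution norm `‖u‖_{Ż^σ_{2,1}}`. -/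
def Zhom {n : ℕ} (ε : Fin n → ℝ) (χ : ℝ → ℝ) (m : ℕ) (σ : ℝ) (u : ℝ × Eucl n → ℂ) : ℝ≥0∞ :=
  ∑' j : ℤ, tp (σ * j) * YmJ ε χ m j u

/-- `N_j`-norm of a function: `2^{-j/2} sup_e ‖f‖_{L^{1,2}_e}`. -/
def NJraw {n : ℕ} (j : ℤ) (f : ℝ × Eucl n → ℂ) : ℝ≥0∞ :=
  tp (-(j : ℝ) / 2) * sphSup (fun e => aniNorm 1 2 e f)

/-- `‖P_j u‖_{N_j}`. -/
def NJ {n : ℕ} (χ : ℝ → ℝ) (j : ℤ) (u : ℝ × Eucl n → ℂ) : ℝ≥0∞ :=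
  NJraw j (projT χ j u)

/-- The homogeneous nonlinear norm `‖F‖_{Ṅ^σ_{2,1}}`. -/
def Nhom {n : ℕ} (χ : ℝ → ℝ) (σ : ℝ) (F : ℝ × Eucl n → ℂ) : ℝ≥0∞ :=
  ∑' j : ℤ, tp (σ * j) * NJ χ j F

/-- `‖P_j u‖_{T̃_j} = ‖P_j u‖_{L^∞_t L²_x} + ‖P_j u‖_{L^{2+4/n}_{t,x}}`. -/
def TtilJ {n : ℕ} (χ : ℝ → ℝ) (j : ℤ) (u : ℝ × Eucl n → ℂ) : ℝ≥0∞ :=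
  mixNorm ∞ 2 (projT χ j u)
    + eLpNorm (projT χ j u) (ENNReal.ofReal (2 + 4 / (n : ℝ))) volume

/-- `‖P_j u‖_{M̃_j} = sup_{p ∈ ℤ, p ≥ 2, np ≥ 6} sup_e 2^{(n/2-1/p)j}‖P_j u‖_{L^{p,∞}_e}`. -/
def MtilJ {n : ℕ} (χ : ℝ → ℝ) (j : ℤ) (u : ℝ × Eucl n → ℂ) : ℝ≥0∞ :=
  ⨆ (p : ℕ) (_ : 2 ≤ p ∧ 6 ≤ n * p),
    sphSup (fun e => tp (((n : ℝ) / 2 - 1 / (p : ℝ)) * j) * aniNorm (p : ℝ≥0∞) ∞ e (projT χ j u))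

/-- `‖P_j u‖_{Ỹ_j}`. -/
def YtilJ {n : ℕ} (ε : Fin n → ℝ) (χ : ℝ → ℝ) (j : ℤ) (u : ℝ × Eucl n → ℂ) : ℝ≥0∞ :=
  MtilJ χ j u + SJ ε χ j u + TtilJ χ j u

/-- The inhomogeneous resolution norm `‖u‖_{Z̃^σ_{2,1}}`. -/
def Ztil {n : ℕ} (ε : Fin n → ℝ) (χ : ℝ → ℝ) (σ : ℝ) (u : ℝ × Eucl n → ℂ) : ℝ≥0∞ :=
  (∑' j : ℤ, if j ≤ 0 then YtilJ ε χ j u ^ 2 else 0) ^ ((1 : ℝ) / 2)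
    + ∑' j : ℤ, if 1 ≤ j then tp (σ * j) * YtilJ ε χ j u else 0

/-- `‖f‖_{Ñ_j}`: infimum over decompositions `f = v + w`. -/
def NtilJraw {n : ℕ} (j : ℤ) (f : ℝ × Eucl n → ℂ) : ℝ≥0∞ :=
  ⨅ (vw : (ℝ × Eucl n → ℂ) × (ℝ × Eucl n → ℂ)) (_ : f = vw.1 + vw.2),
    NJraw j vw.1 + eLpNorm vw.2 (ENNReal.ofReal ((2 * (n : ℝ) + 4) / ((n : ℝ) + 4))) volume

/-- The inhomogeneous nonlinear norm `‖F‖_{Ñ^σ_{2,1}}`. -/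
def Ntil {n : ℕ} (χ : ℝ → ℝ) (σ : ℝ) (F : ℝ × Eucl n → ℂ) : ℝ≥0∞ :=
  (∑' j : ℤ, if j ≤ 0 then NtilJraw j (projT χ j F) ^ 2 else 0) ^ ((1 : ℝ) / 2)
    + ∑' j : ℤ, if 1 ≤ j then tp (σ * j) * NtilJraw j (projT χ j F) else 0

/-- `k`-th spatial partial derivative of a space-time function. -/
def pd {n : ℕ} (k : ℕ) (u : ℝ × Eucl n → ℂ) (p : ℝ × Eucl n) : ℂ :=
  if h : k < n then fderiv ℝ (fun y => u (p.1, y)) p.2 (EuclideanSpace.single ⟨k, h⟩ (1 : ℝ))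
  else 0

/-- The retarded Duhamel integral `∫_0^t W_±(t-s) G(s) ds`. -/
def duhamel {n : ℕ} (ε : Fin n → ℝ) (G : ℝ × Eucl n → ℂ) (p : ℝ × Eucl n) : ℂ :=
  ∫ s in (0 : ℝ)..p.1, prop ε (p.1 - s) (fun y => G (s, y)) p.2

/-- Admissible Strichartz pair: `2/q = n(1/2 - 1/r)`, `q, r ≥ 2`, and `q ≠ 2` when `n = 2`. -/
def Admissible (n : ℕ) (q r : ℝ) : Prop :=
  2 / q = (n : ℝ) * (1 / 2 - 1 / r) ∧ 2 ≤ q ∧ 2 ≤ r ∧ (n = 2 → q ≠ 2)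

/-- Value of a power series with coefficients `c` at `z`. -/
def polyVal {d : ℕ} (c : (Fin d →₀ ℕ) → ℂ) (z : Fin d → ℂ) : ℂ :=
  ∑' β : Fin d →₀ ℕ, c β * ∏ i, z i ^ β i

/-- The argument vector `(u, ū, ∇u, ∇ū)` of the general nonlinearity. -/
def nlArg {n : ℕ} (u : ℝ × Eucl n → ℂ) (p : ℝ × Eucl n) (i : Fin (2 * n + 2)) : ℂ :=
  if (i : ℕ) = 0 then u p
  else if (i : ℕ) = 1 then starRingEnd ℂ (u p)
  else if (i : ℕ) < n + 2 then pd ((i : ℕ) - 2) u p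
  else pd ((i : ℕ) - (n + 2)) (fun q => starRingEnd ℂ (u q)) p

/-- The argument vector `(∇u, ∇ū)` of a nonlinearity in `2n` variables. -/
def gradArg {n : ℕ} (u : ℝ × Eucl n → ℂ) (p : ℝ × Eucl n) (i : Fin (2 * n)) : ℂ :=
  if (i : ℕ) < n then pd (i : ℕ) u p
  else pd ((i : ℕ) - n) (fun q => starRingEnd ℂ (u q)) p

end DNLS
open DNLS

namespace DNLS

/-- A symmetric Young-type inequality for the quadratic form of a convolution kernel. -/
theorem lintegral_young_form {p : ℝ} (hp : 2 ≤ p) {w k : ℝ → ℝ≥0∞} (hw : Measurable w)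
    (hk : Measurable k) :
    ∫⁻ x, ∫⁻ y, w x * w y * k (x - y) ≤
      (∫⁻ x, w x ^ (p / (p - 1))) ^ (2 * (1 - 1 / p)) * (∫⁻ x, k x ^ (p / 2)) ^ (2 / p) := by
  have hp0 : 0 < p := by linarith
  have hp1 : 0 < p - 1 := by linarith
  set s := p / (p - 1) with hs
  have hs0 : 0 < s := by positivity
  set W := ∫⁻ x, w x ^ s with hW
  set K := ∫⁻ x, k x ^ (p / 2) with hK
  have hkm : Measurable fun z : ℝ × ℝ => k (z.1 - z.2) ^ (p / 2) :=
    (hk.comp (measurable_fst.sub measurable_snd)).pow_const _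
  have h1m : Measurable fun z : ℝ × ℝ => w z.1 ^ s := (hw.comp measurable_fst).pow_const _
  have h2m : Measurable fun z : ℝ × ℝ => w z.2 ^ s := (hw.comp measurable_snd).pow_const _
  have e1 : ∫⁻ z : ℝ × ℝ, w z.1 ^ s * w z.2 ^ s ∂(volume.prod volume) = W * W := by
    rw [lintegral_prod_mul (f := fun x => w x ^ s) (g := fun x => w x ^ s)
      (hw.pow_const _).aemeasurable (hw.pow_const _).aemeasurable]
  have e2 : ∫⁻ z : ℝ × ℝ, w z.1 ^ s * k (z.1 - z.2) ^ (p / 2) ∂(volume.prod volume) = W * K := by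
    have hm : Measurable fun z : ℝ × ℝ => w z.1 ^ s * k (z.1 - z.2) ^ (p / 2) := h1m.mul hkm
    rw [lintegral_prod _ hm.aemeasurable]
    have : ∀ x : ℝ, ∫⁻ y, w x ^ s * k (x - y) ^ (p / 2) = w x ^ s * K := by
      intro x
      rw [lintegral_const_mul _ (show Measurable fun y => k (x - y) ^ (p / 2) from
        (hk.comp (measurable_const.sub measurable_id)).pow_const _)]
      rw [lintegral_sub_left_eq_self (fun y => k y ^ (p / 2)) x]
    simp only [this]
    rw [lintegral_mul_const _ (hw.pow_const _)]
  have e3 : ∫⁻ z : ℝ × ℝ, w z.2 ^ s * k (z.1 - z.2) ^ (p / 2) ∂(volume.prod volume) = W * K := by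
    have hm : Measurable fun z : ℝ × ℝ => w z.2 ^ s * k (z.1 - z.2) ^ (p / 2) := h2m.mul hkm
    rw [lintegral_prod_symm _ hm.aemeasurable]
    have : ∀ y : ℝ, ∫⁻ x, w y ^ s * k (x - y) ^ (p / 2) = w y ^ s * K := by
      intro y
      rw [lintegral_const_mul _ (show Measurable fun x => k (x - y) ^ (p / 2) from
        (hk.comp (measurable_id.sub measurable_const)).pow_const _)]
      rw [lintegral_sub_right_eq_self (fun y => k y ^ (p / 2)) y]
    simp only [this]
    rw [lintegral_mul_const _ (hw.pow_const _)]
  have hmain : ∫⁻ z : ℝ × ℝ, w z.1 * w z.2 * k (z.1 - z.2) ∂(volume.prod volume) ≤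
      (W * W) ^ (1 - 2 / p) * (((W * K) ^ (1 / 2 : ℝ) * (W * K) ^ (1 / 2 : ℝ))) ^ (2 / p) := by
    have h2p : 0 ≤ 1 - 2 / p := by
      rw [sub_nonneg, div_le_one hp0]; exact hp
    have step := ENNReal.lintegral_mul_norm_pow_le (μ := (volume : Measure ℝ).prod volume)
      (f := fun z => w z.1 ^ s * w z.2 ^ s)
      (g := fun z => (w z.1 ^ s * k (z.1 - z.2) ^ (p / 2)) ^ (1 / 2 : ℝ) *
        (w z.2 ^ s * k (z.1 - z.2) ^ (p / 2)) ^ (1 / 2 : ℝ))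
      (h1m.mul h2m).aemeasurable
      ((((h1m.mul hkm).pow_const _).mul ((h2m.mul hkm).pow_const _)).aemeasurable)
      h2p (by positivity : 0 ≤ 2 / p) (by ring)
    have step2 := ENNReal.lintegral_mul_norm_pow_le (μ := (volume : Measure ℝ).prod volume)
      (h1m.mul hkm).aemeasurable (h2m.mul hkm).aemeasurable
      (by norm_num : (0 : ℝ) ≤ 1 / 2) (by norm_num : (0 : ℝ) ≤ 1 / 2) (by norm_num)
    rw [e1] at step
    simp only [Pi.mul_apply] at step2
    rw [e2, e3] at step2
    calc _ = _ := ?_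
      _ ≤ _ := step
      _ ≤ _ := by gcongr
    refine lintegral_congr fun z => ?_
    have hx : ∀ a : ℝ≥0∞, (a ^ s) ^ (1 - 2 / p) * (a ^ s) ^ (1 / p) = a := by
      intro a
      rw [← ENNReal.rpow_add_of_nonneg _ _ h2p (by positivity), ← ENNReal.rpow_mul]
      have : s * (1 - 2 / p + 1 / p) = 1 := by rw [hs]; field_simp; ring
      rw [this, ENNReal.rpow_one]
    have hk' : ∀ a : ℝ≥0∞, (a ^ (p / 2)) ^ (1 / p) * (a ^ (p / 2)) ^ (1 / p) = a := by
      intro a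
      rw [← ENNReal.rpow_add_of_nonneg _ _ (by positivity) (by positivity), ← ENNReal.rpow_mul]
      have : p / 2 * (1 / p + 1 / p) = 1 := by field_simp; ring
      rw [this, ENNReal.rpow_one]
    have h12 : (1 / 2 : ℝ) * (2 / p) = 1 / p := by ring
    rw [ENNReal.mul_rpow_of_nonneg _ _ h2p, ENNReal.mul_rpow_of_nonneg _ _ (by positivity : 0 ≤ 2 / p),
      ← ENNReal.rpow_mul _ (1 / 2) (2 / p), ← ENNReal.rpow_mul _ (1 / 2) (2 / p), h12,
      ENNReal.mul_rpow_of_nonneg _ _ (by positivity : 0 ≤ 1 / p),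
      ENNReal.mul_rpow_of_nonneg _ _ (by positivity : 0 ≤ 1 / p)]
    calc w z.1 * w z.2 * k (z.1 - z.2) = ((w z.1 ^ s) ^ (1 - 2 / p) * (w z.1 ^ s) ^ (1 / p)) *
          ((w z.2 ^ s) ^ (1 - 2 / p) * (w z.2 ^ s) ^ (1 / p)) *
          ((k (z.1 - z.2) ^ (p / 2)) ^ (1 / p) * (k (z.1 - z.2) ^ (p / 2)) ^ (1 / p)) := by
            rw [hx, hx, hk']
      _ = _ := by ring
  rw [lintegral_lintegral (f := fun x y => w x * w y * k (x - y))]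
  swap
  · exact (((hw.comp measurable_fst).mul (hw.comp measurable_snd)).mul
      (hk.comp (measurable_fst.sub measurable_snd))).aemeasurable
  refine hmain.trans (le_of_eq ?_)
  have h2p : 0 ≤ 1 - 2 / p := by
    rw [sub_nonneg, div_le_one hp0]; exact hp
  rw [← ENNReal.rpow_add_of_nonneg _ _ (by norm_num) (by norm_num)]
  norm_num only [ENNReal.rpow_one]
  rw [ENNReal.mul_rpow_of_nonneg _ _ h2p, ENNReal.mul_rpow_of_nonneg _ _ (by positivity : 0 ≤ 2 / p),
    ← mul_assoc, ← ENNReal.rpow_add_of_nonneg _ _ h2p h2p,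
    ← ENNReal.rpow_add_of_nonneg _ _ (by linarith) (by positivity)]
  congr 2
  ring

theorem lintegral_Ioc_rpow {β : ℝ} (hβ : 0 < β) {X : ℝ} (hX : 0 ≤ X) :
    ∫⁻ l in Set.Ioc 0 X, ENNReal.ofReal (β * l ^ (β - 1)) = ENNReal.ofReal (X ^ β) := by
  have hint : IntervalIntegrable (fun l : ℝ => β * l ^ (β - 1)) volume 0 X :=
    (intervalIntegral.intervalIntegrable_rpow' (by linarith)).const_mul _
  rw [← ofReal_integral_eq_lintegral_ofReal]
  · rw [← intervalIntegral.integral_of_le hX, intervalIntegral.integral_const_mul,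
      integral_rpow (Or.inl (by linarith))]
    congr 1
    rw [sub_add_cancel, Real.zero_rpow hβ.ne', sub_zero]
    field_simp
  · exact (intervalIntegrable_iff_integrableOn_Ioc_of_le hX).1 hint
  · filter_upwards [ae_restrict_mem measurableSet_Ioc] with l hl
    have := hl.1
    show 0 ≤ β * l ^ (β - 1)
    positivity

theorem rpow_le_lintegral_Ioi_indicator {β : ℝ} (hβ : 0 < β) (x : ℝ≥0∞) :
    x ^ β ≤ ∫⁻ l in Set.Ioi (0 : ℝ),
      {l : ℝ | ENNReal.ofReal l < x}.indicator (fun l => ENNReal.ofReal (β * l ^ (β - 1))) l := by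
  have key : ∀ X : ℝ, 0 ≤ X → ENNReal.ofReal X ≤ x → ENNReal.ofReal (X ^ β) ≤
      ∫⁻ l in Set.Ioi (0 : ℝ), {l : ℝ | ENNReal.ofReal l < x}.indicator
        (fun l => ENNReal.ofReal (β * l ^ (β - 1))) l := by
    intro X hX hx
    rw [← lintegral_Ioc_rpow hβ hX, ← restrict_Ioo_eq_restrict_Ioc]
    calc _ ≤ ∫⁻ l in Set.Ioo 0 X, {l : ℝ | ENNReal.ofReal l < x}.indicator
            (fun l => ENNReal.ofReal (β * l ^ (β - 1))) l := by
          refine setLIntegral_mono' measurableSet_Ioo fun l hl => ?_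
          rw [Set.indicator_of_mem]
          exact ((ENNReal.ofReal_lt_ofReal_iff (hl.1.trans hl.2)).2 hl.2).trans_le hx
      _ ≤ _ := lintegral_mono_set Set.Ioo_subset_Ioi_self
  rcases eq_or_ne x ∞ with rfl | hx
  · rw [ENNReal.top_rpow_of_pos hβ]
    refine le_of_eq (Eq.symm (ENNReal.eq_top_of_forall_nnreal_le fun r => ?_))
    have := key ((r : ℝ) ^ (1 / β)) (by positivity) le_top
    rwa [← Real.rpow_mul r.coe_nonneg, one_div_mul_cancel hβ.ne', Real.rpow_one,
      ENNReal.ofReal_coe_nnreal] at this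
  · have := key x.toReal ENNReal.toReal_nonneg (by rw [ENNReal.ofReal_toReal hx])
    rwa [← ENNReal.ofReal_rpow_of_nonneg ENNReal.toReal_nonneg hβ.le,
      ENNReal.ofReal_toReal hx] at this

theorem lintegral_Ioi_indicator_le_rpow {β : ℝ} (hβ : 0 < β) (x : ℝ≥0∞) :
    ∫⁻ l in Set.Ioi (0 : ℝ),
      {l : ℝ | ENNReal.ofReal l ≤ x}.indicator (fun l => ENNReal.ofReal (β * l ^ (β - 1))) l
      ≤ x ^ β := by
  rcases eq_or_ne x ∞ with rfl | hx
  · simp [ENNReal.top_rpow_of_pos hβ]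
  rw [← lintegral_indicator measurableSet_Ioi]
  calc _ ≤ ∫⁻ l, (Set.Ioc 0 x.toReal).indicator (fun l => ENNReal.ofReal (β * l ^ (β - 1))) l := by
        refine lintegral_mono fun l => ?_
        by_cases h0 : l ∈ Set.Ioi (0 : ℝ)
        · rw [Set.indicator_of_mem h0]
          by_cases h1 : ENNReal.ofReal l ≤ x
          · have h2 : l ∈ Set.Ioc 0 x.toReal :=
              ⟨h0, (ENNReal.ofReal_le_iff_le_toReal hx).1 h1⟩
            rw [Set.indicator_of_mem h2]
            exact Set.indicator_le_self _ _ _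
          · rw [Set.indicator_of_notMem (show l ∉ {l : ℝ | ENNReal.ofReal l ≤ x} from h1)]
            exact zero_le
        · rw [Set.indicator_of_notMem h0]; exact zero_le
    _ = ENNReal.ofReal (x.toReal ^ β) := by
        rw [lintegral_indicator measurableSet_Ioc, lintegral_Ioc_rpow hβ ENNReal.toReal_nonneg]
    _ = x ^ β := by
        rw [← ENNReal.ofReal_rpow_of_nonneg ENNReal.toReal_nonneg hβ.le, ENNReal.ofReal_toReal hx]

/-- A layer-cake bound: a weak-type estimate with a moving threshold integrates to a
strong-type estimate. -/
theorem lintegral_rpow_le_of_distribution {X Y : Type*} [MeasurableSpace X] [MeasurableSpace Y]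
    {μ : Measure X} {ν : Measure Y} [SFinite μ] [SFinite ν] {q α : ℝ} (hq : 0 < q) (hα : α < q)
    {J : X → ℝ≥0∞} (hJ : Measurable J) {w Λ : Y → ℝ≥0∞} (hw : Measurable w) (hΛ : Measurable Λ)
    (h : ∀ l : ℝ, 0 < l → μ {x | ENNReal.ofReal l < J x} ≤
      ENNReal.ofReal (l ^ (-α)) * ∫⁻ y, {y | ENNReal.ofReal l ≤ Λ y}.indicator w y ∂ν) :
    ∫⁻ x, J x ^ q ∂μ ≤ ENNReal.ofReal (q / (q - α)) * ∫⁻ y, w y * Λ y ^ (q - α) ∂ν := by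
  have hβ : 0 < q - α := by linarith
  have hA : MeasurableSet {z : X × ℝ | ENNReal.ofReal z.2 < J z.1} :=
    measurableSet_lt (ENNReal.measurable_ofReal.comp measurable_snd) (hJ.comp measurable_fst)
  have hB : MeasurableSet {z : ℝ × Y | ENNReal.ofReal z.1 ≤ Λ z.2} :=
    measurableSet_le (ENNReal.measurable_ofReal.comp measurable_fst) (hΛ.comp measurable_snd)
  have hpm : ∀ (c β : ℝ), Measurable fun l : ℝ => ENNReal.ofReal (c * l ^ β) := fun c β => by
    fun_prop
  calc ∫⁻ x, J x ^ q ∂μ ≤ ∫⁻ x, (∫⁻ l in Set.Ioi (0 : ℝ),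
        {z : X × ℝ | ENNReal.ofReal z.2 < J z.1}.indicator
          (fun z => ENNReal.ofReal (q * z.2 ^ (q - 1))) (x, l)) ∂μ :=
        lintegral_mono fun x => (rpow_le_lintegral_Ioi_indicator hq (J x))
    _ = ∫⁻ l in Set.Ioi (0 : ℝ), ∫⁻ x, {z : X × ℝ | ENNReal.ofReal z.2 < J z.1}.indicator
          (fun z => ENNReal.ofReal (q * z.2 ^ (q - 1))) (x, l) ∂μ := by
        rw [lintegral_lintegral_swap]
        exact (((hpm q (q - 1)).comp measurable_snd).indicator hA).aemeasurable
    _ = ∫⁻ l in Set.Ioi (0 : ℝ), ENNReal.ofReal (q * l ^ (q - 1)) *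
          μ {x | ENNReal.ofReal l < J x} := by
        refine lintegral_congr fun l => ?_
        rw [← lintegral_indicator_const (measurableSet_lt measurable_const hJ)]
        rfl
    _ ≤ ∫⁻ l in Set.Ioi (0 : ℝ), ∫⁻ y, ENNReal.ofReal (q / (q - α)) *
          ({z : ℝ × Y | ENNReal.ofReal z.1 ≤ Λ z.2}.indicator
          (fun z => w z.2 * ENNReal.ofReal ((q - α) * z.1 ^ (q - α - 1))) (l, y)) ∂ν := by
        refine setLIntegral_mono' measurableSet_Ioi fun l hl => ?_
        have hl : 0 < l := hl
        calc _ ≤ ENNReal.ofReal (q * l ^ (q - 1)) * (ENNReal.ofReal (l ^ (-α)) *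
              ∫⁻ y, {y | ENNReal.ofReal l ≤ Λ y}.indicator w y ∂ν) := by gcongr; exact h l hl
          _ = ENNReal.ofReal (q / (q - α)) * (ENNReal.ofReal ((q - α) * l ^ (q - α - 1)) *
              ∫⁻ y, {y | ENNReal.ofReal l ≤ Λ y}.indicator w y ∂ν) := by
              rw [← mul_assoc, ← mul_assoc, ← ENNReal.ofReal_mul (by positivity),
                ← ENNReal.ofReal_mul (by positivity)]
              congr 2
              have : l ^ (q - α - 1) = l ^ (q - 1) * l ^ (-α) := by
                rw [← Real.rpow_add hl]; congr 1; ring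
              rw [this]; field_simp
          _ = _ := by
              rw [← lintegral_const_mul _ (hw.indicator (measurableSet_le measurable_const hΛ)),
                ← lintegral_const_mul]
              · refine lintegral_congr fun y => ?_
                congr 1
                by_cases hy : ENNReal.ofReal l ≤ Λ y
                · rw [Set.indicator_of_mem (show y ∈ {y | ENNReal.ofReal l ≤ Λ y} from hy),
                    Set.indicator_of_mem
                      (show (l, y) ∈ {z : ℝ × Y | ENNReal.ofReal z.1 ≤ Λ z.2} from hy), mul_comm]
                · rw [Set.indicator_of_notMem (show y ∉ {y | ENNReal.ofReal l ≤ Λ y} from hy),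
                    Set.indicator_of_notMem
                      (show (l, y) ∉ {z : ℝ × Y | ENNReal.ofReal z.1 ≤ Λ z.2} from hy), mul_zero]
              · exact measurable_const.mul (hw.indicator (measurableSet_le measurable_const hΛ))
    _ = ∫⁻ y, (∫⁻ l in Set.Ioi (0 : ℝ), ENNReal.ofReal (q / (q - α)) *
          ({z : ℝ × Y | ENNReal.ofReal z.1 ≤ Λ z.2}.indicator
          (fun z => w z.2 * ENNReal.ofReal ((q - α) * z.1 ^ (q - α - 1))) (l, y))) ∂ν := by
        rw [lintegral_lintegral_swap]
        exact (measurable_const.mul (((hw.comp measurable_snd).mul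
          ((hpm (q - α) (q - α - 1)).comp measurable_fst)).indicator hB)).aemeasurable
    _ ≤ ∫⁻ y, ENNReal.ofReal (q / (q - α)) * (w y * Λ y ^ (q - α)) ∂ν := by
        refine lintegral_mono fun y => ?_
        have hBy : MeasurableSet {l : ℝ | ENNReal.ofReal l ≤ Λ y} :=
          measurableSet_le ENNReal.measurable_ofReal measurable_const
        calc _ = ∫⁻ l in Set.Ioi (0 : ℝ), ENNReal.ofReal (q / (q - α)) * (w y *
              {l : ℝ | ENNReal.ofReal l ≤ Λ y}.indicator
              (fun l => ENNReal.ofReal ((q - α) * l ^ (q - α - 1))) l) := by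
                refine lintegral_congr fun l => ?_
                congr 1
                by_cases hy : ENNReal.ofReal l ≤ Λ y
                · rw [Set.indicator_of_mem (show l ∈ {l : ℝ | ENNReal.ofReal l ≤ Λ y} from hy),
                    Set.indicator_of_mem
                      (show (l, y) ∈ {z : ℝ × Y | ENNReal.ofReal z.1 ≤ Λ z.2} from hy)]
                · rw [Set.indicator_of_notMem (show l ∉ {l : ℝ | ENNReal.ofReal l ≤ Λ y} from hy),
                    Set.indicator_of_notMem
                      (show (l, y) ∉ {z : ℝ × Y | ENNReal.ofReal z.1 ≤ Λ z.2} from hy), mul_zero]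
          _ ≤ _ := by
                have hm := (hpm (q - α) (q - α - 1)).indicator hBy
                rw [lintegral_const_mul _ (hm.const_mul _), lintegral_const_mul _ hm]
                gcongr
                exact lintegral_Ioi_indicator_le_rpow hβ _
    _ = _ := lintegral_const_mul _ (hw.mul (hΛ.pow_const _))

theorem lintegral_Ioi_rpow_neg_two {R : ℝ} (hR : 0 < R) :
    ∫⁻ x in Set.Ioi R, ENNReal.ofReal (x ^ (-2 : ℝ)) = ENNReal.ofReal (1 / R) := by
  rw [← ofReal_integral_eq_lintegral_ofReal]
  · rw [integral_Ioi_rpow_of_lt (by norm_num) hR]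
    congr 1
    norm_num
    rw [Real.rpow_neg_one]
  · exact integrableOn_Ioi_rpow_of_lt (by norm_num) hR
  · filter_upwards [ae_restrict_mem measurableSet_Ioi] with x hx
    exact Real.rpow_nonneg (hR.trans hx).le _

/-- The one-sided Riesz kernel `x₊^{-2/q}`. -/
def rieszKer (q : ℝ) : ℝ → ℝ≥0∞ := (Set.Ioi 0).indicator fun x => ENNReal.ofReal (x ^ (-(2 / q)))

theorem measurable_rieszKer (q : ℝ) : Measurable (rieszKer q) :=
  Measurable.indicator (by fun_prop) measurableSet_Ioi

theorem measure_lt_rieszKer_conv_le {q : ℝ} (hq : 2 < q) {a : ℝ → ℝ≥0∞} (ha : Measurable a)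
    (hN : ∫⁻ s, a s ^ (q / (q - 1)) = 1) {l : ℝ} (hl : 0 < l) :
    volume {t | ENNReal.ofReal l < ∫⁻ s, a s * rieszKer q (t - s)} ≤
      ENNReal.ofReal (l ^ (-(q - 1))) *
        ∫⁻ s, {s | ENNReal.ofReal l ≤
          (ENNReal.ofReal (3 ^ (q - 1) / (1 - 2 / q)) * a s) ^ (1 / (q - 1))}.indicator
          (fun s => ENNReal.ofReal (3 ^ (q - 1) / (1 - 2 / q)) * a s) s := by
  have hq0 : 0 < q := by linarith
  have hq1 : 0 < q - 1 := by linarith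
  have hβ : 0 < 1 - 2 / q := by rw [sub_pos, div_lt_one hq0]; exact hq
  set β := 1 - 2 / q with hβdef
  set c := 3 ^ (q - 1) / β with hc
  have hc0 : 0 < c := by positivity
  set R : ℝ := (3 / l) ^ q with hRdef
  have hR : 0 < R := by positivity
  set h : ℝ := l ^ (q - 1) / c with hh
  have hh0 : 0 < h := by positivity
  set kn : ℝ → ℝ≥0∞ := (Set.Ioc 0 R).indicator fun x => ENNReal.ofReal (x ^ (-(2 / q))) with hkn
  set kt : ℝ → ℝ≥0∞ := (Set.Ioi R).indicator fun x => ENNReal.ofReal (x ^ (-(2 / q))) with hkt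
  have hknm : Measurable kn := Measurable.indicator (by fun_prop) measurableSet_Ioc
  have hktm : Measurable kt := Measurable.indicator (by fun_prop) measurableSet_Ioi
  have hk : ∀ x, rieszKer q x = kn x + kt x := by
    intro x
    simp only [rieszKer, hkn, hkt, Set.indicator_apply, Set.mem_Ioi, Set.mem_Ioc]
    by_cases h1 : 0 < x
    · by_cases h2 : x ≤ R
      · simp [h1, h2, not_lt.2 h2]
      · simp [h1, h2, not_le.1 h2]
    · have : ¬ R < x := fun h => h1 (hR.trans h)
      simp [h1, this]
  set κ : ℝ := R ^ β / β with hκ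
  have hκ0 : 0 < κ := by positivity
  have hkn_int : ∫⁻ x, kn x = ENNReal.ofReal κ := by
    rw [hkn, lintegral_indicator measurableSet_Ioc]
    have := lintegral_Ioc_rpow hβ hR.le
    have e : ∀ x : ℝ, ENNReal.ofReal (β * x ^ (β - 1)) =
        ENNReal.ofReal β * ENNReal.ofReal (x ^ (-(2 / q))) := by
      intro x
      rw [← ENNReal.ofReal_mul hβ.le]; congr 3; rw [hβdef]; ring
    simp only [e] at this
    rw [lintegral_const_mul _ (by fun_prop)] at this
    rw [hκ, ENNReal.ofReal_div_of_pos hβ, ← this, mul_comm, ENNReal.mul_div_cancel_right]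
    · simpa using hβ
    · simp
  have hκh : κ * h = l / 3 := by
    have e1 : R ^ β = 3 ^ (q - 2) * l ^ (-(q - 2)) := by
      rw [hRdef, ← Real.rpow_mul (by positivity), Real.div_rpow (by norm_num) hl.le,
        Real.rpow_neg hl.le, div_eq_mul_inv]
      have : q * β = q - 2 := by rw [hβdef]; field_simp
      rw [this]
    have e2 : (3 : ℝ) ^ (q - 1) = 3 ^ (q - 2) * 3 := by
      rw [← Real.rpow_add_one (by norm_num)]; congr 1; ring
    have e3 : l ^ (q - 1) = l ^ (q - 2) * l := by
      rw [← Real.rpow_add_one hl.ne']; congr 1; ring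
    have e4 : l ^ (-(q - 2)) * l ^ (q - 2) = 1 := by
      rw [← Real.rpow_add hl]; simp
    rw [hκ, hh, hc, e1, e2, e3]
    have h3 : (0 : ℝ) < 3 ^ (q - 2) := by positivity
    field_simp
    linear_combination e4
  set a2 : ℝ → ℝ≥0∞ := {s | ENNReal.ofReal h < a s}.indicator a with ha2
  have hsm : MeasurableSet {s | ENNReal.ofReal h < a s} := measurableSet_lt measurable_const ha
  have ha2m : Measurable a2 := ha.indicator hsm
  set J : ℝ → ℝ≥0∞ := fun t => ∫⁻ s, a2 s * kn (t - s) with hJ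
  have hJ2 : Measurable fun z : ℝ × ℝ => a2 z.2 * kn (z.1 - z.2) :=
    (ha2m.comp measurable_snd).mul (hknm.comp (measurable_fst.sub measurable_snd))
  have hJm : Measurable J := hJ2.lintegral_prod_right'
  have tail : ∀ t, ∫⁻ s, a s * kt (t - s) ≤ ENNReal.ofReal (l / 3) := by
    intro t
    have hconj : (q / (q - 1)).HolderConjugate q := by
      have := Real.HolderConjugate.conjExponent (p := q) (by linarith)
      exact this.symm
    refine (ENNReal.lintegral_mul_le_Lp_mul_Lq volume hconj ha.aemeasurable
      (show AEMeasurable (fun s => kt (t - s)) volume from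
        (hktm.comp (measurable_const.sub measurable_id)).aemeasurable)).trans ?_
    rw [hN, ENNReal.one_rpow, one_mul, lintegral_sub_left_eq_self (fun y => kt y ^ q) t]
    have : ∀ y, kt y ^ q = (Set.Ioi R).indicator (fun x => ENNReal.ofReal (x ^ (-2 : ℝ))) y := by
      intro y
      simp only [hkt, Set.indicator_apply, Set.mem_Ioi]
      split_ifs with hy
      · have hy0 := hR.trans hy
        rw [ENNReal.ofReal_rpow_of_pos (by positivity), ← Real.rpow_mul hy0.le]
        congr 2; field_simp
      · simp [hq0]
    simp only [this]
    rw [lintegral_indicator measurableSet_Ioi, lintegral_Ioi_rpow_neg_two hR,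
      ENNReal.ofReal_rpow_of_pos (by positivity)]
    refine ENNReal.ofReal_le_ofReal (le_of_eq ?_)
    rw [hRdef, one_div, ← Real.inv_rpow (by positivity),
      ← Real.rpow_mul (by positivity), mul_one_div_cancel hq0.ne', Real.rpow_one, inv_div]
  have low : ∀ t, ∫⁻ s, ENNReal.ofReal h * kn (t - s) ≤ ENNReal.ofReal (l / 3) := by
    intro t
    rw [lintegral_const_mul _ (show Measurable fun s => kn (t - s) from
      hknm.comp (measurable_const.sub measurable_id)), lintegral_sub_left_eq_self kn t, hkn_int,
      ← ENNReal.ofReal_mul hh0.le, mul_comm, hκh]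
  have hI : ∀ t, ∫⁻ s, a s * rieszKer q (t - s) ≤
      ENNReal.ofReal (l / 3) + ENNReal.ofReal (l / 3) + J t := by
    intro t
    have m1 : Measurable fun s => kn (t - s) := hknm.comp (measurable_const.sub measurable_id)
    have m2 : Measurable fun s => kt (t - s) := hktm.comp (measurable_const.sub measurable_id)
    have m3 : Measurable fun s => a s * kt (t - s) := ha.mul m2
    have m4 : Measurable fun s => a s * kt (t - s) + ENNReal.ofReal h * kn (t - s) :=
      m3.add (m1.const_mul _)
    calc _ ≤ ∫⁻ s, (a s * kt (t - s) + ENNReal.ofReal h * kn (t - s) + a2 s * kn (t - s)) := by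
          refine lintegral_mono fun s => ?_
          simp only [hk, ha2, Set.indicator_apply, Set.mem_ofPred_eq]
          by_cases hs : ENNReal.ofReal h < a s
          · simp only [hs, if_true]
            rw [mul_add, add_comm (a s * kn _)]
            gcongr; exact le_self_add
          · simp only [hs, if_false, zero_mul, add_zero]
            rw [mul_add, add_comm (a s * kn _)]
            gcongr; exact not_lt.1 hs
      _ = (∫⁻ s, a s * kt (t - s)) + (∫⁻ s, ENNReal.ofReal h * kn (t - s)) + J t := by
          rw [lintegral_add_left m4, lintegral_add_left m3]
      _ ≤ _ := by exact add_le_add_left (add_le_add (tail t) (low t)) _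
  have hsub : {t | ENNReal.ofReal l < ∫⁻ s, a s * rieszKer q (t - s)} ⊆
      {t | ENNReal.ofReal (l / 3) ≤ J t} := by
    intro t ht
    by_contra hcon
    have hcon : J t < ENNReal.ofReal (l / 3) := not_le.1 hcon
    refine absurd (lt_of_lt_of_le ht (hI t)) (not_lt.2 ?_)
    calc _ ≤ ENNReal.ofReal (l / 3) + ENNReal.ofReal (l / 3) + ENNReal.ofReal (l / 3) := by
          gcongr
      _ = ENNReal.ofReal l := by
          rw [← ENNReal.ofReal_add (by positivity) (by positivity),
            ← ENNReal.ofReal_add (by positivity) (by positivity)]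
          congr 1; ring
  have hJint : ∫⁻ t, J t = ENNReal.ofReal κ * ∫⁻ s, a2 s := by
    rw [hJ, lintegral_lintegral_swap hJ2.aemeasurable]
    have : ∀ s, ∫⁻ t, a2 s * kn (t - s) = a2 s * ENNReal.ofReal κ := by
      intro s
      rw [lintegral_const_mul _ (show Measurable fun t => kn (t - s) from
        hknm.comp (measurable_id.sub measurable_const)), lintegral_sub_right_eq_self kn s, hkn_int]
    simp only [this]
    rw [lintegral_mul_const _ ha2m, mul_comm]
  calc _ ≤ volume {t | ENNReal.ofReal (l / 3) ≤ J t} := measure_mono hsub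
    _ ≤ (∫⁻ t, J t) / ENNReal.ofReal (l / 3) :=
        meas_ge_le_lintegral_div hJm.aemeasurable (by simpa using hl) ENNReal.ofReal_ne_top
    _ = ENNReal.ofReal (l ^ (-(q - 1))) * ∫⁻ s, ENNReal.ofReal c * a2 s := by
        rw [hJint, lintegral_const_mul _ ha2m, ← mul_assoc, ← ENNReal.ofReal_mul (by positivity),
          mul_comm, mul_div_assoc, ← ENNReal.ofReal_div_of_pos (by positivity), mul_comm]
        congr 2
        rw [← hκh, hh, Real.rpow_neg hl.le]
        field_simp
    _ ≤ _ := by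
        gcongr with s
        simp only [ha2, Set.indicator_apply, Set.mem_ofPred_eq]
        by_cases hs : ENNReal.ofReal h < a s
        · simp only [hs, if_true]
          rw [if_pos]
          have : ENNReal.ofReal (l ^ (q - 1)) ≤ ENNReal.ofReal c * a s := by
            calc _ = ENNReal.ofReal c * ENNReal.ofReal h := by
                  rw [← ENNReal.ofReal_mul hc0.le, hh]; congr 1; field_simp
              _ ≤ _ := by gcongr
          calc ENNReal.ofReal l = (ENNReal.ofReal (l ^ (q - 1))) ^ (1 / (q - 1)) := by
                rw [ENNReal.ofReal_rpow_of_pos (by positivity), ← Real.rpow_mul hl.le,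
                  mul_one_div_cancel hq1.ne', Real.rpow_one]
            _ ≤ _ := by gcongr
        · simp [hs]

theorem lintegral_rieszKer_conv_rpow_le {q : ℝ} (hq : 2 < q) {a : ℝ → ℝ≥0∞} (ha : Measurable a)
    (hN : ∫⁻ s, a s ^ (q / (q - 1)) = 1) :
    ∫⁻ t, (∫⁻ s, a s * rieszKer q (t - s)) ^ q ≤
      ENNReal.ofReal q * ENNReal.ofReal (3 ^ (q - 1) / (1 - 2 / q)) ^ (q / (q - 1)) := by
  have hq0 : 0 < q := by linarith
  have hq1 : 0 < q - 1 := by linarith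
  have hIm : Measurable fun t => ∫⁻ s, a s * rieszKer q (t - s) := by
    have : Measurable fun z : ℝ × ℝ => a z.2 * rieszKer q (z.1 - z.2) :=
      (ha.comp measurable_snd).mul
        ((measurable_rieszKer q).comp (measurable_fst.sub measurable_snd))
    exact this.lintegral_prod_right'
  set c := ENNReal.ofReal (3 ^ (q - 1) / (1 - 2 / q)) with hc
  have := lintegral_rpow_le_of_distribution (μ := (volume : Measure ℝ)) (ν := (volume : Measure ℝ))
    hq0 (show q - 1 < q by linarith) hIm (ha.const_mul c)
    ((ha.const_mul c).pow_const (1 / (q - 1)))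
    (fun l hl => measure_lt_rieszKer_conv_le hq ha hN hl)
  refine this.trans (le_of_eq ?_)
  have e : ∀ s, c * a s * ((c * a s) ^ (1 / (q - 1))) ^ (q - (q - 1)) =
      c ^ (q / (q - 1)) * a s ^ (q / (q - 1)) := by
    intro s
    rw [show q - (q - 1) = 1 by ring, ENNReal.rpow_one,
      ← ENNReal.mul_rpow_of_nonneg _ _ (by positivity)]
    nth_rewrite 1 [← ENNReal.rpow_one (c * a s)]
    rw [← ENNReal.rpow_add_of_nonneg _ _ (by norm_num) (by positivity)]
    congr 1; field_simp; ring
  simp only [e]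
  rw [lintegral_const_mul _ (ha.pow_const _), hN, mul_one, show q - (q - 1) = 1 by ring, div_one]

/-- The diagonal Hardy–Littlewood–Sobolev inequality on the line, for one-sided kernels. -/
theorem lintegral_rieszKer_form_le {q : ℝ} (hq : 2 < q) : ∃ C : ℝ≥0∞, C ≠ ∞ ∧
    ∀ a : ℝ → ℝ≥0∞, Measurable a →
      ∫⁻ t, ∫⁻ s, a t * (a s * rieszKer q (t - s)) ≤
        C * (∫⁻ s, a s ^ (q / (q - 1))) ^ (2 * ((q - 1) / q)) := by
  have hq0 : 0 < q := by linarith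
  have hq1 : 0 < q - 1 := by linarith
  set D := ENNReal.ofReal q * ENNReal.ofReal (3 ^ (q - 1) / (1 - 2 / q)) ^ (q / (q - 1)) with hD
  have hDt : D ≠ ∞ := ENNReal.mul_ne_top ENNReal.ofReal_ne_top
    (ENNReal.rpow_ne_top_of_nonneg (by positivity) ENNReal.ofReal_ne_top)
  refine ⟨D ^ (1 / q) + 1, ?_, fun a ha => ?_⟩
  · exact ENNReal.add_ne_top.2 ⟨ENNReal.rpow_ne_top_of_nonneg (by positivity) hDt, by simp⟩
  set N := ∫⁻ s, a s ^ (q / (q - 1)) with hN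
  rcases eq_or_ne N ∞ with hNt | hNt
  · rw [hNt, ENNReal.top_rpow_of_pos (by positivity), ENNReal.mul_top (by simp)]; exact le_top
  have hk2 : Measurable fun z : ℝ × ℝ => rieszKer q (z.1 - z.2) :=
    (measurable_rieszKer q).comp (measurable_fst.sub measurable_snd)
  have hkt : ∀ t, Measurable fun s => rieszKer q (t - s) := fun t =>
    (measurable_rieszKer q).comp (measurable_const.sub measurable_id)
  rcases eq_or_ne N 0 with hN0 | hN0
  · have h0 : a =ᵐ[volume] 0 := by
      rw [hN, lintegral_eq_zero_iff (ha.pow_const _)] at hN0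
      filter_upwards [hN0] with s hs
      simpa [(show 0 < q / (q - 1) by positivity), (show 0 ≤ q / (q - 1) by positivity).not_gt] using hs
    have : ∫⁻ t, ∫⁻ s, a t * (a s * rieszKer q (t - s)) = 0 := by
      rw [lintegral_congr_ae (g := fun _ => 0)]
      · simp
      · filter_upwards [h0] with t ht
        simp [ht]
    rw [this]; exact zero_le
  set c := N ^ ((q - 1) / q) with hc
  have hc0 : c ≠ 0 := by simp [hc, hN0, hNt]
  have hct : c ≠ ∞ := ENNReal.rpow_ne_top_of_nonneg (by positivity) hNt
  set a' : ℝ → ℝ≥0∞ := fun s => c⁻¹ * a s with ha'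
  have ha'm : Measurable a' := ha.const_mul _
  have haa : ∀ s, a s = c * a' s := fun s => by
    rw [ha', ← mul_assoc, ENNReal.mul_inv_cancel hc0 hct, one_mul]
  have hcN : c ^ (q / (q - 1)) = N := by
    rw [hc, ← ENNReal.rpow_mul]
    have : (q - 1) / q * (q / (q - 1)) = 1 := by field_simp
    rw [this, ENNReal.rpow_one]
  have hN' : ∫⁻ s, a' s ^ (q / (q - 1)) = 1 := by
    simp only [ha', ENNReal.mul_rpow_of_nonneg _ _ (show 0 ≤ q / (q - 1) by positivity)]
    rw [lintegral_const_mul _ (ha.pow_const _), ENNReal.inv_rpow, hcN, ← hN,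
      ENNReal.inv_mul_cancel hN0 hNt]
  have hIm : Measurable fun t => ∫⁻ s, a' s * rieszKer q (t - s) := by
    have : Measurable fun z : ℝ × ℝ => a' z.2 * rieszKer q (z.1 - z.2) :=
      (ha'm.comp measurable_snd).mul hk2
    exact this.lintegral_prod_right'
  have e : ∫⁻ t, ∫⁻ s, a t * (a s * rieszKer q (t - s)) =
      c ^ (2 : ℝ) * ∫⁻ t, a' t * ∫⁻ s, a' s * rieszKer q (t - s) := by
    have m1 : Measurable fun t => a' t * ∫⁻ s, a' s * rieszKer q (t - s) := ha'm.mul hIm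
    rw [← lintegral_const_mul _ m1]
    refine lintegral_congr fun t => ?_
    have m2 : Measurable fun s => a' s * rieszKer q (t - s) := ha'm.mul (hkt t)
    rw [← lintegral_const_mul _ m2, ← lintegral_const_mul _ (m2.const_mul _)]
    refine lintegral_congr fun s => ?_
    rw [haa t, haa s, ENNReal.rpow_two]; ring
  have hconj : (q / (q - 1)).HolderConjugate q :=
    (Real.HolderConjugate.conjExponent (p := q) (by linarith)).symm
  rw [e, hc, ← ENNReal.rpow_mul, mul_comm (_ / _) (2 : ℝ), mul_comm _ (N ^ _)]
  gcongr
  refine (ENNReal.lintegral_mul_le_Lp_mul_Lq volume hconj ha'm.aemeasurable hIm.aemeasurable).trans ?_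
  rw [hN', ENNReal.one_rpow, one_mul]
  refine le_trans ?_ le_self_add
  gcongr
  exact lintegral_rieszKer_conv_rpow_le hq ha'm hN'

/-- Real interpolation between an `L¹ → L^∞` bound and an `L² → L²` bound. -/
theorem lintegral_rpow_le_of_truncation {E : Type*} [MeasurableSpace E] {μ : Measure E} [SFinite μ]
    {r : ℝ} (hr : 2 < r) {f T : E → ℝ≥0∞} (hf : Measurable f) (hT : Measurable T)
    {A ν : ℝ} (hA : 0 < A) (hν : 0 < ν) {B : ℝ≥0∞}
    (hN : ∫⁻ x, f x ^ (r / (r - 1)) ∂μ ≤ ENNReal.ofReal ν)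
    (h : ∀ h : ℝ≥0∞, ∃ T₂ : E → ℝ≥0∞, Measurable T₂ ∧
      (∀ x, T x ≤ ENNReal.ofReal A * (∫⁻ y, {y | h < f y}.indicator f y ∂μ) + T₂ x) ∧
      ∫⁻ x, T₂ x ^ (2 : ℝ) ∂μ ≤ B * ∫⁻ y, {y | f y ≤ h}.indicator (fun y => f y ^ (2 : ℝ)) y ∂μ) :
    ∫⁻ x, T x ^ r ∂μ ≤ ENNReal.ofReal (r / (r - 2)) *
      (4 * B * ENNReal.ofReal ((2 * A * ν) ^ (r - 2) * ν)) := by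
  have hr1 : 0 < r - 1 := by linarith
  have hr2 : 0 < r - 2 := by linarith
  have hr0 : 0 < r := by linarith
  set D : ℝ≥0∞ := ENNReal.ofReal ((2 * A * ν) ^ (r - 1)) with hD
  have hD0 : D ≠ 0 := by rw [hD]; simp only [ne_eq, ENNReal.ofReal_eq_zero, not_le]; positivity
  have hDt : D ≠ ∞ := ENNReal.ofReal_ne_top
  have hwm : Measurable fun y => 4 * B * f y ^ (2 : ℝ) := (hf.pow_const _).const_mul _
  have hΛm : Measurable fun y => (D / f y) ^ (1 / (r - 1)) :=
    (measurable_const.div hf).pow_const _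
  have key := lintegral_rpow_le_of_distribution (μ := μ) (ν := μ) hr0 hr hT hwm hΛm ?_
  · refine key.trans ?_
    gcongr
    calc _ ≤ ∫⁻ y, 4 * B * ENNReal.ofReal ((2 * A * ν) ^ (r - 2)) * f y ^ (r / (r - 1)) ∂μ := by
          refine lintegral_mono fun y => ?_
          rw [mul_assoc (4 * B), mul_assoc (4 * B)]
          gcongr 4 * B * ?_
          rcases eq_or_ne (f y) 0 with h0 | h0
          · simp [h0]
          rcases eq_or_ne (f y) ∞ with ht | ht
          · rw [ht, ENNReal.top_rpow_of_pos (show 0 < r / (r - 1) by positivity), ENNReal.mul_top]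
            · exact le_top
            · simp only [ne_eq, ENNReal.ofReal_eq_zero, not_le]; positivity
          rw [← ENNReal.rpow_mul, div_eq_mul_inv D,
            ENNReal.mul_rpow_of_nonneg _ _ (by positivity), ENNReal.inv_rpow, ← ENNReal.rpow_neg,
            mul_left_comm, ← ENNReal.rpow_add _ _ h0 ht]
          refine le_of_eq ?_
          congr 1
          · rw [hD, ENNReal.ofReal_rpow_of_pos (by positivity), ← Real.rpow_mul (by positivity)]
            congr 2; field_simp
          · congr 1; field_simp; ring
      _ = 4 * B * ENNReal.ofReal ((2 * A * ν) ^ (r - 2)) * ∫⁻ y, f y ^ (r / (r - 1)) ∂μ :=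
          lintegral_const_mul _ (hf.pow_const _)
      _ ≤ 4 * B * ENNReal.ofReal ((2 * A * ν) ^ (r - 2)) * ENNReal.ofReal ν := by gcongr
      _ = _ := by rw [mul_assoc, ← ENNReal.ofReal_mul (by positivity)]
  intro l hl
  set H : ℝ := (2 * A * ν / l) ^ (r - 1) with hH
  have hH0 : 0 < H := by positivity
  obtain ⟨T₂, hT₂, hle, hsq⟩ := h (ENNReal.ofReal H)
  have tail : ENNReal.ofReal A * (∫⁻ y, {y | ENNReal.ofReal H < f y}.indicator f y ∂μ) ≤
      ENNReal.ofReal (l / 2) := by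
    calc _ ≤ ENNReal.ofReal A * ∫⁻ y, ENNReal.ofReal (l / (2 * A * ν)) * f y ^ (r / (r - 1)) ∂μ := by
          gcongr with y
          by_cases hy : ENNReal.ofReal H < f y
          · rw [Set.indicator_of_mem (show y ∈ {y | ENNReal.ofReal H < f y} from hy)]
            have h0 : f y ≠ 0 := (zero_le.trans_lt hy).ne'
            have e : f y ^ (r / (r - 1)) = f y ^ (1 / (r - 1)) * f y := by
              have : r / (r - 1) = 1 / (r - 1) + 1 := by field_simp; ring
              rw [this, ENNReal.rpow_add_of_nonneg _ _ (by positivity) (by norm_num),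
                ENNReal.rpow_one]
            have e2 : ENNReal.ofReal (2 * A * ν / l) ≤ f y ^ (1 / (r - 1)) := by
              calc _ = ENNReal.ofReal H ^ (1 / (r - 1)) := by
                    rw [hH, ENNReal.ofReal_rpow_of_pos (by positivity),
                      ← Real.rpow_mul (by positivity), mul_one_div_cancel hr1.ne', Real.rpow_one]
                _ ≤ _ := by gcongr
            calc f y = ENNReal.ofReal (l / (2 * A * ν)) * (ENNReal.ofReal (2 * A * ν / l) * f y) := by
                  rw [← mul_assoc, ← ENNReal.ofReal_mul (by positivity)]
                  have : l / (2 * A * ν) * (2 * A * ν / l) = 1 := by field_simp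
                  rw [this, ENNReal.ofReal_one, one_mul]
              _ ≤ _ := by rw [e]; gcongr
          · rw [Set.indicator_of_notMem (show y ∉ {y | ENNReal.ofReal H < f y} from hy)]
            exact zero_le
      _ = ENNReal.ofReal A * (ENNReal.ofReal (l / (2 * A * ν)) * ∫⁻ y, f y ^ (r / (r - 1)) ∂μ) := by
          rw [lintegral_const_mul _ (hf.pow_const _)]
      _ ≤ ENNReal.ofReal A * (ENNReal.ofReal (l / (2 * A * ν)) * ENNReal.ofReal ν) := by gcongr
      _ = _ := by
          rw [← ENNReal.ofReal_mul (by positivity), ← ENNReal.ofReal_mul (by positivity)]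
          congr 1; field_simp
  have hsub : {x | ENNReal.ofReal l < T x} ⊆ {x | ENNReal.ofReal ((l / 2) ^ 2) ≤ T₂ x ^ (2 : ℝ)} := by
    intro x hx
    have hx : ENNReal.ofReal l < T x := hx
    have : ENNReal.ofReal (l / 2) ≤ T₂ x := by
      by_contra hcon
      refine absurd (lt_of_lt_of_le hx (hle x)) (not_lt.2 ?_)
      calc _ ≤ ENNReal.ofReal (l / 2) + ENNReal.ofReal (l / 2) := add_le_add tail (not_le.1 hcon).le
        _ = _ := by rw [← ENNReal.ofReal_add (by positivity) (by positivity)]; congr 1; ring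
    show ENNReal.ofReal ((l / 2) ^ 2) ≤ T₂ x ^ (2 : ℝ)
    rw [ENNReal.ofReal_pow (by positivity), ENNReal.rpow_two]
    gcongr
  have hset : MeasurableSet {y | f y ≤ ENNReal.ofReal H} := measurableSet_le hf measurable_const
  calc _ ≤ μ {x | ENNReal.ofReal ((l / 2) ^ 2) ≤ T₂ x ^ (2 : ℝ)} := measure_mono hsub
    _ ≤ (∫⁻ x, T₂ x ^ (2 : ℝ) ∂μ) / ENNReal.ofReal ((l / 2) ^ 2) :=
        meas_ge_le_lintegral_div (hT₂.pow_const _).aemeasurable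
          (by rw [ne_eq, ENNReal.ofReal_eq_zero, not_le]; positivity) ENNReal.ofReal_ne_top
    _ ≤ (B * ∫⁻ y, {y | f y ≤ ENNReal.ofReal H}.indicator (fun y => f y ^ (2 : ℝ)) y ∂μ) /
          ENNReal.ofReal ((l / 2) ^ 2) := by gcongr
    _ = ENNReal.ofReal (l ^ (-2 : ℝ)) * ∫⁻ y, 4 * B *
          {y | f y ≤ ENNReal.ofReal H}.indicator (fun y => f y ^ (2 : ℝ)) y ∂μ := by
        rw [lintegral_const_mul _ ((hf.pow_const _).indicator hset), ← mul_assoc, div_eq_mul_inv,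
          ← ENNReal.ofReal_inv_of_pos (by positivity), mul_comm, ← mul_assoc, ← mul_assoc]
        congr 2
        have h4 : (4 : ℝ≥0∞) = ENNReal.ofReal 4 := by simp
        rw [h4, ← ENNReal.ofReal_mul (by positivity)]
        congr 1
        rw [Real.rpow_neg hl.le, Real.rpow_two]; field_simp; norm_num
    _ ≤ _ := by
        gcongr with y
        by_cases hy : f y ≤ ENNReal.ofReal H
        · rw [Set.indicator_of_mem (show y ∈ {y | f y ≤ ENNReal.ofReal H} from hy),
            Set.indicator_of_mem]
          show ENNReal.ofReal l ≤ (D / f y) ^ (1 / (r - 1))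
          have : ENNReal.ofReal (l ^ (r - 1)) ≤ D / f y := by
            rw [ENNReal.le_div_iff_mul_le (Or.inr hD0) (Or.inr hDt)]
            calc _ ≤ ENNReal.ofReal (l ^ (r - 1)) * ENNReal.ofReal H := by gcongr
              _ = D := by
                rw [← ENNReal.ofReal_mul (by positivity), hH, hD,
                  Real.div_rpow (by positivity) hl.le]
                congr 1; field_simp
          calc ENNReal.ofReal l = ENNReal.ofReal (l ^ (r - 1)) ^ (1 / (r - 1)) := by
                rw [ENNReal.ofReal_rpow_of_pos (by positivity), ← Real.rpow_mul hl.le,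
                  mul_one_div_cancel hr1.ne', Real.rpow_one]
            _ ≤ _ := by gcongr
        · rw [Set.indicator_of_notMem (show y ∉ {y | f y ≤ ENNReal.ofReal H} from hy), mul_zero]
          exact zero_le

theorem measurable_finset_sup {X ι : Type*} [MeasurableSpace X] (s : Finset ι)
    {f : ι → X → ℝ≥0∞} (hf : ∀ i, Measurable (f i)) : Measurable fun x => s.sup fun i => f i x := by
  classical
  induction s using Finset.induction_on with
  | empty => simp only [Finset.sup_empty]; exact measurable_const
  | insert a s _ ih =>
    simp only [Finset.sup_insert]
    exact (hf a).sup ih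

/-- A discrete Christ–Kiselev lemma for maximal functions of additive families. -/
theorem lintegral_sup_rpow_le_of_blocks {X : Type*} [MeasurableSpace X] {μ : Measure X} {p s : ℝ}
    (hp : 1 ≤ p) (hs : 0 < s) (hsp : s < p) {N : ℕ → ℕ → X → ℝ≥0∞}
    (hNm : ∀ k l, Measurable (N k l)) (h0 : ∀ k x, N k k x = 0)
    (htri : ∀ k l m, k ≤ l → l ≤ m → ∀ x, N k m x ≤ N k l x + N l m x)
    {m : ℕ → ℝ≥0∞} (hm : ∀ i, m i ≠ ∞) {B : ℝ≥0∞}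
    (hB : ∀ k l, k ≤ l →
      (∫⁻ x, N k l x ^ p ∂μ) ^ (1 / p) ≤ B * (∑ i ∈ Finset.Ico k l, m i) ^ (1 / s)) :
    ∀ d a, (∫⁻ x, ((Finset.Icc a (a + d)).sup fun k => N a k x) ^ p ∂μ) ^ (1 / p) ≤
      ENNReal.ofReal (1 / (1 - 2 ^ (1 / p - 1 / s))) *
        (B * (∑ i ∈ Finset.Ico a (a + d), m i) ^ (1 / s)) := by
  have hp0 : 0 < p := by linarith
  have hexp : 1 / p - 1 / s < 0 := sub_neg.2 (one_div_lt_one_div_of_lt hs hsp)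
  set θ : ℝ := 2 ^ (1 / p - 1 / s) with hθ
  have hθ0 : 0 < θ := by positivity
  have hθ1 : θ < 1 := Real.rpow_lt_one_of_one_lt_of_neg (by norm_num) hexp
  have hC : 0 < 1 - θ := by linarith
  set C : ℝ≥0∞ := ENNReal.ofReal (1 / (1 - θ)) with hCdef
  have hrec : 1 + ENNReal.ofReal θ * C = C := by
    rw [hCdef, ← ENNReal.ofReal_mul hθ0.le, ← ENNReal.ofReal_one,
      ← ENNReal.ofReal_add (by norm_num) (by positivity)]
    congr 1; field_simp; ring
  have hSm : ∀ a I, Measurable fun x => (I : Finset ℕ).sup fun k => N a k x := fun a I =>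
    measurable_finset_sup I (hNm a)
  intro d
  induction d using Nat.strong_induction_on with
  | _ d ih =>
  intro a
  rcases Nat.eq_zero_or_pos d with rfl | hd
  · simp [h0, hp0]
  set M : ℝ≥0∞ := ∑ i ∈ Finset.Ico a (a + d), m i with hM
  have hMt : M ≠ ∞ := ENNReal.sum_ne_top.2 fun i _ => hm i
  have hex : ∃ c, M / 2 ≤ ∑ i ∈ Finset.Ico a (a + (c + 1)), m i := by
    refine ⟨d - 1, ?_⟩
    rw [Nat.sub_add_cancel hd]
    exact ENNReal.half_le_self
  classical
  set c := Nat.find hex with hc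
  have hc1 : M / 2 ≤ ∑ i ∈ Finset.Ico a (a + (c + 1)), m i := Nat.find_spec hex
  have hcd : c + 1 ≤ d := by
    have : c ≤ d - 1 := Nat.find_min' hex (by
      rw [Nat.sub_add_cancel hd]
      exact ENNReal.half_le_self)
    omega
  have hleft : ∑ i ∈ Finset.Ico a (a + c), m i ≤ M / 2 := by
    rcases Nat.eq_zero_or_pos c with h | h
    · simp [h]
    · have := Nat.find_min hex (show c - 1 < c by omega)
      rw [Nat.sub_add_cancel h] at this
      exact (not_le.1 this).le
  obtain ⟨d', hd'⟩ : ∃ d', d = c + 1 + d' := ⟨d - (c + 1), by omega⟩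
  have hsplit : ∑ i ∈ Finset.Ico a (a + (c + 1)), m i +
      ∑ i ∈ Finset.Ico (a + (c + 1)) (a + (c + 1) + d'), m i = M := by
    rw [hM, hd', ← add_assoc a (c + 1) d']
    exact Finset.sum_Ico_consecutive m (by omega) (by omega)
  have hright : ∑ i ∈ Finset.Ico (a + (c + 1)) (a + (c + 1) + d'), m i ≤ M / 2 := by
    have h1 : M / 2 + ∑ i ∈ Finset.Ico (a + (c + 1)) (a + (c + 1) + d'), m i ≤ M / 2 + M / 2 := by
      rw [ENNReal.add_halves]
      nth_rewrite 2 [← hsplit]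
      gcongr
    exact (ENNReal.add_le_add_iff_left (ENNReal.div_ne_top hMt (by norm_num))).1 h1
  set S₁ : X → ℝ≥0∞ := fun x => (Finset.Icc a (a + c)).sup fun k => N a k x with hS₁
  set S₂ : X → ℝ≥0∞ := fun x =>
    (Finset.Icc (a + (c + 1)) (a + (c + 1) + d')).sup fun k => N (a + (c + 1)) k x with hS₂
  have hpt : ∀ x, ((Finset.Icc a (a + d)).sup fun k => N a k x) ≤
      N a (a + (c + 1)) x + max (S₁ x) (S₂ x) := by
    intro x
    refine Finset.sup_le fun k hk => ?_
    rw [Finset.mem_Icc] at hk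
    rcases le_or_gt k (a + c) with h | h
    · refine le_trans ?_ (le_trans (le_max_left (S₁ x) (S₂ x)) le_add_self)
      exact Finset.le_sup (f := fun k => N a k x) (Finset.mem_Icc.2 ⟨hk.1, h⟩)
    · refine (htri a (a + (c + 1)) k (by omega) (by omega) x).trans ?_
      gcongr
      refine le_trans ?_ (le_max_right (S₁ x) (S₂ x))
      exact Finset.le_sup (f := fun k => N (a + (c + 1)) k x) (Finset.mem_Icc.2 ⟨by omega, by omega⟩)
  have hS₁m : Measurable S₁ := hSm _ _
  have hS₂m : Measurable S₂ := hSm _ _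
  have hhalf : ∀ (S : X → ℝ≥0∞) (Y : ℝ≥0∞), Y ≤ M / 2 →
      (∫⁻ x, S x ^ p ∂μ) ^ (1 / p) ≤ C * (B * Y ^ (1 / s)) →
      ∫⁻ x, S x ^ p ∂μ ≤ (C * (B * (M / 2) ^ (1 / s))) ^ p := by
    intro S Y hY hSY
    calc _ = ((∫⁻ x, S x ^ p ∂μ) ^ (1 / p)) ^ p := by
          rw [← ENNReal.rpow_mul, one_div_mul_cancel hp0.ne', ENNReal.rpow_one]
      _ ≤ _ := by
          gcongr
          exact hSY.trans (by gcongr)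
  have hmax : (∫⁻ x, max (S₁ x) (S₂ x) ^ p ∂μ) ^ (1 / p) ≤
      2 ^ (1 / p) * (C * (B * (M / 2) ^ (1 / s))) := by
    calc _ ≤ (∫⁻ x, S₁ x ^ p ∂μ + ∫⁻ x, S₂ x ^ p ∂μ) ^ (1 / p) := by
          rw [← lintegral_add_left (hS₁m.pow_const _)]
          gcongr with x
          rcases max_choice (S₁ x) (S₂ x) with h | h <;> rw [h]
          · exact le_self_add
          · exact le_add_self
      _ ≤ ((C * (B * (M / 2) ^ (1 / s))) ^ p + (C * (B * (M / 2) ^ (1 / s))) ^ p) ^ (1 / p) := by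
          gcongr
          · exact hhalf _ _ hleft (ih c (by omega) a)
          · exact hhalf _ _ hright (ih d' (by omega) (a + (c + 1)))
      _ = _ := by
          rw [← two_mul, ENNReal.mul_rpow_of_nonneg _ _ (by positivity), ← ENNReal.rpow_mul,
            mul_one_div_cancel hp0.ne', ENNReal.rpow_one]
  calc _ ≤ (∫⁻ x, (N a (a + (c + 1)) x + max (S₁ x) (S₂ x)) ^ p ∂μ) ^ (1 / p) := by
        gcongr with x
        exact hpt x
    _ ≤ (∫⁻ x, N a (a + (c + 1)) x ^ p ∂μ) ^ (1 / p) +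
          (∫⁻ x, max (S₁ x) (S₂ x) ^ p ∂μ) ^ (1 / p) :=
        ENNReal.lintegral_Lp_add_le (hNm _ _).aemeasurable (hS₁m.max hS₂m).aemeasurable hp
    _ ≤ B * M ^ (1 / s) + 2 ^ (1 / p) * (C * (B * (M / 2) ^ (1 / s))) := by
        refine add_le_add ((hB _ _ (by omega)).trans ?_) hmax
        gcongr
        rw [← hsplit]; exact le_self_add
    _ = (1 + ENNReal.ofReal θ * C) * (B * M ^ (1 / s)) := by
        have e : ENNReal.ofReal θ = 2 ^ (1 / p) * ((2 : ℝ≥0∞)⁻¹) ^ (1 / s) := by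
          rw [hθ, ← ENNReal.ofReal_rpow_of_pos (by norm_num), ENNReal.inv_rpow, ← ENNReal.rpow_neg,
            ← ENNReal.rpow_add _ _ (by norm_num) (by norm_num), ENNReal.ofReal_ofNat, sub_eq_add_neg]
        rw [e, div_eq_mul_inv M 2, ENNReal.mul_rpow_of_nonneg _ _ (by positivity)]
        ring
    _ = _ := by rw [hrec]

/-- Fubini for the pairing of two superpositions of bounded symbols. -/
theorem integral_superposition_eq {E X Y : Type*} [MeasurableSpace E] [MeasurableSpace X]
    [MeasurableSpace Y] {η : Measure E} {μ : Measure X} {ν : Measure Y} [SFinite η] [SFinite μ]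
    [SFinite ν] {m : E → ℂ} (hm : Integrable m η) {a : X × E → ℂ} {b : Y × E → ℂ}
    (ha : Measurable a) (hb : Measurable b) {A : X → ℝ} {B : Y → ℝ} (hA : Integrable A μ)
    (hB : Integrable B ν) (haA : ∀ x ξ, ‖a (x, ξ)‖ ≤ A x) (hbB : ∀ y ξ, ‖b (y, ξ)‖ ≤ B y) :
    (∫ ξ, m ξ * ((∫ x, a (x, ξ) ∂μ) * starRingEnd ℂ (∫ y, b (y, ξ) ∂ν)) ∂η =
      ∫ z : X × Y, (∫ ξ, m ξ * (a (z.1, ξ) * starRingEnd ℂ (b (z.2, ξ))) ∂η) ∂(μ.prod ν)) ∧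
    Integrable (fun z : X × Y => ∫ ξ, m ξ * (a (z.1, ξ) * starRingEnd ℂ (b (z.2, ξ))) ∂η)
      (μ.prod ν) := by
  have hmeas : AEStronglyMeasurable (fun z : E × (X × Y) =>
      m z.1 * (a (z.2.1, z.1) * starRingEnd ℂ (b (z.2.2, z.1)))) (η.prod (μ.prod ν)) := by
    refine hm.1.comp_fst.mul (Measurable.aestronglyMeasurable ?_)
    refine (ha.comp ((measurable_fst.comp measurable_snd).prodMk measurable_fst)).mul
      (Complex.continuous_conj.measurable.comp
        (hb.comp ((measurable_snd.comp measurable_snd).prodMk measurable_fst)))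
  have hint : Integrable (fun z : E × (X × Y) =>
      m z.1 * (a (z.2.1, z.1) * starRingEnd ℂ (b (z.2.2, z.1)))) (η.prod (μ.prod ν)) := by
    refine ((hm.norm.mul_prod (hA.mul_prod hB))).mono' hmeas (Filter.Eventually.of_forall ?_)
    rintro ⟨ξ, x, y⟩
    simp only [norm_mul, RCLike.norm_conj]
    gcongr
    · exact (norm_nonneg _).trans (haA x ξ)
    · exact haA x ξ
    · exact hbB y ξ
  have e1 : ∫ ξ, m ξ * ((∫ x, a (x, ξ) ∂μ) * starRingEnd ℂ (∫ y, b (y, ξ) ∂ν)) ∂η =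
      ∫ ξ, (∫ z : X × Y, m ξ * (a (z.1, ξ) * starRingEnd ℂ (b (z.2, ξ))) ∂(μ.prod ν)) ∂η := by
    congr 1; ext ξ
    rw [integral_const_mul, integral_prod_mul (fun x => a (x, ξ)) (fun y => starRingEnd ℂ (b (y, ξ))),
      integral_conj]
  exact ⟨by rw [e1, integral_integral_swap hint], hint.integral_prod_right⟩

theorem enorm_integral_superposition_le {E X Y : Type*} [MeasurableSpace E] [MeasurableSpace X]
    [MeasurableSpace Y] {η : Measure E} {μ : Measure X} {ν : Measure Y} [SFinite η] [SFinite μ]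
    [SFinite ν] {m : E → ℂ} (hm : Integrable m η) {a : X × E → ℂ} {b : Y × E → ℂ}
    (ha : Measurable a) (hb : Measurable b) {A : X → ℝ} {B : Y → ℝ} (hA : Integrable A μ)
    (hB : Integrable B ν) (haA : ∀ x ξ, ‖a (x, ξ)‖ ≤ A x) (hbB : ∀ y ξ, ‖b (y, ξ)‖ ≤ B y) :
    ‖∫ ξ, m ξ * ((∫ x, a (x, ξ) ∂μ) * starRingEnd ℂ (∫ y, b (y, ξ) ∂ν)) ∂η‖ₑ ≤
      ∫⁻ x, (∫⁻ y, ‖∫ ξ, m ξ * (a (x, ξ) * starRingEnd ℂ (b (y, ξ))) ∂η‖ₑ ∂ν) ∂μ := by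
  obtain ⟨e, hint⟩ := integral_superposition_eq hm ha hb hA hB haA hbB
  rw [e]
  exact (enorm_integral_le_lintegral_enorm _).trans_eq (lintegral_prod _ hint.1.enorm)

variable {n : ℕ}

theorem continuous_quadSym (ε : Fin n → ℝ) : Continuous (quadSym ε) := by
  unfold quadSym
  fun_prop

/-- The unimodular phase `e^{i(2π x·ξ - t|ξ|²_±)}`. -/
def wave (ε : Fin n → ℝ) (t : ℝ) (x ξ : Eucl n) : ℂ :=
  cexp (((2 * Real.pi * ⟪x, ξ⟫ - t * quadSym ε ξ : ℝ) : ℂ) * I)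

theorem norm_wave (ε : Fin n → ℝ) (t : ℝ) (x ξ : Eucl n) : ‖wave ε t x ξ‖ = 1 :=
  Complex.norm_exp_ofReal_mul_I _

@[fun_prop]
theorem continuous_wave {X : Type*} [TopologicalSpace X] (ε : Fin n → ℝ) {t : X → ℝ}
    {x ξ : X → Eucl n} (ht : Continuous t) (hx : Continuous x) (hξ : Continuous ξ) :
    Continuous fun a => wave ε (t a) (x a) (ξ a) := by
  have := continuous_quadSym ε
  unfold wave
  fun_prop

theorem wave_mul_conj (ε : Fin n → ℝ) (t s : ℝ) (x y ξ : Eucl n) :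
    wave ε t x ξ * starRingEnd ℂ (wave ε s y ξ) = wave ε (t - s) (x - y) ξ := by
  unfold wave
  rw [← Complex.exp_conj, ← Complex.exp_add]
  congr 1
  rw [map_mul, Complex.conj_ofReal, Complex.conj_I, inner_sub_left]
  push_cast; ring

theorem norm_integral_gaussian_wave_le {ε : Fin n → ℝ} (hε : ∀ i, ε i = 1 ∨ ε i = -1) {t : ℝ}
    (ht : t ≠ 0) {δ : ℝ} (hδ : 0 < δ) (x : Eucl n) :
    ‖∫ ξ, wave ε t x ξ * cexp (-δ * ‖ξ‖ ^ 2)‖ ≤ (Real.pi / |t|) ^ ((n : ℝ) / 2) := by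
  have hb : ∀ i, 0 < ((δ : ℂ) + t * ε i * I).re := by intro i; simp [hδ]
  have e : ∫ ξ, wave ε t x ξ * cexp (-δ * ‖ξ‖ ^ 2) =
      ∏ i, ((Real.pi : ℂ) / (δ + t * ε i * I)) ^ (1 / 2 : ℂ) *
        cexp ((2 * Real.pi * x i * I) ^ 2 / (4 * (δ + t * ε i * I))) := by
    rw [← GaussianFourier.integral_cexp_neg_sum_mul_add hb (fun i => 2 * Real.pi * x i * I),
      ← (PiLp.volume_preserving_toLp (Fin n)).integral_comp
        (MeasurableEquiv.toLp 2 _).measurableEmbedding]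
    congr 1; ext v
    unfold wave quadSym
    rw [← Complex.exp_add]
    congr 1
    rw [← Complex.ofReal_pow, EuclideanSpace.norm_sq_eq, PiLp.inner_apply]
    simp only [Real.norm_eq_abs, sq_abs, RCLike.inner_apply, conj_trivial]
    push_cast
    simp only [sub_mul, Finset.mul_sum, Finset.sum_mul, ← Finset.sum_neg_distrib,
      ← Finset.sum_sub_distrib, ← Finset.sum_add_distrib]
    refine Finset.sum_congr rfl fun i _ => ?_
    ring
  rw [e, norm_prod]
  have hfac : ∀ i, ‖((Real.pi : ℂ) / (δ + t * ε i * I)) ^ (1 / 2 : ℂ) *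
        cexp ((2 * Real.pi * x i * I) ^ 2 / (4 * (δ + t * ε i * I)))‖ ≤
      (Real.pi / |t|) ^ (1 / 2 : ℝ) := by
    intro i
    have hεi : |ε i| = 1 := by rcases hε i with h | h <;> simp [h]
    have h1 : |t| ≤ ‖(δ + t * ε i * I : ℂ)‖ := by
      have := Complex.abs_im_le_norm (δ + t * ε i * I : ℂ)
      simpa [abs_mul, hεi] using this
    have h2 : ‖((Real.pi : ℂ) / (δ + t * ε i * I)) ^ (1 / 2 : ℂ)‖ ≤ (Real.pi / |t|) ^ (1 / 2 : ℝ) := by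
      rw [show (1 / 2 : ℂ) = ((1 / 2 : ℝ) : ℂ) by norm_num, Complex.norm_cpow_real, norm_div,
        Complex.norm_real, Real.norm_of_nonneg Real.pi_pos.le]
      have := abs_pos.2 ht
      gcongr
    have h3 : ‖cexp ((2 * Real.pi * x i * I) ^ 2 / (4 * (δ + t * ε i * I)))‖ ≤ 1 := by
      rw [Complex.norm_exp, Real.exp_le_one_iff]
      have : (2 * Real.pi * x i * I) ^ 2 / (4 * (δ + t * ε i * I)) =
          ((-(Real.pi * x i) ^ 2 : ℝ) : ℂ) * (δ + t * ε i * I : ℂ)⁻¹ := by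
        rw [mul_pow _ I, I_sq, div_eq_mul_inv, mul_inv]
        push_cast; ring
      rw [this, Complex.re_ofReal_mul, Complex.inv_re]
      have h5 : 0 ≤ (δ + t * ε i * I : ℂ).re / Complex.normSq (δ + t * ε i * I) :=
        div_nonneg (hb i).le (Complex.normSq_nonneg _)
      nlinarith [sq_nonneg (Real.pi * x i)]
    rw [norm_mul]
    calc _ ≤ (Real.pi / |t|) ^ (1 / 2 : ℝ) * 1 := by gcongr
      _ = _ := mul_one _
  calc _ ≤ ∏ _i : Fin n, (Real.pi / |t|) ^ (1 / 2 : ℝ) :=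
        Finset.prod_le_prod (fun _ _ => norm_nonneg _) fun i _ => hfac i
    _ = _ := by
        rw [Finset.prod_const, Finset.card_univ, Fintype.card_fin, ← Real.rpow_natCast,
          ← Real.rpow_mul (by positivity)]
        congr 1; ring

/-- The convolution kernel `∫ b(ξ) e^{i(2π x·ξ - t|ξ|²_±)} dξ`. -/
def ker (ε : Fin n → ℝ) (b : Eucl n → ℂ) (t : ℝ) (x : Eucl n) : ℂ :=
  ∫ ξ, b ξ * wave ε t x ξ

theorem integrable_mul_wave (ε : Fin n → ℝ) {b : Eucl n → ℂ} (hb : Integrable b) (t : ℝ)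
    (x : Eucl n) : Integrable fun ξ => b ξ * wave ε t x ξ := by
  refine hb.mono (hb.1.mul (Continuous.aestronglyMeasurable ?_)) (Eventually.of_forall fun ξ => ?_)
  · fun_prop
  · simp [norm_wave]

theorem norm_ker_le (ε : Fin n → ℝ) (b : Eucl n → ℂ) (t : ℝ) (x : Eucl n) :
    ‖ker ε b t x‖ ≤ ∫ ξ, ‖b ξ‖ := by
  refine (norm_integral_le_integral_norm _).trans_eq ?_
  simp [norm_wave]

theorem integrable_gaussian {δ : ℝ} (hδ : 0 < δ) :
    Integrable fun ξ : Eucl n => cexp (-δ * ‖ξ‖ ^ 2) := by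
  have := GaussianFourier.integrable_cexp_neg_mul_sq_norm_add (V := Eucl n) (b := (δ : ℂ))
    (by simpa using hδ) 0 0
  simpa using this

theorem norm_gaussian_le_one {δ : ℝ} (hδ : 0 ≤ δ) (ξ : Eucl n) :
    ‖cexp (-δ * ‖ξ‖ ^ 2)‖ ≤ 1 := by
  rw [Complex.norm_exp, Real.exp_le_one_iff]
  have : (-(δ : ℂ) * (‖ξ‖ : ℂ) ^ 2).re = -(δ * ‖ξ‖ ^ 2) := by
    rw [← Complex.ofReal_pow, ← Complex.ofReal_neg, ← Complex.ofReal_mul, Complex.ofReal_re]; ring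
  rw [this]
  have : 0 ≤ δ * ‖ξ‖ ^ 2 := by positivity
  linarith

theorem norm_ker_le_dispersive {ε : Fin n → ℝ} (hε : ∀ i, ε i = 1 ∨ ε i = -1) {b : Eucl n → ℂ}
    (hbc : Continuous b) (hb : Integrable b) (hfb : Integrable (𝓕 b)) {t : ℝ} (ht : t ≠ 0)
    (x : Eucl n) :
    ‖ker ε b t x‖ ≤ (∫ ξ, ‖𝓕 b ξ‖) * (Real.pi / |t|) ^ ((n : ℝ) / 2) := by
  have key : ∀ δ : ℝ, 0 < δ → ‖∫ ξ, b ξ * wave ε t x ξ * cexp (-δ * ‖ξ‖ ^ 2)‖ ≤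
      (∫ ξ, ‖𝓕 b ξ‖) * (Real.pi / |t|) ^ ((n : ℝ) / 2) := by
    intro δ hδ
    have e1 : ∀ ξ, b ξ * wave ε t x ξ * cexp (-δ * ‖ξ‖ ^ 2) =
        ∫ y, 𝓕 b y * (wave ε t (x + y) ξ * cexp (-δ * ‖ξ‖ ^ 2)) := by
      intro ξ
      conv_lhs => rw [← hbc.fourierInv_fourier_eq hb hfb, Real.fourierInv_eq']
      rw [mul_assoc, ← integral_mul_const]
      congr 1; ext y
      have : wave ε t (x + y) ξ = cexp (↑(2 * Real.pi * ⟪y, ξ⟫) * I) * wave ε t x ξ := by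
        unfold wave
        rw [← Complex.exp_add, inner_add_left]
        congr 1; push_cast; ring
      rw [this, smul_eq_mul]; ring
    simp_rw [e1]
    have hint : Integrable (fun z : Eucl n × Eucl n =>
        𝓕 b z.2 * (wave ε t (x + z.2) z.1 * cexp (-δ * ‖z.1‖ ^ 2))) (volume.prod volume) := by
      refine ((integrable_gaussian hδ).mul_prod hfb).mono
        (hfb.1.comp_snd.mul (Continuous.aestronglyMeasurable ?_)) (Eventually.of_forall fun z => ?_)
      · fun_prop
      · simp only [norm_mul, norm_wave, one_mul]
        rw [mul_comm]
    rw [integral_integral_swap hint]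
    refine (norm_integral_le_integral_norm _).trans ?_
    rw [← integral_mul_const]
    refine integral_mono_of_nonneg (Eventually.of_forall fun _ => norm_nonneg _)
      (hfb.norm.mul_const _) (Eventually.of_forall fun y => ?_)
    simp only
    rw [integral_const_mul, norm_mul]
    gcongr
    exact norm_integral_gaussian_wave_le hε ht hδ (x + y)
  have lim : Tendsto (fun k : ℕ => ∫ ξ, b ξ * wave ε t x ξ *
      cexp (-((1 / ((k : ℝ) + 1) : ℝ) : ℂ) * ‖ξ‖ ^ 2)) atTop (𝓝 (ker ε b t x)) := by
    refine tendsto_integral_of_dominated_convergence (fun ξ => ‖b ξ‖) (fun k => ?_) hb.norm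
      (fun k => Eventually.of_forall fun ξ => ?_) (Eventually.of_forall fun ξ => ?_)
    · exact (integrable_mul_wave ε hb t x).1.mul (Continuous.aestronglyMeasurable (by fun_prop))
    · rw [norm_mul, norm_mul, norm_wave, mul_one]
      exact mul_le_of_le_one_right (norm_nonneg _) (norm_gaussian_le_one (by positivity) ξ)
    · have h0 : Tendsto (fun k : ℕ => 1 / ((k : ℝ) + 1)) atTop (𝓝 0) :=
        tendsto_one_div_add_atTop_nhds_zero_nat
      have hc : Continuous fun s : ℝ => b ξ * wave ε t x ξ * cexp (-(s : ℂ) * ‖ξ‖ ^ 2) := by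
        fun_prop
      have := (hc.tendsto 0).comp h0
      simpa [Function.comp_def] using this
  exact le_of_tendsto lim.norm (Eventually.of_forall fun k => key _ (by positivity))

theorem hasLineDerivAt_wave (ε : Fin n → ℝ) (t : ℝ) (x ξ : Eucl n) (i : Fin n) :
    HasLineDerivAt ℝ (wave ε t x)
      (((2 * Real.pi * x i - 2 * t * (ε i * ξ i) : ℝ) : ℂ) * I * wave ε t x ξ) ξ
      (EuclideanSpace.single i 1) := by
  unfold HasLineDerivAt wave
  have h : HasDerivAt (fun s : ℝ => 2 * Real.pi * ⟪x, ξ + s • EuclideanSpace.single i (1 : ℝ)⟫ -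
      t * quadSym ε (ξ + s • EuclideanSpace.single i (1 : ℝ)))
      (2 * Real.pi * x i - 2 * t * (ε i * ξ i)) 0 := by
    have hq : ∀ s : ℝ, quadSym ε (ξ + s • EuclideanSpace.single i (1 : ℝ)) =
        quadSym ε ξ + (2 * s * (ε i * ξ i) + s ^ 2 * ε i) := by
      intro s
      unfold quadSym
      rw [← sub_eq_iff_eq_add', ← Finset.sum_sub_distrib, Finset.sum_eq_single i]
      · simp; ring
      · intro j _ hj
        simp [hj]
      · simp
    simp_rw [hq, inner_add_right, inner_smul_right, EuclideanSpace.inner_single_right]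
    have := (((hasDerivAt_id (0 : ℝ)).mul_const (x i)).const_add ⟪x, ξ⟫).const_mul (2 * Real.pi)
    have h2 := ((((hasDerivAt_id (0 : ℝ)).const_mul 2).mul_const (ε i * ξ i)).add
      (((hasDerivAt_id (0 : ℝ)).pow 2).mul_const (ε i))).const_add (quadSym ε ξ)
    convert! this.sub (h2.const_mul t) using 1
    · ext s; simp
    · simp; ring
  have := ((h.ofReal_comp.mul_const I).cexp)
  simp only [zero_smul, add_zero] at this
  convert! this using 1
  ring

theorem abs_coord_pow_mul_norm_ker_le (ε : Fin n → ℝ) (hε : ∀ i, ε i = 1 ∨ ε i = -1) (i : Fin n)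
    (k : ℕ) (b : SchwartzMap (Eucl n) ℂ) :
    ∃ C : ℝ, 0 ≤ C ∧ ∀ t x, |x i| ^ k * ‖ker ε b t x‖ ≤ C * (1 + |t|) ^ k := by
  induction k generalizing b with
  | zero =>
    exact ⟨∫ ξ, ‖b ξ‖, integral_nonneg fun _ => norm_nonneg _, fun t x => by
      simpa using norm_ker_le ε b t x⟩
  | succ k ih =>
    have hg : (fun ξ : Eucl n => ξ i).HasTemperateGrowth :=
      (EuclideanSpace.proj (𝕜 := ℝ) i : Eucl n →L[ℝ] ℝ).hasTemperateGrowth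
    set b₁ : SchwartzMap (Eucl n) ℂ := LineDeriv.lineDerivOp (EuclideanSpace.single i (1 : ℝ) : Eucl n) b
      with hb₁
    set b₂ : SchwartzMap (Eucl n) ℂ := SchwartzMap.smulLeftCLM ℂ (fun ξ : Eucl n => ξ i) b with hb₂
    have hb₂a : ∀ ξ, b₂ ξ = (ξ i : ℂ) * b ξ := by
      intro ξ
      rw [hb₂, SchwartzMap.smulLeftCLM_apply_apply hg, Complex.real_smul]
    obtain ⟨C₁, hC₁, h₁⟩ := ih b₁
    obtain ⟨C₂, hC₂, h₂⟩ := ih b₂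
    have hεi : |ε i| = 1 := by rcases hε i with h | h <;> simp [h]
    have ibp : ∀ t x, (2 * Real.pi * x i : ℝ) * I * ker ε b t x =
        (2 * t * ε i : ℝ) * I * ker ε b₂ t x - ker ε b₁ t x := by
      intro t x
      have e0 : ∀ ξ, b ξ * (((2 * Real.pi * x i - 2 * t * (ε i * ξ i) : ℝ) : ℂ) * I * wave ε t x ξ) =
          (2 * Real.pi * x i : ℝ) * I * (b ξ * wave ε t x ξ) -
            (2 * t * ε i : ℝ) * I * (b₂ ξ * wave ε t x ξ) := by
        intro ξ; rw [hb₂a]; push_cast; ring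
      have i0 := integrable_mul_wave ε b.integrable t x
      have i1 := integrable_mul_wave ε b₁.integrable t x
      have i2 := integrable_mul_wave ε b₂.integrable t x
      have := integral_bilinear_hasLineDerivAt_right_eq_neg_left_of_integrable (μ := volume)
        (B := ContinuousLinearMap.mul ℝ ℂ) (f := b) (f' := b₁) (g := wave ε t x)
        (g' := fun ξ => ((2 * Real.pi * x i - 2 * t * (ε i * ξ i) : ℝ) : ℂ) * I * wave ε t x ξ)
        (v := EuclideanSpace.single i (1 : ℝ)) (by simpa using i1)
        (by
          simp only [ContinuousLinearMap.mul_apply', e0]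
          exact (i0.const_mul _).sub (i2.const_mul _)) (by simpa using i0)
        (fun ξ _ => (b.hasFDerivAt ξ).hasLineDerivAt _) (fun ξ _ => hasLineDerivAt_wave ε t x ξ i)
      simp only [ContinuousLinearMap.mul_apply', e0] at this
      rw [integral_sub (i0.const_mul _) (i2.const_mul _), integral_const_mul, integral_const_mul]
        at this
      unfold ker
      linear_combination this
    refine ⟨C₁ + 2 * C₂, by positivity, fun t x => ?_⟩
    have hπ : (1 : ℝ) ≤ 2 * Real.pi := by linarith [Real.pi_gt_three]
    have h3 : |x i| * ‖ker ε b t x‖ ≤ 2 * |t| * ‖ker ε b₂ t x‖ + ‖ker ε b₁ t x‖ := by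
      have := norm_sub_le ((2 * t * ε i : ℝ) * I * ker ε b₂ t x) (ker ε b₁ t x)
      rw [← ibp t x] at this
      simp only [norm_mul, Complex.norm_real, Real.norm_eq_abs, Complex.norm_I, hεi, abs_two,
        mul_one, abs_of_pos Real.pi_pos] at this
      refine le_trans ?_ this
      have : 0 ≤ |x i| * ‖ker ε b t x‖ := by positivity
      nlinarith
    calc |x i| ^ (k + 1) * ‖ker ε b t x‖ = |x i| ^ k * (|x i| * ‖ker ε b t x‖) := by ring
      _ ≤ |x i| ^ k * (2 * |t| * ‖ker ε b₂ t x‖ + ‖ker ε b₁ t x‖) := by gcongr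
      _ = 2 * |t| * (|x i| ^ k * ‖ker ε b₂ t x‖) + |x i| ^ k * ‖ker ε b₁ t x‖ := by ring
      _ ≤ 2 * (1 + |t|) * (C₂ * (1 + |t|) ^ k) + (1 + |t|) * (C₁ * (1 + |t|) ^ k) := by
        have h4 : |x i| ^ k * ‖ker ε b₁ t x‖ ≤ (1 + |t|) * (C₁ * (1 + |t|) ^ k) := by
          refine (h₁ t x).trans (le_mul_of_one_le_left (by positivity) ?_)
          linarith [abs_nonneg t]
        have h5 := h₂ t x
        have h6 : |t| ≤ 1 + |t| := by linarith
        exact add_le_add (mul_le_mul (by linarith) h5 (by positivity) (by positivity)) h4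
      _ = (C₁ + 2 * C₂) * (1 + |t|) ^ (k + 1) := by ring

theorem norm_pow_mul_norm_ker_le (ε : Fin n → ℝ) (hε : ∀ i, ε i = 1 ∨ ε i = -1)
    (k : ℕ) (b : SchwartzMap (Eucl n) ℂ) :
    ∃ C : ℝ, 0 ≤ C ∧ ∀ t x, ‖x‖ ^ (k + 1) * ‖ker ε b t x‖ ≤ C * (1 + |t|) ^ (k + 1) := by
  choose C hC h using fun i => abs_coord_pow_mul_norm_ker_le ε hε i (k + 1) b
  refine ⟨(n : ℝ) ^ k * ∑ i, C i, mul_nonneg (by positivity) (Finset.sum_nonneg fun i _ => hC i),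
    fun t x => ?_⟩
  have h1 : ‖x‖ ≤ ∑ i, |x i| := by
    rw [EuclideanSpace.norm_eq]
    refine Real.sqrt_le_iff.2 ⟨Finset.sum_nonneg fun _ _ => abs_nonneg _, ?_⟩
    exact Finset.sum_sq_le_sq_sum_of_nonneg fun i _ => abs_nonneg (x i)
  have h2 : (∑ i, |x i|) ^ (k + 1) ≤ (n : ℝ) ^ k * ∑ i, |x i| ^ (k + 1) := by
    simpa using pow_sum_le_card_mul_sum_pow (s := Finset.univ)
      (fun i _ => abs_nonneg (x i)) k
  calc ‖x‖ ^ (k + 1) * ‖ker ε b t x‖ ≤ ((n : ℝ) ^ k * ∑ i, |x i| ^ (k + 1)) * ‖ker ε b t x‖ := by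
        gcongr
        exact (by gcongr : ‖x‖ ^ (k + 1) ≤ (∑ i, |x i|) ^ (k + 1)).trans h2
    _ = (n : ℝ) ^ k * ∑ i, |x i| ^ (k + 1) * ‖ker ε b t x‖ := by
        rw [mul_assoc, Finset.sum_mul]
    _ ≤ (n : ℝ) ^ k * ∑ i, C i * (1 + |t|) ^ (k + 1) := by
        refine mul_le_mul_of_nonneg_left (Finset.sum_le_sum fun i _ => h i t x) (by positivity)
    _ = _ := by rw [← Finset.sum_mul]; ring

/-- Uniform decay of the kernel in space, interpolated from the dispersive and the
nonstationary bound. -/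
theorem exists_norm_ker_le_rpow (hn : 0 < n) {ε : Fin n → ℝ} (hε : ∀ i, ε i = 1 ∨ ε i = -1)
    (k : ℕ) (b : SchwartzMap (Eucl n) ℂ) :
    ∃ C : ℝ, 0 < C ∧ ∀ t x,
      ‖ker ε b t x‖ ≤ C * (1 + ‖x‖) ^ (-(1 / (1 / ((k : ℝ) + 1) + 2 / (n : ℝ)))) := by
  obtain ⟨C₁, hC₁, h₁⟩ := norm_pow_mul_norm_ker_le ε hε k b
  set C₀ : ℝ := ∫ ξ, ‖b ξ‖
  have hC₀ : 0 ≤ C₀ := integral_nonneg fun _ => norm_nonneg _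
  set D : ℝ := ∫ ξ, ‖𝓕 (b : Eucl n → ℂ) ξ‖
  have hD : 0 ≤ D := integral_nonneg fun _ => norm_nonneg _
  set K : ℝ := (k : ℝ) + 1
  have hK : 0 < K := by positivity
  have hn' : (0 : ℝ) < n := by exact_mod_cast hn
  set a : ℝ := 1 / K + 2 / n
  have ha : 0 < a := by positivity
  have fint : Integrable (𝓕 (b : Eucl n → ℂ)) := by
    rw [← SchwartzMap.fourier_coe]; exact (𝓕 b).integrable
  -- the two bounds in a common form
  set A : ℝ := 1 + C₁ ^ (1 / K)
  set B : ℝ := 1 + D ^ (2 / (n : ℝ)) * Real.pi + C₀ ^ (2 / (n : ℝ))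
  set E : ℝ := C₀ ^ a + 2 * A * B
  have hE : 0 < E := by positivity
  refine ⟨E ^ (1 / a), by positivity, fun t x => ?_⟩
  set κ := ‖ker ε b t x‖
  have hκ : 0 ≤ κ := norm_nonneg _
  have hκ0 : κ ≤ C₀ := norm_ker_le ε b t x
  have b1 : ‖x‖ * κ ^ (1 / K) ≤ C₁ ^ (1 / K) * (1 + |t|) := by
    have := Real.rpow_le_rpow (by positivity) (h₁ t x) (by positivity : 0 ≤ 1 / K)
    rw [Real.mul_rpow (by positivity) hκ, Real.mul_rpow hC₁ (by positivity)] at this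
    have e : ∀ y : ℝ, 0 ≤ y → (y ^ (k + 1)) ^ (1 / K) = y := by
      intro y hy
      rw [← Real.rpow_natCast, ← Real.rpow_mul hy]
      have : ((k + 1 : ℕ) : ℝ) * (1 / K) = 1 := by push_cast; exact mul_one_div_cancel hK.ne'
      rw [this, Real.rpow_one]
    rwa [e _ (norm_nonneg _), e _ (by positivity)] at this
  have b2 : (1 + |t|) * κ ^ (2 / (n : ℝ)) ≤ 2 * B := by
    have hc : κ ^ (2 / (n : ℝ)) ≤ C₀ ^ (2 / (n : ℝ)) := by gcongr
    have hp1 : 0 ≤ D ^ (2 / (n : ℝ)) * Real.pi := by positivity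
    rcases le_or_gt |t| 1 with h | h
    · have : (1 + |t|) * κ ^ (2 / (n : ℝ)) ≤ 2 * C₀ ^ (2 / (n : ℝ)) := by
        gcongr; linarith
      simp only [B]; linarith
    · have ht : t ≠ 0 := by rintro rfl; simp at h; linarith
      have htp : 0 < |t| := by linarith
      have := Real.rpow_le_rpow hκ (norm_ker_le_dispersive hε b.continuous b.integrable fint ht x)
        (by positivity : 0 ≤ 2 / (n : ℝ))
      rw [Real.mul_rpow hD (by positivity), ← Real.rpow_mul (by positivity),
        show (n : ℝ) / 2 * (2 / n) = 1 by field_simp, Real.rpow_one] at this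
      have h3 : |t| * κ ^ (2 / (n : ℝ)) ≤ D ^ (2 / (n : ℝ)) * Real.pi := by
        calc _ ≤ |t| * (D ^ (2 / (n : ℝ)) * (Real.pi / |t|)) := by gcongr
          _ = _ := by field_simp
      have h4 : κ ^ (2 / (n : ℝ)) ≤ |t| * κ ^ (2 / (n : ℝ)) :=
        le_mul_of_one_le_left (by positivity) h.le
      have h5 : 0 ≤ C₀ ^ (2 / (n : ℝ)) := by positivity
      simp only [B]; nlinarith
  have b3 : ‖x‖ * κ ^ a ≤ 2 * A * B := by
    have hKn : κ ^ a = κ ^ (1 / K) * κ ^ (2 / (n : ℝ)) :=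
      Real.rpow_add_of_nonneg hκ (by positivity) (by positivity)
    have hA : C₁ ^ (1 / K) ≤ A := by simp [A]
    calc ‖x‖ * κ ^ a = (‖x‖ * κ ^ (1 / K)) * κ ^ (2 / (n : ℝ)) := by rw [hKn]; ring
      _ ≤ (C₁ ^ (1 / K) * (1 + |t|)) * κ ^ (2 / (n : ℝ)) := by gcongr
      _ = C₁ ^ (1 / K) * ((1 + |t|) * κ ^ (2 / (n : ℝ))) := by ring
      _ ≤ A * (2 * B) := by gcongr
      _ = _ := by ring
  have b4 : κ ^ a ≤ C₀ ^ a := by gcongr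
  have b5 : κ ^ a ≤ E * (1 + ‖x‖)⁻¹ := by
    rw [← div_eq_mul_inv, le_div_iff₀ (by positivity)]
    simp only [E]; linarith
  have := Real.rpow_le_rpow (by positivity) b5 (by positivity : 0 ≤ 1 / a)
  rw [← Real.rpow_mul hκ, mul_one_div_cancel ha.ne', Real.rpow_one,
    Real.mul_rpow hE.le (by positivity), Real.inv_rpow (by positivity)] at this
  rwa [Real.rpow_neg (by positivity)]

/-- Nonnegative, continuous and integrable Fourier weights with integrable Fourier transform. -/
structure IsWeight (b : Eucl n → ℂ) : Prop where
  continuous : Continuous b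
  integrable : Integrable b
  integrable_fourier : Integrable (𝓕 b)
  eq_norm : ∀ ξ, b ξ = ((‖b ξ‖ : ℝ) : ℂ)

/-- The superposition `∫ a(x) e^{i(2π p(x)·ξ - T(x)|ξ|²_±)} dμ(x)` of waves. -/
def superpose {X : Type*} [MeasurableSpace X] (ε : Fin n → ℝ) (T : X → ℝ) (p : X → Eucl n)
    (a : X → ℂ) (μ : Measure X) (ξ : Eucl n) : ℂ :=
  ∫ x, a x * wave ε (T x) (p x) ξ ∂μ

theorem integral_wave_mul_conj {X Y : Type*} {ε : Fin n → ℝ} {T : X → ℝ} {p : X → Eucl n} {a : X → ℂ}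
    {S : Y → ℝ} {p' : Y → Eucl n} {a' : Y → ℂ} (b : Eucl n → ℂ) (x : X) (y : Y) :
    ∫ ξ, b ξ * (a x * wave ε (T x) (p x) ξ * starRingEnd ℂ (a' y * wave ε (S y) (p' y) ξ)) =
      a x * starRingEnd ℂ (a' y) * ker ε b (T x - S y) (p x - p' y) := by
  unfold ker
  rw [← integral_const_mul]
  congr 1; ext ξ
  rw [← wave_mul_conj, map_mul]; ring

section superpose
variable {X Y : Type*} [MeasurableSpace X] [MeasurableSpace Y] {μ : Measure X} {ν : Measure Y}
  {ε : Fin n → ℝ} {T : X → ℝ} {p : X → Eucl n} {a : X → ℂ}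
  {S : Y → ℝ} {p' : Y → Eucl n} {a' : Y → ℂ}

theorem norm_superpose_le (ξ : Eucl n) : ‖superpose ε T p a μ ξ‖ ≤ ∫ x, ‖a x‖ ∂μ := by
  refine (norm_integral_le_integral_norm _).trans_eq ?_
  simp [norm_wave]

theorem measurable_wave_comp (hT : Measurable T) (hp : Measurable p) (ha : Measurable a) :
    Measurable fun z : X × Eucl n => a z.1 * wave ε (T z.1) (p z.1) z.2 := by
  have hq : Measurable (quadSym ε) := (continuous_quadSym ε).measurable
  refine (ha.comp measurable_fst).mul ?_
  unfold wave
  refine Complex.measurable_exp.comp ((Complex.measurable_ofReal.comp ?_).mul_const I)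
  exact (((hp.comp measurable_fst).inner measurable_snd).const_mul _).sub
    ((hT.comp measurable_fst).mul (hq.comp measurable_snd))

variable [SFinite μ] [SFinite ν]

theorem measurable_superpose (hT : Measurable T) (hp : Measurable p) (ha : Measurable a) :
    Measurable (superpose ε T p a μ) :=
  ((measurable_wave_comp (ε := ε) hT hp ha).stronglyMeasurable.integral_prod_left').measurable

theorem integral_superpose_mul_conj {b : Eucl n → ℂ} (hb : Integrable b)
    (hT : Measurable T) (hp : Measurable p) (ha : Measurable a) (hai : Integrable a μ)
    (hS : Measurable S) (hp' : Measurable p') (ha' : Measurable a') (hai' : Integrable a' ν) :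
    ∫ ξ, b ξ * (superpose ε T p a μ ξ * starRingEnd ℂ (superpose ε S p' a' ν ξ)) =
      ∫ z : X × Y, a z.1 * starRingEnd ℂ (a' z.2) * ker ε b (T z.1 - S z.2) (p z.1 - p' z.2)
        ∂(μ.prod ν) := by
  have := (integral_superposition_eq (μ := μ) (ν := ν) hb (measurable_wave_comp (ε := ε) hT hp ha)
    (measurable_wave_comp (ε := ε) hS hp' ha') hai.norm hai'.norm
    (fun x ξ => by simp [norm_wave]) (fun x ξ => by simp [norm_wave])).1
  simp only [integral_wave_mul_conj] at this
  exact this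

theorem enorm_integral_superpose_mul_conj_le {b : Eucl n → ℂ} (hb : Integrable b)
    (hT : Measurable T) (hp : Measurable p) (ha : Measurable a) (hai : Integrable a μ)
    (hS : Measurable S) (hp' : Measurable p') (ha' : Measurable a') (hai' : Integrable a' ν) :
    ‖∫ ξ, b ξ * (superpose ε T p a μ ξ * starRingEnd ℂ (superpose ε S p' a' ν ξ))‖ₑ ≤
      ∫⁻ x, (∫⁻ y, ‖a x‖ₑ * ‖a' y‖ₑ * ‖ker ε b (T x - S y) (p x - p' y)‖ₑ ∂ν) ∂μ := by
  have := enorm_integral_superposition_le (μ := μ) (ν := ν) hb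
    (measurable_wave_comp (ε := ε) hT hp ha)
    (measurable_wave_comp (ε := ε) hS hp' ha') hai.norm hai'.norm
    (fun x ξ => by simp [norm_wave]) (fun x ξ => by simp [norm_wave])
  simp only [integral_wave_mul_conj, enorm_mul, RCLike.enorm_conj] at this
  exact this

/-- The square function of a superposition is controlled by the kernel. -/
theorem lintegral_weight_superpose_sq_le {b : Eucl n → ℂ} (hb : IsWeight b)
    (hT : Measurable T) (hp : Measurable p) (ha : Measurable a) (hai : Integrable a μ) :
    ∫⁻ ξ, ‖b ξ‖ₑ * ‖superpose ε T p a μ ξ‖ₑ ^ (2 : ℝ) ≤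
      ∫⁻ x, (∫⁻ y, ‖a x‖ₑ * ‖a y‖ₑ * ‖ker ε b (T x - T y) (p x - p y)‖ₑ ∂μ) ∂μ := by
  refine le_trans (le_of_eq ?_)
    (enorm_integral_superpose_mul_conj_le hb.integrable hT hp ha hai hT hp ha hai)
  have e : ∀ ξ, b ξ * (superpose ε T p a μ ξ * starRingEnd ℂ (superpose ε T p a μ ξ)) =
      ((‖b ξ‖ * ‖superpose ε T p a μ ξ‖ ^ 2 : ℝ) : ℂ) := by
    intro ξ
    conv_lhs => rw [hb.eq_norm ξ, Complex.mul_conj, Complex.normSq_eq_norm_sq]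
    push_cast; rfl
  simp_rw [e]
  rw [integral_complex_ofReal, ← ofReal_norm, Complex.norm_real, Real.norm_of_nonneg
    (integral_nonneg fun _ => by positivity), ofReal_integral_eq_lintegral_ofReal]
  · congr 1; ext ξ
    rw [ENNReal.ofReal_mul (norm_nonneg _), ENNReal.ofReal_pow (norm_nonneg _), ofReal_norm,
      ofReal_norm, ENNReal.rpow_ofNat]
  · refine (hb.integrable.norm.mul_const ((∫ x, ‖a x‖ ∂μ) ^ 2)).mono'
      (hb.integrable.1.norm.mul
        ((measurable_superpose hT hp ha).norm.pow_const 2).aestronglyMeasurable) ?_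
    refine Eventually.of_forall fun ξ => ?_
    rw [norm_mul, norm_norm, norm_pow, norm_norm]
    gcongr
    exact norm_superpose_le ξ
  · exact Eventually.of_forall fun _ => by positivity

end superpose

theorem enorm_integral_mul_conj_le_weight {b u v : Eucl n → ℂ} (hb : Measurable b)
    (hu : Measurable u) (hv : Measurable v) :
    ‖∫ ξ, b ξ * (u ξ * starRingEnd ℂ (v ξ))‖ₑ ≤
      (∫⁻ ξ, ‖b ξ‖ₑ * ‖u ξ‖ₑ ^ (2 : ℝ)) ^ (1 / 2 : ℝ) *
        (∫⁻ ξ, ‖b ξ‖ₑ * ‖v ξ‖ₑ ^ (2 : ℝ)) ^ (1 / 2 : ℝ) := by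
  refine (enorm_integral_le_lintegral_enorm _).trans ?_
  have e : ∀ ξ, ‖b ξ * (u ξ * starRingEnd ℂ (v ξ))‖ₑ =
      (‖b ξ‖ₑ ^ (1 / 2 : ℝ) * ‖u ξ‖ₑ) * (‖b ξ‖ₑ ^ (1 / 2 : ℝ) * ‖v ξ‖ₑ) := by
    intro ξ
    rw [enorm_mul, enorm_mul, RCLike.enorm_conj]
    have : ‖b ξ‖ₑ = ‖b ξ‖ₑ ^ (1 / 2 : ℝ) * ‖b ξ‖ₑ ^ (1 / 2 : ℝ) := by
      rw [← ENNReal.rpow_add_of_nonneg _ _ (by norm_num) (by norm_num)]; norm_num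
    conv_lhs => rw [this]
    ring
  simp_rw [e]
  have hh : (2 : ℝ).HolderConjugate 2 := by
    rw [Real.holderConjugate_iff]; norm_num
  have m1 : Measurable fun ξ => ‖b ξ‖ₑ ^ (1 / 2 : ℝ) * ‖u ξ‖ₑ :=
    (hb.enorm.pow_const _).mul hu.enorm
  have m2 : Measurable fun ξ => ‖b ξ‖ₑ ^ (1 / 2 : ℝ) * ‖v ξ‖ₑ :=
    (hb.enorm.pow_const _).mul hv.enorm
  refine (ENNReal.lintegral_mul_le_Lp_mul_Lq volume hh m1.aemeasurable m2.aemeasurable).trans_eq ?_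
  have e2 : ∀ x y : ℝ≥0∞, (x ^ (1 / 2 : ℝ) * y) ^ (2 : ℝ) = x * y ^ (2 : ℝ) := by
    intro x y
    rw [ENNReal.mul_rpow_of_nonneg _ _ (by norm_num), ← ENNReal.rpow_mul]; norm_num
  simp_rw [e2]

/-- Schur's test for a convolution kernel. -/
theorem lintegral_conv_form_le {f : Eucl n → ℝ≥0∞} (hf : Measurable f) {k : Eucl n → ℝ≥0∞}
    (hk : Measurable k) :
    ∫⁻ x, (∫⁻ y, f x * f y * k (x - y)) ≤ (∫⁻ x, k x) * ∫⁻ x, f x ^ (2 : ℝ) := by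
  have hm1 : Measurable fun z : Eucl n × Eucl n => k (z.1 - z.2) * f z.1 ^ (2 : ℝ) :=
    (hk.comp (measurable_fst.sub measurable_snd)).mul ((hf.comp measurable_fst).pow_const _)
  have hm2 : Measurable fun z : Eucl n × Eucl n => k (z.1 - z.2) * f z.2 ^ (2 : ℝ) :=
    (hk.comp (measurable_fst.sub measurable_snd)).mul ((hf.comp measurable_snd).pow_const _)
  have h1 : ∀ x y, f x * f y * k (x - y) ≤
      2⁻¹ * (k (x - y) * f x ^ (2 : ℝ) + k (x - y) * f y ^ (2 : ℝ)) := by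
    intro x y
    have := ENNReal.young_inequality (f x) (f y) (p := 2) (q := 2)
      (by rw [Real.holderConjugate_iff]; norm_num)
    calc f x * f y * k (x - y) ≤ (f x ^ (2 : ℝ) / ENNReal.ofReal 2 +
        f y ^ (2 : ℝ) / ENNReal.ofReal 2) * k (x - y) := by gcongr
      _ = _ := by
        rw [ENNReal.ofReal_ofNat, div_eq_mul_inv, div_eq_mul_inv]; ring
  calc _ ≤ ∫⁻ x, (∫⁻ y, 2⁻¹ * (k (x - y) * f x ^ (2 : ℝ) + k (x - y) * f y ^ (2 : ℝ))) := by
        exact lintegral_mono fun x => lintegral_mono fun y => h1 x y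
    _ = 2⁻¹ * ((∫⁻ x, (∫⁻ y, k (x - y) * f x ^ (2 : ℝ))) +
          ∫⁻ x, (∫⁻ y, k (x - y) * f y ^ (2 : ℝ))) := by
        have e : ∀ x, ∫⁻ y, 2⁻¹ * (k (x - y) * f x ^ (2 : ℝ) + k (x - y) * f y ^ (2 : ℝ)) =
            2⁻¹ * ((∫⁻ y, k (x - y) * f x ^ (2 : ℝ)) + ∫⁻ y, k (x - y) * f y ^ (2 : ℝ)) := by
          intro x
          have a1 : Measurable fun y => k (x - y) * f x ^ (2 : ℝ) :=
            hm1.comp (measurable_const.prodMk measurable_id)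
          have a2 : Measurable fun y => k (x - y) * f y ^ (2 : ℝ) :=
            hm2.comp (measurable_const.prodMk measurable_id)
          have a3 : Measurable fun y => k (x - y) * f x ^ (2 : ℝ) + k (x - y) * f y ^ (2 : ℝ) :=
            a1.add a2
          rw [lintegral_const_mul _ a3, lintegral_add_left a1]
        simp_rw [e]
        have b1 : Measurable fun x => ∫⁻ y, k (x - y) * f x ^ (2 : ℝ) := hm1.lintegral_prod_right'
        have b2 : Measurable fun x => ∫⁻ y, k (x - y) * f y ^ (2 : ℝ) := hm2.lintegral_prod_right'
        have b3 : Measurable fun x => (∫⁻ y, k (x - y) * f x ^ (2 : ℝ)) +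
          ∫⁻ y, k (x - y) * f y ^ (2 : ℝ) := b1.add b2
        rw [lintegral_const_mul _ b3, lintegral_add_left b1]
    _ = 2⁻¹ * ((∫⁻ x, k x) * (∫⁻ x, f x ^ (2 : ℝ)) + (∫⁻ x, k x) * ∫⁻ x, f x ^ (2 : ℝ)) := by
        congr 2
        · have : ∀ x, ∫⁻ y, k (x - y) * f x ^ (2 : ℝ) = (∫⁻ y, k y) * f x ^ (2 : ℝ) := by
            intro x
            have a1 : Measurable fun y => k (x - y) := hk.comp (measurable_const.sub measurable_id)
            rw [lintegral_mul_const _ a1, lintegral_sub_left_eq_self k x]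
          simp_rw [this]
          rw [lintegral_const_mul _ (hf.pow_const _)]
        · rw [lintegral_lintegral_swap hm2.aemeasurable]
          have : ∀ y, ∫⁻ x, k (x - y) * f y ^ (2 : ℝ) = (∫⁻ y, k y) * f y ^ (2 : ℝ) := by
            intro y
            have a1 : Measurable fun x => k (x - y) := hk.comp (measurable_id.sub measurable_const)
            rw [lintegral_mul_const _ a1, lintegral_sub_right_eq_self k y]
          simp_rw [this]
          rw [lintegral_const_mul _ (hf.pow_const _)]
    _ = _ := by
        rw [← two_mul, ← mul_assoc, ENNReal.inv_mul_cancel (by norm_num) (by norm_num), one_mul]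

theorem ker_zero_eq (ε : Fin n → ℝ) (b : Eucl n → ℂ) : ker ε b 0 = 𝓕⁻ b := by
  ext x
  rw [Real.fourierInv_eq']
  unfold ker wave
  congr 1; ext ξ
  rw [smul_eq_mul, mul_comm, real_inner_comm]
  simp

theorem lintegral_enorm_ker_zero (ε : Fin n → ℝ) {b : Eucl n → ℂ} (hb : IsWeight b) :
    ∫⁻ x, ‖ker ε b 0 x‖ₑ = ENNReal.ofReal (∫ ξ, ‖𝓕 b ξ‖) := by
  rw [ofReal_integral_norm_eq_lintegral_enorm hb.integrable_fourier, ker_zero_eq,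
    ← lintegral_neg_eq_self]
  congr 1; ext x
  rw [Real.fourierInv_eq_fourier_neg, neg_neg]

theorem continuous_ker (ε : Fin n → ℝ) {b : Eucl n → ℂ} (hb : Integrable b) :
    Continuous fun z : ℝ × Eucl n => ker ε b z.1 z.2 := by
  unfold ker
  refine continuous_of_dominated (fun z => (integrable_mul_wave ε hb z.1 z.2).1)
    (fun z => Eventually.of_forall fun ξ => ?_) hb.norm (Eventually.of_forall fun ξ => ?_)
  · simp [norm_wave]
  · fun_prop

/-- Weighted Plancherel inequality at a fixed time. -/
theorem lintegral_weight_superpose_const_sq_le {ε : Fin n → ℝ} {b : Eucl n → ℂ} (hb : IsWeight b)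
    (τ : ℝ) {f : Eucl n → ℂ} (hf : Measurable f) (hfi : Integrable f) :
    ∫⁻ ξ, ‖b ξ‖ₑ * ‖superpose ε (fun _ => τ) (fun y => -y) f volume ξ‖ₑ ^ (2 : ℝ) ≤
      ENNReal.ofReal (∫ ξ, ‖𝓕 b ξ‖) * ∫⁻ x, ‖f x‖ₑ ^ (2 : ℝ) := by
  refine (lintegral_weight_superpose_sq_le hb measurable_const measurable_neg hf hfi).trans ?_
  rw [← lintegral_enorm_ker_zero ε hb]
  have hk : Measurable fun x => ‖ker ε b 0 (-x)‖ₑ :=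
    (((continuous_ker ε hb.integrable).comp (Continuous.prodMk_right 0)).comp
      continuous_neg).measurable.enorm
  refine (le_of_eq ?_).trans ((lintegral_conv_form_le hf.enorm hk).trans_eq ?_)
  · congr 1; ext x; congr 1; ext y
    rw [sub_self, show -x - -y = -(x - y) by abel]
  · rw [lintegral_neg_eq_self (fun x => ‖ker ε b 0 x‖ₑ)]

/-- Convolution with the kernel of the frequency localized propagator. -/
def convKer (ε : Fin n → ℝ) (b : Eucl n → ℂ) (τ : ℝ) (f : Eucl n → ℂ) (x : Eucl n) : ℂ :=
  ∫ y, f y * ker ε b τ (x - y)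

section convKer
variable {ε : Fin n → ℝ} {b : Eucl n → ℂ} {τ : ℝ} {f g : Eucl n → ℂ}

theorem continuous_ker_sub (ε : Fin n → ℝ) (hb : Integrable b) (τ : ℝ) :
    Continuous fun z : Eucl n × Eucl n => ker ε b τ (z.1 - z.2) :=
  ((continuous_ker ε hb).comp (Continuous.prodMk_right τ)).comp (continuous_fst.sub continuous_snd)

theorem measurable_convKer (hb : Integrable b) (hf : Measurable f) :
    Measurable (convKer ε b τ f) := by
  have hm : Measurable fun z : Eucl n × Eucl n => f z.2 * ker ε b τ (z.1 - z.2) :=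
    (hf.comp measurable_snd).mul (continuous_ker_sub ε hb τ).measurable
  exact hm.stronglyMeasurable.integral_prod_right'.measurable

theorem enorm_convKer_le {A : ℝ} (hA : ∀ x, ‖ker ε b τ x‖ ≤ A) (x : Eucl n) :
    ‖convKer ε b τ f x‖ₑ ≤ ENNReal.ofReal A * ∫⁻ y, ‖f y‖ₑ := by
  refine (enorm_integral_le_lintegral_enorm _).trans ?_
  rw [← lintegral_const_mul' _ _ ENNReal.ofReal_ne_top]
  refine lintegral_mono fun y => ?_
  rw [enorm_mul, mul_comm, ← ofReal_norm (ker ε b τ (x - y))]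
  gcongr
  exact hA _

theorem integrable_mul_ker_sub (hb : Integrable b) (hfi : Integrable f) (x : Eucl n) :
    Integrable fun y => f y * ker ε b τ (x - y) := by
  refine (hfi.norm.mul_const (∫ ξ, ‖b ξ‖)).mono' (hfi.1.mul
    ((continuous_ker_sub ε hb τ).comp (Continuous.prodMk_right x)).aestronglyMeasurable) ?_
  refine Eventually.of_forall fun y => ?_
  rw [norm_mul]
  gcongr
  exact norm_ker_le ε b τ _

theorem convKer_add (hb : Integrable b) (hfi : Integrable f) (hgi : Integrable g) (x : Eucl n) :
    convKer ε b τ (fun y => f y + g y) x = convKer ε b τ f x + convKer ε b τ g x := by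
  unfold convKer
  rw [← integral_add (integrable_mul_ker_sub hb hfi x) (integrable_mul_ker_sub hb hgi x)]
  congr 1; ext y; ring

theorem integrable_pairing_ker (hb : Integrable b) (hf : Measurable f)
    (hfi : Integrable f) (hg : Measurable g) (hgi : Integrable g) :
    Integrable (fun z : Eucl n × Eucl n => f z.1 * starRingEnd ℂ (g z.2) *
      ker ε b τ (z.2 - z.1)) (volume.prod volume) := by
  have hk : Measurable fun z : Eucl n × Eucl n => ker ε b τ (z.2 - z.1) :=
    ((continuous_ker_sub ε hb τ).comp continuous_swap).measurable
  have m1 : Measurable fun z : Eucl n × Eucl n => f z.1 := hf.comp measurable_fst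
  have m2 : Measurable fun z : Eucl n × Eucl n => starRingEnd ℂ (g z.2) :=
    Complex.continuous_conj.measurable.comp (hg.comp measurable_snd)
  have hi2 := (hfi.norm.mul_prod hgi.norm).mul_const (∫ ξ, ‖b ξ‖)
  refine hi2.mono' ((m1.mul m2).mul hk).aestronglyMeasurable (Eventually.of_forall fun z => ?_)
  rw [norm_mul, norm_mul, RCLike.norm_conj]
  gcongr
  exact norm_ker_le ε b _ _

theorem integral_superpose_eq_integral_convKer (hb : Integrable b) (hf : Measurable f)
    (hfi : Integrable f) (hg : Measurable g) (hgi : Integrable g) :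
    ∫ ξ, b ξ * (superpose ε (fun _ => τ) (fun y => -y) f volume ξ *
      starRingEnd ℂ (superpose ε (fun _ => 0) (fun y => -y) g volume ξ)) =
      ∫ x, convKer ε b τ f x * starRingEnd ℂ (g x) := by
  have hn : Measurable fun y : Eucl n => -y := measurable_neg
  refine (integral_superpose_mul_conj (ε := ε) (μ := volume) (ν := volume) (T := fun _ => τ)
    (S := fun _ => 0) (p := fun y => -y) (p' := fun y => -y) hb measurable_const hn hf hfi
    measurable_const hn hg hgi).trans ?_
  have e : ∀ z : Eucl n × Eucl n, f z.1 * starRingEnd ℂ (g z.2) * ker ε b (τ - 0) (-z.1 - -z.2) =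
      f z.1 * starRingEnd ℂ (g z.2) * ker ε b τ (z.2 - z.1) := by
    intro z
    rw [sub_zero, neg_sub_neg]
  simp_rw [e]
  rw [integral_prod_symm _ (integrable_pairing_ker hb hf hfi hg hgi)]
  congr 1; ext x
  unfold convKer
  rw [← integral_mul_const]
  congr 1; ext y
  ring

theorem le_of_le_sqrt_mul {I D F : ℝ≥0∞} (hI : I ≠ ∞)
    (h : I ≤ (D * F) ^ (1 / 2 : ℝ) * (D * I) ^ (1 / 2 : ℝ)) : I ≤ D ^ (2 : ℝ) * F := by
  rcases eq_or_ne I 0 with rfl | h0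
  · exact zero_le
  have hs : ∀ y : ℝ≥0∞, y ^ (1 / 2 : ℝ) * y ^ (1 / 2 : ℝ) = y := by
    intro y
    rw [← ENNReal.rpow_add_of_nonneg _ _ (by norm_num) (by norm_num)]; norm_num
  have hi0 : I ^ (1 / 2 : ℝ) ≠ 0 := by simp [h0, hI]
  have hit : I ^ (1 / 2 : ℝ) ≠ ∞ := by simp [h0, hI]
  have h1 : I ^ (1 / 2 : ℝ) ≤ D * F ^ (1 / 2 : ℝ) := by
    rw [ENNReal.mul_rpow_of_nonneg _ _ (by norm_num), ENNReal.mul_rpow_of_nonneg _ _ (by norm_num)]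
      at h
    have : I ^ (1 / 2 : ℝ) * I ^ (1 / 2 : ℝ) ≤ (D * F ^ (1 / 2 : ℝ)) * I ^ (1 / 2 : ℝ) := by
      calc _ = I := hs I
        _ ≤ _ := h
        _ = (D ^ (1 / 2 : ℝ) * D ^ (1 / 2 : ℝ)) * F ^ (1 / 2 : ℝ) * I ^ (1 / 2 : ℝ) := by ring
        _ = _ := by rw [hs]
    exact (ENNReal.mul_le_mul_iff_left hi0 hit).1 this
  calc I = I ^ (1 / 2 : ℝ) * I ^ (1 / 2 : ℝ) := (hs I).symm
    _ ≤ (D * F ^ (1 / 2 : ℝ)) * (D * F ^ (1 / 2 : ℝ)) := by gcongr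
    _ = D ^ (2 : ℝ) * (F ^ (1 / 2 : ℝ) * F ^ (1 / 2 : ℝ)) := by rw [ENNReal.rpow_ofNat]; ring
    _ = _ := by rw [hs]

theorem lintegral_convKer_sq_le (hb : IsWeight b) (hf : Measurable f) (hfi : Integrable f) :
    ∫⁻ x, ‖convKer ε b τ f x‖ₑ ^ (2 : ℝ) ≤
      ENNReal.ofReal (∫ ξ, ‖𝓕 b ξ‖) ^ (2 : ℝ) * ∫⁻ x, ‖f x‖ₑ ^ (2 : ℝ) := by
  set D := ENNReal.ofReal (∫ ξ, ‖𝓕 b ξ‖)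
  have hTm : Measurable (convKer ε b τ f) := measurable_convKer hb.integrable hf
  have hball : ∀ R : ℕ, ∫⁻ x in Metric.closedBall (0 : Eucl n) R, ‖convKer ε b τ f x‖ₑ ^ (2 : ℝ) ≤
      D ^ (2 : ℝ) * ∫⁻ x, ‖f x‖ₑ ^ (2 : ℝ) := by
    intro R
    set s := Metric.closedBall (0 : Eucl n) R
    have hs : MeasurableSet s := measurableSet_closedBall
    set M : ℝ≥0∞ := ENNReal.ofReal (∫ ξ, ‖b ξ‖) * ∫⁻ y, ‖f y‖ₑ
    have hM : M ≠ ∞ := ENNReal.mul_ne_top ENNReal.ofReal_ne_top hfi.2.ne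
    have hTb : ∀ x, ‖convKer ε b τ f x‖ₑ ≤ M := fun x => enorm_convKer_le (norm_ker_le ε b τ) x
    set g : Eucl n → ℂ := s.indicator (convKer ε b τ f) with hg
    have hgm : Measurable g := hTm.indicator hs
    have hgi : Integrable g := by
      refine ⟨hgm.aestronglyMeasurable, ?_⟩
      have : ∫⁻ x, ‖g x‖ₑ ≤ M * volume s := by
        rw [← setLIntegral_const, ← lintegral_indicator hs]
        refine lintegral_mono fun x => ?_
        rw [hg, enorm_indicator_eq_indicator_enorm]
        exact Set.indicator_le_indicator (hTb x)
      exact this.trans_lt (ENNReal.mul_lt_top hM.lt_top measure_closedBall_lt_top)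
    have eI : ∀ x, ‖g x‖ₑ ^ (2 : ℝ) = s.indicator (fun x => ‖convKer ε b τ f x‖ₑ ^ (2 : ℝ)) x := by
      intro x
      rw [hg, enorm_indicator_eq_indicator_enorm]
      by_cases hx : x ∈ s <;> simp [hx]
    have e1 : ∫⁻ x in s, ‖convKer ε b τ f x‖ₑ ^ (2 : ℝ) = ∫⁻ x, ‖g x‖ₑ ^ (2 : ℝ) := by
      rw [← lintegral_indicator hs]
      exact lintegral_congr fun x => (eI x).symm
    have hIfin : ∫⁻ x, ‖g x‖ₑ ^ (2 : ℝ) ≠ ∞ := by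
      rw [← e1]
      refine ne_top_of_le_ne_top ?_ (lintegral_mono (g := fun _ => M ^ (2 : ℝ)) fun x => ?_)
      · rw [setLIntegral_const]
        exact ENNReal.mul_ne_top (ENNReal.rpow_ne_top_of_nonneg (by norm_num) hM)
          measure_closedBall_lt_top.ne
      · simp only
        gcongr
        exact hTb x
    have e2 : ∫⁻ x, ‖g x‖ₑ ^ (2 : ℝ) = ‖∫ x, convKer ε b τ f x * starRingEnd ℂ (g x)‖ₑ := by
      have e : ∀ x, convKer ε b τ f x * starRingEnd ℂ (g x) = ((‖g x‖ ^ 2 : ℝ) : ℂ) := by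
        intro x
        by_cases hx : x ∈ s
        · simp [hg, hx, Complex.mul_conj, Complex.normSq_eq_norm_sq]
        · simp [hg, hx]
      simp_rw [e]
      have e3 : ∀ x, ‖g x‖ₑ ^ (2 : ℝ) = ENNReal.ofReal (‖g x‖ ^ 2) := by
        intro x
        rw [ENNReal.ofReal_pow (norm_nonneg _), ofReal_norm, ENNReal.rpow_ofNat]
      rw [integral_complex_ofReal, ← ofReal_norm, Complex.norm_real, Real.norm_of_nonneg
        (integral_nonneg fun _ => by positivity), ofReal_integral_eq_lintegral_ofReal]
      · exact lintegral_congr e3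
      · refine ⟨(hgm.norm.pow_const 2).aestronglyMeasurable, ?_⟩
        refine lt_of_le_of_lt (lintegral_mono (g := fun x => ‖g x‖ₑ ^ (2 : ℝ)) fun x => ?_)
          hIfin.lt_top
        simp [enorm_pow]
      · exact Eventually.of_forall fun _ => by positivity
    rw [e1]
    refine le_of_le_sqrt_mul hIfin ?_
    conv_lhs => rw [e2, ← integral_superpose_eq_integral_convKer hb.integrable hf hfi hgm hgi]
    refine (enorm_integral_mul_conj_le_weight hb.continuous.measurable
      (measurable_superpose measurable_const measurable_neg hf)
      (measurable_superpose measurable_const measurable_neg hgm)).trans ?_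
    gcongr
    · exact lintegral_weight_superpose_const_sq_le hb τ hf hfi
    · exact lintegral_weight_superpose_const_sq_le hb 0 hgm hgi
  have hcov : AECover (volume : Measure (Eucl n)) atTop
      (fun R : ℕ => Metric.closedBall (0 : Eucl n) R) :=
    aecover_closedBall tendsto_natCast_atTop_atTop
  exact le_of_tendsto (hcov.lintegral_tendsto_of_nat (hTm.enorm.pow_const _).aemeasurable)
    (Eventually.of_forall hball)

end convKer

/-- Dispersive `L^{r'} → L^r` bound for the localized propagator, in dual form. -/
theorem exists_enorm_pairing_le {ε : Fin n → ℝ} (hε : ∀ i, ε i = 1 ∨ ε i = -1) {r : ℝ}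
    (hr : 2 < r) {D : ℝ} (hD : 0 < D) :
    ∃ C : ℝ, 0 < C ∧ ∀ b : Eucl n → ℂ, IsWeight b → ∫ ξ, ‖𝓕 b ξ‖ ≤ D → ∀ τ : ℝ, τ ≠ 0 →
      ∀ f g : Eucl n → ℂ, Measurable f → Integrable f → Measurable g → Integrable g →
      ∫⁻ x, ‖f x‖ₑ ^ (r / (r - 1)) ≠ ∞ →
      ‖∫ ξ, b ξ * (superpose ε (fun _ => τ) (fun y => -y) f volume ξ *
        starRingEnd ℂ (superpose ε (fun _ => 0) (fun y => -y) g volume ξ))‖ₑ ≤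
      ENNReal.ofReal (C * |τ| ^ (-((n : ℝ) * (1 / 2 - 1 / r)))) *
        ((∫⁻ x, ‖f x‖ₑ ^ (r / (r - 1))) ^ ((r - 1) / r) *
          (∫⁻ x, ‖g x‖ₑ ^ (r / (r - 1))) ^ ((r - 1) / r)) := by
  have hr0 : 0 < r := by linarith
  have hr1 : 0 < r - 1 := by linarith
  have hr2 : 0 < r - 2 := by linarith
  set K : ℝ := r / (r - 2) * (4 * D ^ 2 * 2 ^ (r - 2)) with hK
  have hK0 : 0 < K := by positivity
  clear_value K
  refine ⟨K ^ (1 / r) * (D * Real.pi ^ ((n : ℝ) / 2)) ^ ((r - 2) / r), by positivity, ?_⟩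
  intro b hb hbD τ hτ f g hf hfi hg hgi hfin
  set N := ∫⁻ x, ‖f x‖ₑ ^ (r / (r - 1)) with hN
  rcases eq_or_ne N 0 with hN0 | hN0
  · have hf0 : f =ᵐ[volume] 0 := by
      have := (lintegral_eq_zero_iff (hf.enorm.pow_const _)).1 hN0
      filter_upwards [this] with x hx
      have h1 : 0 < r / (r - 1) := by positivity
      simpa [ENNReal.rpow_eq_zero_iff, h1, h1.not_gt] using hx
    have : ∀ ξ, superpose ε (fun _ => τ) (fun y => -y) f volume ξ = 0 := by
      intro ξ
      refine integral_eq_zero_of_ae ?_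
      filter_upwards [hf0] with x hx
      simp [hx]
    simp [this]
  have hτ' : 0 < |τ| := abs_pos.2 hτ
  have hν : 0 < N.toReal := ENNReal.toReal_pos hN0 hfin
  set ν := N.toReal
  set A : ℝ := D * (Real.pi / |τ|) ^ ((n : ℝ) / 2) with hA
  have hA0 : 0 < A := by positivity
  have hker : ∀ x, ‖ker ε b τ x‖ ≤ A := fun x =>
    (norm_ker_le_dispersive hε hb.continuous hb.integrable hb.integrable_fourier hτ x).trans
      (mul_le_mul_of_nonneg_right hbD (by positivity))
  have hTm : Measurable (convKer ε b τ f) := measurable_convKer hb.integrable hf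
  have hTr : ∫⁻ x, ‖convKer ε b τ f x‖ₑ ^ r ≤
      ENNReal.ofReal (r / (r - 2)) * (4 * ENNReal.ofReal D ^ (2 : ℝ) *
        ENNReal.ofReal ((2 * A * ν) ^ (r - 2) * ν)) := by
    refine lintegral_rpow_le_of_truncation hr hf.enorm hTm.enorm hA0 hν
      (ENNReal.ofReal_toReal hfin).ge fun h => ?_
    set s : Set (Eucl n) := {y | ‖f y‖ₑ ≤ h} with hs
    have hsm : MeasurableSet s := measurableSet_le hf.enorm measurable_const
    have hsc : sᶜ = {y | h < ‖f y‖ₑ} := by ext y; simp [hs]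
    refine ⟨fun x => ‖convKer ε b τ (s.indicator f) x‖ₑ,
      (measurable_convKer hb.integrable (hf.indicator hsm)).enorm, fun x => ?_, ?_⟩
    · have e : f = fun y => sᶜ.indicator f y + s.indicator f y := by
        ext y; exact (Set.indicator_compl_add_self_apply s f y).symm
      have e2 : convKer ε b τ f x = convKer ε b τ (sᶜ.indicator f) x +
          convKer ε b τ (s.indicator f) x := by
        conv_lhs => rw [e]
        exact convKer_add hb.integrable (hfi.indicator hsm.compl) (hfi.indicator hsm) x
      rw [e2]
      refine (enorm_add_le _ _).trans ?_
      gcongr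
      refine (enorm_convKer_le hker x).trans_eq ?_
      rw [← hsc]
      congr 1
      refine lintegral_congr fun y => ?_
      rw [enorm_indicator_eq_indicator_enorm]
    · refine (lintegral_convKer_sq_le hb (hf.indicator hsm) (hfi.indicator hsm)).trans ?_
      have : ∀ y, ‖s.indicator f y‖ₑ ^ (2 : ℝ) =
          {y | ‖f y‖ₑ ≤ h}.indicator (fun y => ‖f y‖ₑ ^ (2 : ℝ)) y := by
        intro y
        rw [← hs, enorm_indicator_eq_indicator_enorm]
        by_cases hy : y ∈ s <;> simp [hy]
      simp_rw [this]
      gcongr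
  rw [integral_superpose_eq_integral_convKer hb.integrable hf hfi hg hgi]
  have hh : r.HolderConjugate (r / (r - 1)) := by
    rw [Real.holderConjugate_iff]
    refine ⟨by linarith, ?_⟩
    field_simp; ring
  have hTle : (∫⁻ x, ‖convKer ε b τ f x‖ₑ ^ r) ^ (1 / r) ≤
      ENNReal.ofReal (K ^ (1 / r) * (D * Real.pi ^ ((n : ℝ) / 2)) ^ ((r - 2) / r) *
        |τ| ^ (-((n : ℝ) * (1 / 2 - 1 / r)))) * N ^ ((r - 1) / r) := by
    calc (∫⁻ x, ‖convKer ε b τ f x‖ₑ ^ r) ^ (1 / r) ≤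
        (ENNReal.ofReal (K * (A ^ (r - 2) * ν ^ (r - 1)))) ^ (1 / r) := by
          gcongr
          refine hTr.trans_eq ?_
          rw [ENNReal.ofReal_rpow_of_pos hD, Real.rpow_two,
            show (4 : ℝ≥0∞) = ENNReal.ofReal 4 by simp, ← ENNReal.ofReal_mul (by norm_num),
            ← ENNReal.ofReal_mul (by positivity), ← ENNReal.ofReal_mul (by positivity)]
          congr 1
          have : ν ^ (r - 1) = ν ^ (r - 2) * ν := by
            rw [← Real.rpow_add_one hν.ne']; congr 1; ring
          rw [Real.mul_rpow (by positivity) hν.le, Real.mul_rpow (by norm_num) hA0.le, this, hK]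
          ring
      _ = ENNReal.ofReal (K ^ (1 / r) * (A ^ ((r - 2) / r) * ν ^ ((r - 1) / r))) := by
          rw [ENNReal.ofReal_rpow_of_pos (by positivity), Real.mul_rpow hK0.le (by positivity),
            Real.mul_rpow (by positivity) (by positivity), ← Real.rpow_mul hA0.le,
            ← Real.rpow_mul hν.le, mul_one_div, mul_one_div]
      _ = _ := by
          rw [← ENNReal.ofReal_toReal hfin, ENNReal.ofReal_rpow_of_pos hν,
            ← ENNReal.ofReal_mul (by positivity)]
          congr 1
          have : A ^ ((r - 2) / r) = (D * Real.pi ^ ((n : ℝ) / 2)) ^ ((r - 2) / r) *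
              |τ| ^ (-((n : ℝ) * (1 / 2 - 1 / r))) := by
            have h1 : A = D * Real.pi ^ ((n : ℝ) / 2) * |τ| ^ (-((n : ℝ) / 2)) := by
              rw [hA, Real.div_rpow Real.pi_pos.le hτ'.le, Real.rpow_neg hτ'.le]; ring
            rw [h1, Real.mul_rpow (by positivity) (by positivity), ← Real.rpow_mul hτ'.le]
            congr 2
            field_simp
          rw [this]; ring
  calc _ ≤ ∫⁻ x, ‖convKer ε b τ f x‖ₑ * ‖g x‖ₑ := by
        refine (enorm_integral_le_lintegral_enorm _).trans_eq ?_
        simp_rw [enorm_mul, RCLike.enorm_conj]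
    _ ≤ (∫⁻ x, ‖convKer ε b τ f x‖ₑ ^ r) ^ (1 / r) *
        (∫⁻ x, ‖g x‖ₑ ^ (r / (r - 1))) ^ (1 / (r / (r - 1))) :=
        ENNReal.lintegral_mul_le_Lp_mul_Lq volume hh hTm.enorm.aemeasurable hg.enorm.aemeasurable
    _ ≤ _ := by
        rw [one_div_div, ← mul_assoc]
        gcongr

/-- A measurable choice of an index realizing a finite maximum. -/
theorem exists_measurable_selector {X : Type*} [MeasurableSpace X] {f : ℕ → X → ℝ≥0∞}
    (hf : ∀ i, Measurable (f i)) (N : ℕ) :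
    ∃ σ : X → ℕ, Measurable σ ∧ ∀ x, ((Finset.range (N + 1)).sup fun i => f i x) = f (σ x) x := by
  classical
  induction N with
  | zero => exact ⟨fun _ => 0, measurable_const, fun x => by simp⟩
  | succ N ih =>
    obtain ⟨σ, hσ, h⟩ := ih
    have hs : MeasurableSet {x | ((Finset.range (N + 1)).sup fun i => f i x) ≤ f (N + 1) x} :=
      measurableSet_le (measurable_finset_sup _ hf) (hf _)
    refine ⟨fun x => if ((Finset.range (N + 1)).sup fun i => f i x) ≤ f (N + 1) x then N + 1
      else σ x, Measurable.ite hs measurable_const hσ, fun x => ?_⟩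
    rw [Finset.range_add_one, Finset.sup_insert]
    dsimp only
    split_ifs with hx
    · exact sup_eq_left.2 hx
    · rw [sup_eq_right.2 (not_le.1 hx).le, h x]

theorem integral_mul_ker_eq_integral_superpose {X : Type*} [MeasurableSpace X] {μ : Measure X}
    [SFinite μ] {ε : Fin n → ℝ} {h : Eucl n → ℂ} (hh : Measurable h) (hhi : Integrable h) {T : X → ℝ}
    {p : X → Eucl n} (hT : Measurable T) (hp : Measurable p) {a : X → ℂ} (ha : Measurable a)
    (hai : Integrable a μ) :
    ∫ x, a x * ker ε h (T x) (p x) ∂μ = ∫ ξ, h ξ * superpose ε T p a μ ξ := by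
  have hm : Measurable fun z : X × Eucl n => h z.2 * (a z.1 * wave ε (T z.1) (p z.1) z.2) :=
    (hh.comp measurable_snd).mul (measurable_wave_comp hT hp ha)
  have hint : Integrable (fun z : X × Eucl n => h z.2 * (a z.1 * wave ε (T z.1) (p z.1) z.2))
      (μ.prod volume) := by
    refine (hai.norm.mul_prod hhi.norm).mono' hm.aestronglyMeasurable
      (Eventually.of_forall fun z => ?_)
    rw [norm_mul, norm_mul, norm_wave, mul_one, mul_comm]
  have := integral_integral_swap (f := fun x ξ => h ξ * (a x * wave ε (T x) (p x) ξ)) hint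
  unfold ker superpose
  simp_rw [← integral_const_mul]
  rw [← this]
  congr 1; ext x; congr 1; ext ξ; ring

theorem measurable_ker (ε : Fin n → ℝ) {h : Eucl n → ℂ} (hh : Integrable h) :
    Measurable fun z : ℝ × Eucl n => ker ε h z.1 z.2 :=
  (continuous_ker ε hh).measurable

theorem measurable_comp_prodMk {X Y Z W : Type*} [MeasurableSpace X] [MeasurableSpace Y]
    [MeasurableSpace Z] [MeasurableSpace W] {K : Y × Z → W} (hK : Measurable K) {f : X → Y}
    {g : X → Z} (hf : Measurable f) (hg : Measurable g) : Measurable fun x => K (f x, g x) :=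
  hK.comp (hf.prodMk hg)

theorem measurable_ker_comp {X : Type*} [MeasurableSpace X] {ε : Fin n → ℝ} {h : Eucl n → ℂ}
    (hh : Integrable h) {T : X → ℝ} {p : X → Eucl n} (hT : Measurable T) (hp : Measurable p) :
    Measurable fun x => ker ε h (T x) (p x) :=
  measurable_comp_prodMk (measurable_ker ε hh) hT hp

theorem setLIntegral_enorm_ker_rpow_le {ε : Fin n → ℝ} {b : Eucl n → ℂ} (hb : IsWeight b) {p : ℝ}
    (hp : 2 ≤ p) {T : ℝ → ℝ} {y : ℝ → Eucl n} (hT : Measurable T) (hy : Measurable y)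
    {k : ℝ → ℝ≥0∞} (hk : Measurable k)
    (hker : ∀ r s, ‖ker ε b (T r - T s) (y r - y s)‖ₑ ≤ k (r - s)) {h : Eucl n → ℂ}
    (hh : Measurable h) (hhi : Integrable h) (hbh : ∀ ξ, b ξ * h ξ = h ξ) {A : Set ℝ}
    (hA : MeasurableSet A) (hAf : volume A ≠ ∞) :
    ∫⁻ r in A, ‖ker ε h (T r) (y r)‖ₑ ^ p ≤
      (∫⁻ ξ, ‖h ξ‖ₑ ^ (2 : ℝ)) ^ (p / 2) * ∫⁻ r, k r ^ (p / 2) := by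
  have hp0 : 0 < p := by linarith
  have hp1 : 0 < p - 1 := by linarith
  obtain ⟨U, hU⟩ : ∃ U : ℝ → ℂ, ∀ r, U r = ker ε h (T r) (y r) := ⟨_, fun _ => rfl⟩
  have hUm : Measurable U := by
    rw [funext hU]
    exact measurable_ker_comp hhi hT hy
  have hUb : ∀ r, ‖U r‖ ≤ ∫ ξ, ‖h ξ‖ := fun r => by rw [hU]; exact norm_ker_le ε h _ _
  have hc : 0 ≤ ∫ ξ, ‖h ξ‖ := integral_nonneg fun _ => norm_nonneg _
  simp_rw [← hU]
  set a : ℝ → ℂ := A.indicator fun r => ((‖U r‖ ^ (p - 2) : ℝ) : ℂ) * starRingEnd ℂ (U r) with ha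
  have ham : Measurable a := Measurable.indicator
    ((Complex.measurable_ofReal.comp (hUm.norm.pow_const _)).mul
      (Complex.continuous_conj.measurable.comp hUm)) hA
  have hpow : ∀ r, ‖U r‖ ^ (p - 2) * ‖U r‖ = ‖U r‖ ^ (p - 1) := by
    intro r
    rw [← Real.rpow_add_one' (norm_nonneg _) (by linarith)]; congr 1; ring
  have han : ∀ r, ‖a r‖ = A.indicator (fun r => ‖U r‖ ^ (p - 1)) r := by
    intro r
    by_cases hr : r ∈ A
    · simp only [ha, Set.indicator_of_mem hr]
      rw [norm_mul, RCLike.norm_conj, Complex.norm_real, Real.norm_of_nonneg (by positivity), hpow]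
    · simp [ha, hr]
  have hae : ∀ r, ‖a r‖ₑ = A.indicator (fun r => ‖U r‖ₑ ^ (p - 1)) r := by
    intro r
    rw [← ofReal_norm, han]
    by_cases hr : r ∈ A
    · simp only [Set.indicator_of_mem hr]
      rw [← ENNReal.ofReal_rpow_of_nonneg (norm_nonneg _) hp1.le, ofReal_norm]
    · simp [hr]
  have hai : Integrable a := by
    have hi : Integrable (A.indicator fun _ : ℝ => (∫ ξ, ‖h ξ‖) ^ (p - 1)) :=
      (integrable_indicator_iff hA).2 (integrableOn_const hAf)
    refine hi.mono' ham.aestronglyMeasurable (Eventually.of_forall fun r => ?_)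
    rw [han]
    refine Set.indicator_le_indicator ?_
    gcongr
    exact hUb r
  have haU : ∀ r, a r * U r = A.indicator (fun r => ((‖U r‖ ^ p : ℝ) : ℂ)) r := by
    intro r
    by_cases hr : r ∈ A
    · simp only [ha, Set.indicator_of_mem hr]
      rw [mul_assoc, mul_comm (starRingEnd ℂ (U r)), Complex.mul_conj, Complex.normSq_eq_norm_sq,
        ← Complex.ofReal_mul, sq, ← mul_assoc, hpow,
        ← Real.rpow_add_one' (norm_nonneg _) (by linarith)]
      congr 3; ring
    · simp [ha, hr]
  set X := ∫⁻ r in A, ‖U r‖ₑ ^ p with hX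
  have hXt : X ≠ ∞ := by
    refine ne_top_of_le_ne_top ?_ (lintegral_mono (g := fun _ => ENNReal.ofReal (∫ ξ, ‖h ξ‖) ^ p)
      fun r => ?_)
    · rw [setLIntegral_const]
      exact ENNReal.mul_ne_top (ENNReal.rpow_ne_top_of_nonneg hp0.le ENNReal.ofReal_ne_top) hAf
    · rw [← ofReal_norm]
      exact ENNReal.rpow_le_rpow (ENNReal.ofReal_le_ofReal (hUb r)) hp0.le
  have h1 : X = ‖∫ r, a r * U r‖ₑ := by
    simp_rw [haU]
    rw [integral_indicator hA, integral_complex_ofReal, ← ofReal_norm, Complex.norm_real,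
      Real.norm_of_nonneg (integral_nonneg fun _ => by positivity),
      ofReal_integral_eq_lintegral_ofReal]
    · refine lintegral_congr fun r => ?_
      rw [← ENNReal.ofReal_rpow_of_nonneg (norm_nonneg _) hp0.le, ofReal_norm]
    · refine (integrableOn_const (C := (∫ ξ, ‖h ξ‖) ^ p) hAf).mono'
        (hUm.norm.pow_const _).aestronglyMeasurable (Eventually.of_forall fun r => ?_)
      rw [Real.norm_of_nonneg (by positivity)]
      gcongr
      exact hUb r
    · exact Eventually.of_forall fun _ => by positivity
  set S := superpose ε T y a volume with hS
  have hSm : Measurable S := measurable_superpose hT hy ham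
  have h2 : X ≤ (∫⁻ ξ, ‖b ξ‖ₑ * ‖h ξ‖ₑ ^ (2 : ℝ)) ^ (1 / 2 : ℝ) *
      (∫⁻ ξ, ‖b ξ‖ₑ * ‖S ξ‖ₑ ^ (2 : ℝ)) ^ (1 / 2 : ℝ) := by
    have e : ∫ r, a r * U r = ∫ ξ, b ξ * (h ξ * starRingEnd ℂ (starRingEnd ℂ (S ξ))) := by
      simp_rw [hU]
      rw [integral_mul_ker_eq_integral_superpose hh hhi hT hy ham hai]
      congr 1; ext ξ
      rw [Complex.conj_conj, ← mul_assoc, hbh]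
    rw [h1, e]
    refine (enorm_integral_mul_conj_le_weight hb.continuous.measurable hh
      (Complex.continuous_conj.measurable.comp hSm)).trans_eq ?_
    simp_rw [Function.comp, RCLike.enorm_conj]
  have h3 : ∫⁻ ξ, ‖b ξ‖ₑ * ‖h ξ‖ₑ ^ (2 : ℝ) = ∫⁻ ξ, ‖h ξ‖ₑ ^ (2 : ℝ) := by
    refine lintegral_congr fun ξ => ?_
    by_cases h0 : h ξ = 0
    · simp [h0]
    · have : b ξ = 1 := mul_right_cancel₀ h0 ((hbh ξ).trans (one_mul _).symm)
      simp [this]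
  have h4 : ∫⁻ ξ, ‖b ξ‖ₑ * ‖S ξ‖ₑ ^ (2 : ℝ) ≤
      X ^ (2 * (1 - 1 / p)) * (∫⁻ r, k r ^ (p / 2)) ^ (2 / p) := by
    refine (lintegral_weight_superpose_sq_le hb hT hy ham hai).trans ?_
    calc _ ≤ ∫⁻ r, ∫⁻ s, ‖a r‖ₑ * ‖a s‖ₑ * k (r - s) :=
          lintegral_mono fun r => lintegral_mono fun s => mul_le_mul_right (hker r s) _
      _ ≤ _ := lintegral_young_form hp ham.enorm hk
      _ = _ := by
          congr 2
          rw [hX, ← lintegral_indicator hA]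
          refine lintegral_congr fun r => ?_
          rw [hae]
          by_cases hr : r ∈ A
          · simp only [Set.indicator_of_mem hr]
            rw [← ENNReal.rpow_mul]; congr 1; field_simp
          · simp only [Set.indicator_of_notMem hr]
            exact ENNReal.zero_rpow_of_pos (by positivity)
  rw [h3] at h2
  rcases eq_or_ne X 0 with hX0 | hX0
  · rw [hX0]; exact zero_le
  have h5 : X ≤ X ^ (1 - 1 / p) * ((∫⁻ ξ, ‖h ξ‖ₑ ^ (2 : ℝ)) ^ (1 / 2 : ℝ) *
      (∫⁻ r, k r ^ (p / 2)) ^ (1 / p)) := by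
    refine (h2.trans (mul_le_mul_right (ENNReal.rpow_le_rpow h4 (by norm_num)) _)).trans_eq ?_
    rw [ENNReal.mul_rpow_of_nonneg _ _ (by norm_num), ← ENNReal.rpow_mul, ← ENNReal.rpow_mul,
      show 2 * (1 - 1 / p) * (1 / 2) = 1 - 1 / p by ring, show 2 / p * (1 / 2) = 1 / p by ring]
    ring
  have h6 : X ^ (1 / p) ≤ (∫⁻ ξ, ‖h ξ‖ₑ ^ (2 : ℝ)) ^ (1 / 2 : ℝ) *
      (∫⁻ r, k r ^ (p / 2)) ^ (1 / p) := by
    have hY : X ^ (1 - 1 / p) ≠ 0 := by simp [ENNReal.rpow_eq_zero_iff, hX0, hXt]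
    have hY' : X ^ (1 - 1 / p) ≠ ∞ := by simp [ENNReal.rpow_eq_top_iff, hX0, hXt]
    rw [← ENNReal.mul_le_mul_iff_right hY hY', ← ENNReal.rpow_add _ _ hX0 hXt]
    simpa using h5
  calc X = (X ^ (1 / p)) ^ p := by rw [← ENNReal.rpow_mul]; simp [hp0.ne']
    _ ≤ _ := ENNReal.rpow_le_rpow h6 hp0.le
    _ = _ := by
      rw [ENNReal.mul_rpow_of_nonneg _ _ hp0.le, ← ENNReal.rpow_mul, ← ENNReal.rpow_mul]
      congr 2
      · ring
      · rw [one_div_mul_cancel hp0.ne', ENNReal.rpow_one]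

/-- The `TT*` argument for a linearized maximal function. -/
theorem lintegral_enorm_ker_rpow_le {ε : Fin n → ℝ} {b : Eucl n → ℂ} (hb : IsWeight b) {p : ℝ}
    (hp : 2 ≤ p) {T : ℝ → ℝ} {y : ℝ → Eucl n} (hT : Measurable T) (hy : Measurable y)
    {k : ℝ → ℝ≥0∞} (hk : Measurable k)
    (hker : ∀ r s, ‖ker ε b (T r - T s) (y r - y s)‖ₑ ≤ k (r - s)) {h : Eucl n → ℂ}
    (hh : Measurable h) (hhi : Integrable h) (hbh : ∀ ξ, b ξ * h ξ = h ξ) :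
    ∫⁻ r, ‖ker ε h (T r) (y r)‖ₑ ^ p ≤
      (∫⁻ ξ, ‖h ξ‖ₑ ^ (2 : ℝ)) ^ (p / 2) * ∫⁻ r, k r ^ (p / 2) := by
  have hmono : Monotone fun N : ℕ => Set.Icc (-(N : ℝ)) N := by
    intro i j hij
    have : (i : ℝ) ≤ j := by exact_mod_cast hij
    exact Set.Icc_subset_Icc (by linarith) this
  have hun : ⋃ N : ℕ, Set.Icc (-(N : ℝ)) N = Set.univ := by
    refine Set.eq_univ_of_forall fun r => ?_
    obtain ⟨N, hN⟩ := exists_nat_ge |r|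
    exact Set.mem_iUnion.2 ⟨N, abs_le.1 hN⟩
  rw [← setLIntegral_univ, ← hun, setLIntegral_iUnion_of_directed _ hmono.directed_le]
  exact iSup_le fun N => setLIntegral_enorm_ker_rpow_le hb hp hT hy hk hker hh hhi hbh measurableSet_Icc (by simp)

/-- A nonnegative smooth bump function equal to one on the ball of radius two. -/
theorem exists_schwartz_bump (n : ℕ) : ∃ b : SchwartzMap (Eucl n) ℂ,
    (∀ ξ, b ξ = ((‖b ξ‖ : ℝ) : ℂ)) ∧ ∀ ξ, ‖ξ‖ ≤ 2 → b ξ = 1 := by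
  let f : ContDiffBump (0 : Eucl n) := ⟨2, 4, by norm_num, by norm_num⟩
  have h1 : HasCompactSupport fun ξ => ((f ξ : ℝ) : ℂ) :=
    f.hasCompactSupport.comp_left (g := fun x : ℝ => (x : ℂ)) Complex.ofReal_zero
  have h2 : ContDiff ℝ ((⊤ : ℕ∞) : WithTop ℕ∞) fun ξ => ((f ξ : ℝ) : ℂ) :=
    Complex.ofRealCLM.contDiff.comp f.contDiff
  refine ⟨h1.toSchwartzMap h2, fun ξ => ?_, fun ξ hξ => ?_⟩
  · change ((f ξ : ℝ) : ℂ) = ((‖((f ξ : ℝ) : ℂ)‖ : ℝ) : ℂ)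
    rw [Complex.norm_real, Real.norm_of_nonneg f.nonneg]
  · change ((f ξ : ℝ) : ℂ) = 1
    rw [f.one_of_mem_closedBall (by simpa [f] using hξ), Complex.ofReal_one]

theorem isWeight_schwartz {b : SchwartzMap (Eucl n) ℂ} (hb : ∀ ξ, b ξ = ((‖b ξ‖ : ℝ) : ℂ)) :
    IsWeight (b : Eucl n → ℂ) :=
  ⟨b.continuous, b.integrable, by rw [← SchwartzMap.fourier_coe]; exact (𝓕 b).integrable, hb⟩

theorem fourier_eq_ker (ε : Fin n → ℝ) (b : Eucl n → ℂ) (x : Eucl n) : 𝓕 b x = ker ε b 0 (-x) := by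
  rw [ker_zero_eq, Real.fourierInv_eq_fourier_neg, neg_neg]

theorem wave_smul_smul (ε : Fin n → ℝ) {l : ℝ} (hl : 0 < l) (t : ℝ) (x ξ : Eucl n) :
    wave ε (l ^ 2 * t) (l • x) (l⁻¹ • ξ) = wave ε t x ξ := by
  have hq : quadSym ε (l⁻¹ • ξ) = (l⁻¹) ^ 2 * quadSym ε ξ := by
    unfold quadSym
    rw [Finset.mul_sum]
    refine Finset.sum_congr rfl fun i _ => ?_
    simp only [PiLp.smul_apply, smul_eq_mul]; ring
  unfold wave
  rw [hq, real_inner_smul_left, real_inner_smul_right]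
  congr 3
  field_simp

theorem ker_comp_smul (ε : Fin n → ℝ) (b : Eucl n → ℂ) {l : ℝ} (hl : 0 < l) (t : ℝ) (x : Eucl n) :
    ker ε (fun ξ => b (l⁻¹ • ξ)) t x = ((l ^ n : ℝ) : ℂ) * ker ε b (l ^ 2 * t) (l • x) := by
  have := Measure.integral_comp_inv_smul_of_nonneg volume
    (fun η => b η * wave ε (l ^ 2 * t) (l • x) η) hl.le
  simp only [wave_smul_smul ε hl, finrank_euclideanSpace, Fintype.card_fin] at this
  unfold ker
  rw [this, Complex.real_smul]

theorem fourier_comp_smul_eq (b : Eucl n → ℂ) {l : ℝ} (hl : 0 < l) (x : Eucl n) :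
    𝓕 (fun ξ => b (l⁻¹ • ξ)) x = ((l ^ n : ℝ) : ℂ) * 𝓕 b (l • x) := by
  rw [fourier_eq_ker 1, fourier_eq_ker 1, ker_comp_smul 1 b hl, mul_zero, smul_neg]

theorem IsWeight.comp_smul {b : Eucl n → ℂ} (hb : IsWeight b) {l : ℝ} (hl : 0 < l) :
    IsWeight fun ξ => b (l⁻¹ • ξ) where
  continuous := hb.continuous.comp (continuous_const_smul _)
  integrable := hb.integrable.comp_smul (inv_ne_zero hl.ne')
  integrable_fourier := by
    rw [funext (fourier_comp_smul_eq b hl)]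
    exact (hb.integrable_fourier.comp_smul hl.ne').const_mul _
  eq_norm := fun _ => hb.eq_norm _

theorem integral_norm_fourier_comp_smul (b : Eucl n → ℂ) {l : ℝ} (hl : 0 < l) :
    ∫ x, ‖𝓕 (fun ξ => b (l⁻¹ • ξ)) x‖ = ∫ x, ‖𝓕 b x‖ := by
  simp_rw [fourier_comp_smul_eq b hl, norm_mul]
  rw [integral_const_mul, Measure.integral_comp_smul_of_nonneg volume (fun x => ‖𝓕 b x‖) l (hR := hl.le),
    Complex.norm_real, Real.norm_of_nonneg (by positivity), finrank_euclideanSpace,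
    Fintype.card_fin, smul_eq_mul, ← mul_assoc, mul_inv_cancel₀ (by positivity), one_mul]

theorem lintegral_scaled_decay {a p C l : ℝ} (hp : 0 < p) (ha : 1 < a * (p / 2)) (hC : 0 < C)
    (hl : 0 < l) (d : ℝ) :
    ∫⁻ r : ℝ, ENNReal.ofReal (l ^ d * (C * (1 + |l * r|) ^ (-a))) ^ (p / 2) =
      ENNReal.ofReal (C ^ (p / 2) * (∫ r : ℝ, (1 + ‖r‖) ^ (-(a * (p / 2)))) *
        l ^ (d * (p / 2) - 1)) := by
  have hint : Integrable fun r : ℝ => (1 + ‖r‖) ^ (-(a * (p / 2))) :=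
    integrable_one_add_norm (by simpa using ha)
  have hint' : Integrable fun r : ℝ => (1 + ‖l * r‖) ^ (-(a * (p / 2))) :=
    hint.comp_mul_left' hl.ne'
  have e : ∀ r : ℝ, ENNReal.ofReal (l ^ d * (C * (1 + |l * r|) ^ (-a))) ^ (p / 2) =
      ENNReal.ofReal (l ^ (d * (p / 2)) * C ^ (p / 2) * (1 + ‖l * r‖) ^ (-(a * (p / 2)))) := by
    intro r
    have h1 : 0 < 1 + |l * r| := by positivity
    rw [ENNReal.ofReal_rpow_of_nonneg (by positivity) (by positivity),
      Real.mul_rpow (by positivity) (by positivity), Real.mul_rpow hC.le (by positivity),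
      ← Real.rpow_mul hl.le, ← Real.rpow_mul h1.le, Real.norm_eq_abs, neg_mul, mul_assoc]
  simp_rw [e]
  rw [← ofReal_integral_eq_lintegral_ofReal (hint'.const_mul _)
    (Eventually.of_forall fun r => by positivity), integral_const_mul,
    Measure.integral_comp_mul_left (fun r : ℝ => (1 + ‖r‖) ^ (-(a * (p / 2)))), smul_eq_mul,
    abs_of_pos (inv_pos.2 hl), Real.rpow_sub_one hl.ne']
  congr 1
  field_simp

/-- The maximal function estimate for frequency localized free solutions. -/
theorem exists_maximal_estimate (hn : 2 ≤ n) {ε : Fin n → ℝ} (hε : ∀ i, ε i = 1 ∨ ε i = -1)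
    {p : ℝ} (hp : 2 ≤ p) (hnp : 6 ≤ (n : ℝ) * p) :
    ∃ C : ℝ, 0 < C ∧ ∀ l : ℝ, 0 < l → ∀ h : Eucl n → ℂ, Measurable h → Integrable h →
      (∀ ξ, h ξ ≠ 0 → ‖ξ‖ ≤ 2 * l) → ∀ e : Eucl n, ‖e‖ = 1 → ∀ c : ℕ → ℝ × hyperplane e,
      ∫⁻ r : ℝ, (⨆ i, ‖ker ε h (c i).1 (r • e + ((c i).2 : Eucl n))‖ₑ) ^ p ≤
        ENNReal.ofReal (C * l ^ ((n : ℝ) * (p / 2) - 1)) *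
          (∫⁻ ξ, ‖h ξ‖ₑ ^ (2 : ℝ)) ^ (p / 2) := by
  obtain ⟨b, hb, hb1⟩ := exists_schwartz_bump n
  obtain ⟨C, hC, hker⟩ := exists_norm_ker_le_rpow (by omega : 0 < n) hε n b
  set a : ℝ := 1 / (1 / ((n : ℝ) + 1) + 2 / (n : ℝ)) with ha
  have hn0 : (2 : ℝ) ≤ n := by exact_mod_cast hn
  have hap : 1 < a * (p / 2) := by
    have h1 : 1 / ((n : ℝ) + 1) + 2 / (n : ℝ) < p / 2 := by
      have h2 : 1 / ((n : ℝ) + 1) < 1 / n := one_div_lt_one_div_of_lt (by linarith) (by linarith)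
      have h3 : 3 / (n : ℝ) ≤ p / 2 := by
        rw [div_le_div_iff₀ (by linarith) (by norm_num)]; linarith
      have h4 : 3 / (n : ℝ) = 1 / n + 2 / n := by ring
      linarith
    have h5 : 0 < 1 / ((n : ℝ) + 1) + 2 / (n : ℝ) := by positivity
    rw [ha, one_div_mul_eq_div, one_lt_div h5]
    exact h1
  clear_value a
  have hp0 : 0 < p := by linarith
  refine ⟨C ^ (p / 2) * (∫ r : ℝ, (1 + ‖r‖) ^ (-(a * (p / 2)))) + 1, ?_, ?_⟩
  · have : 0 ≤ ∫ r : ℝ, (1 + ‖r‖) ^ (-(a * (p / 2))) := integral_nonneg fun _ => by positivity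
    positivity
  intro l hl h hh hhi hsupp e he c
  have hw : IsWeight fun ξ => b (l⁻¹ • ξ) := (isWeight_schwartz hb).comp_smul hl
  have hfm : ∀ i, Measurable fun r : ℝ => ‖ker ε h (c i).1 (r • e + ((c i).2 : Eucl n))‖ₑ :=
    fun i => (measurable_ker_comp hhi measurable_const
      ((measurable_id.smul_const e).add_const _)).enorm
  have key : ∀ N : ℕ, ∫⁻ r : ℝ, ((Finset.range (N + 1)).sup fun i =>
      ‖ker ε h (c i).1 (r • e + ((c i).2 : Eucl n))‖ₑ) ^ p ≤
      ENNReal.ofReal ((C ^ (p / 2) * (∫ r : ℝ, (1 + ‖r‖) ^ (-(a * (p / 2)))) + 1) *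
        l ^ ((n : ℝ) * (p / 2) - 1)) * (∫⁻ ξ, ‖h ξ‖ₑ ^ (2 : ℝ)) ^ (p / 2) := by
    intro N
    obtain ⟨σ, hσ, hsup⟩ := exists_measurable_selector hfm N
    simp_rw [hsup]
    have hT : Measurable fun r => (c (σ r)).1 :=
      (measurable_from_nat (f := fun i => (c i).1)).comp hσ
    have hv : Measurable fun r => ((c (σ r)).2 : Eucl n) :=
      (measurable_from_nat (f := fun i => ((c i).2 : Eucl n))).comp hσ
    have hy : Measurable fun r : ℝ => r • e + ((c (σ r)).2 : Eucl n) :=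
      (measurable_id.smul_const e).add hv
    have hkm : Measurable fun r : ℝ =>
        ENNReal.ofReal (l ^ (n : ℝ) * (C * (1 + |l * r|) ^ (-a))) := by fun_prop
    refine (lintegral_enorm_ker_rpow_le hw hp hT hy hkm ?_ hh hhi ?_).trans ?_
    · intro r s
      rw [← ofReal_norm]
      refine ENNReal.ofReal_le_ofReal ?_
      rw [ker_comp_smul ε b hl, norm_mul, Complex.norm_real, Real.norm_of_nonneg (by positivity),
        Real.rpow_natCast]
      refine mul_le_mul_of_nonneg_left ((hker _ _).trans ?_) (by positivity)
      have horth : ∀ v : hyperplane e, ⟪e, (v : Eucl n)⟫ = 0 := fun v =>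
        Submodule.mem_orthogonal_singleton_iff_inner_right.1 v.2
      have hin : ⟪e, r • e + ((c (σ r)).2 : Eucl n) - (s • e + ((c (σ s)).2 : Eucl n))⟫ = r - s := by
        rw [inner_sub_right, inner_add_right, inner_add_right, horth, horth, inner_smul_right,
          inner_smul_right, real_inner_self_eq_norm_sq, he]; ring
      have hle : |r - s| ≤ ‖r • e + ((c (σ r)).2 : Eucl n) - (s • e + ((c (σ s)).2 : Eucl n))‖ := by
        rw [← hin]
        refine (abs_real_inner_le_norm _ _).trans ?_
        rw [he, one_mul]
      have ha0 : 0 < a := by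
        by_contra h0
        have := mul_nonpos_of_nonpos_of_nonneg (not_lt.1 h0) (by positivity : 0 ≤ p / 2)
        linarith
      refine mul_le_mul_of_nonneg_left ?_ hC.le
      refine Real.rpow_le_rpow_of_nonpos (by positivity) ?_ (by linarith)
      rw [norm_smul, abs_mul, Real.norm_eq_abs]
      gcongr
    · intro ξ
      by_cases h0 : h ξ = 0
      · simp [h0]
      · rw [hb1, one_mul]
        rw [norm_smul, norm_inv, Real.norm_of_nonneg hl.le, inv_mul_le_iff₀ hl, mul_comm]
        exact hsupp ξ h0
    · rw [mul_comm, lintegral_scaled_decay hp0 hap hC hl]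
      refine mul_le_mul_left (ENNReal.ofReal_le_ofReal ?_) _
      refine mul_le_mul_of_nonneg_right (by linarith) (by positivity)
  have hmon : Monotone fun (N : ℕ) (r : ℝ) => ((Finset.range (N + 1)).sup fun i =>
      ‖ker ε h (c i).1 (r • e + ((c i).2 : Eucl n))‖ₑ) ^ p := by
    intro N M hNM r
    exact ENNReal.rpow_le_rpow (Finset.sup_mono (Finset.range_mono (by omega))) hp0.le
  calc _ ≤ ∫⁻ r : ℝ, ⨆ N : ℕ, ((Finset.range (N + 1)).sup fun i =>
      ‖ker ε h (c i).1 (r • e + ((c i).2 : Eucl n))‖ₑ) ^ p := by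
        refine lintegral_mono fun r => ?_
        have : (⨆ i, ‖ker ε h (c i).1 (r • e + ((c i).2 : Eucl n))‖ₑ) ≤
            (⨆ N : ℕ, ((Finset.range (N + 1)).sup fun i =>
              ‖ker ε h (c i).1 (r • e + ((c i).2 : Eucl n))‖ₑ) ^ p) ^ p⁻¹ := by
          refine iSup_le fun i => ?_
          rw [ENNReal.le_rpow_inv_iff hp0]
          refine le_iSup_of_le i (ENNReal.rpow_le_rpow ?_ hp0.le)
          exact Finset.le_sup (f := fun i => ‖ker ε h (c i).1 (r • e + ((c i).2 : Eucl n))‖ₑ)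
            (Finset.self_mem_range_succ i)
        exact (ENNReal.le_rpow_inv_iff hp0).1 this
    _ = ⨆ N : ℕ, ∫⁻ r : ℝ, ((Finset.range (N + 1)).sup fun i =>
      ‖ker ε h (c i).1 (r • e + ((c i).2 : Eucl n))‖ₑ) ^ p :=
        lintegral_iSup (fun N => (measurable_finset_sup _ hfm).pow_const _) hmon
    _ ≤ _ := iSup_le key

theorem wave_zero_zero (ε : Fin n → ℝ) (ξ : Eucl n) : wave ε 0 0 ξ = 1 := by simp [wave]

theorem wave_mul_wave (ε : Fin n → ℝ) (t s : ℝ) (x y ξ : Eucl n) :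
    wave ε t x ξ * wave ε s y ξ = wave ε (t + s) (x + y) ξ := by
  unfold wave
  rw [← Complex.exp_add, inner_add_left]
  congr 1
  push_cast; ring

theorem superpose_neg_eq (ε : Fin n → ℝ) (t : ℝ) (f : Eucl n → ℂ) (ξ : Eucl n) :
    superpose ε (fun _ => t) (fun y => -y) f volume ξ = wave ε t 0 ξ * 𝓕 f ξ := by
  unfold superpose
  rw [Real.fourier_eq', ← integral_const_mul]
  congr 1; ext y
  rw [smul_eq_mul, mul_comm]
  have : wave ε t (-y) ξ = wave ε t 0 ξ * cexp (↑(-2 * Real.pi * ⟪y, ξ⟫) * I) := by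
    unfold wave
    rw [← Complex.exp_add, inner_neg_left, inner_zero_left]
    congr 1; push_cast; ring
  rw [this, mul_assoc]

theorem ofReal_abs_rpow_eq_rieszKer {q : ℝ} {s t : ℝ} (h : t ≠ s) :
    ENNReal.ofReal (|t - s| ^ (-(2 / q))) = rieszKer q (t - s) + rieszKer q (s - t) := by
  unfold rieszKer
  rcases lt_or_gt_of_ne h with h | h
  · rw [Set.indicator_of_notMem (by simpa using h.le), Set.indicator_of_mem (by simpa using h),
      zero_add, abs_of_neg (sub_neg.2 h), neg_sub]
  · rw [Set.indicator_of_mem (by simpa using h), Set.indicator_of_notMem (by simpa using h.le),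
      add_zero, abs_of_pos (sub_pos.2 h)]

theorem lintegral_abs_rpow_form_le {q : ℝ} (hq : 2 < q) : ∃ C : ℝ≥0∞, C ≠ ∞ ∧
    ∀ a : ℝ → ℝ≥0∞, Measurable a →
      ∫⁻ s, ∫⁻ t, a s * (a t * (rieszKer q (t - s) + rieszKer q (s - t))) ≤
        C * (∫⁻ s, a s ^ (q / (q - 1))) ^ (2 * ((q - 1) / q)) := by
  obtain ⟨C, hC, h⟩ := lintegral_rieszKer_form_le hq
  refine ⟨2 * C, ENNReal.mul_ne_top (by norm_num) hC, fun a ha => ?_⟩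
  have m1 : Measurable fun z : ℝ × ℝ => a z.1 * (a z.2 * rieszKer q (z.2 - z.1)) :=
    (ha.comp measurable_fst).mul ((ha.comp measurable_snd).mul
      ((measurable_rieszKer q).comp (measurable_snd.sub measurable_fst)))
  have m2 : Measurable fun z : ℝ × ℝ => a z.1 * (a z.2 * rieszKer q (z.1 - z.2)) :=
    (ha.comp measurable_fst).mul ((ha.comp measurable_snd).mul
      ((measurable_rieszKer q).comp (measurable_fst.sub measurable_snd)))
  have e : ∀ s, ∫⁻ t, a s * (a t * (rieszKer q (t - s) + rieszKer q (s - t))) =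
      (∫⁻ t, a s * (a t * rieszKer q (t - s))) + ∫⁻ t, a s * (a t * rieszKer q (s - t)) := by
    intro s
    have : Measurable fun t => a s * (a t * rieszKer q (t - s)) :=
      measurable_comp_prodMk m1 measurable_const measurable_id
    rw [← lintegral_add_left this]
    refine lintegral_congr fun t => ?_
    rw [mul_add, mul_add]
  simp_rw [e]
  have m3 : Measurable fun s => ∫⁻ t, a s * (a t * rieszKer q (t - s)) := m1.lintegral_prod_right'
  rw [lintegral_add_left m3, lintegral_lintegral_swap m1.aemeasurable, two_mul, add_mul]
  refine add_le_add ?_ (h a ha)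
  refine le_trans (le_of_eq ?_) (h a ha)
  refine lintegral_congr fun t => lintegral_congr fun s => ?_
  ring

/-- The dual Strichartz estimate for frequency localized functions. -/
theorem exists_dual_strichartz {ε : Fin n → ℝ} (hε : ∀ i, ε i = 1 ∨ ε i = -1) {q r : ℝ}
    (hq : 2 < q) (hr : 2 < r) (hqr : 2 / q = (n : ℝ) * (1 / 2 - 1 / r)) :
    ∃ C : ℝ, 0 < C ∧ ∀ l : ℝ, 0 < l → ∀ G g : ℝ → Eucl n → ℂ,
      Measurable (fun z : ℝ × Eucl n => G z.1 z.2) → (∀ s ξ, G s ξ ≠ 0 → ‖ξ‖ ≤ 2 * l) →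
      ∀ A : ℝ → ℝ, Integrable A → (∀ s ξ, ‖G s ξ‖ ≤ A s) →
      Measurable (fun z : ℝ × Eucl n => g z.1 z.2) → (∀ s, Integrable (g s)) →
      (∀ s, ∫⁻ y, ‖g s y‖ₑ ^ (r / (r - 1)) ≠ ∞) → (∀ s, 𝓕 (g s) = G s) →
      ∀ E : Set ℝ, MeasurableSet E →
      ∫⁻ ξ, ‖∫ s in E, wave ε (-s) 0 ξ * G s ξ‖ₑ ^ (2 : ℝ) ≤ ENNReal.ofReal C *
        (∫⁻ s in E, ((∫⁻ y, ‖g s y‖ₑ ^ (r / (r - 1))) ^ ((r - 1) / r)) ^ (q / (q - 1))) ^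
          (2 * ((q - 1) / q)) := by
  obtain ⟨b, hb, hb1⟩ := exists_schwartz_bump n
  obtain ⟨C₁, hC₁, hform⟩ := lintegral_abs_rpow_form_le hq
  obtain ⟨C, hC, hpair⟩ := exists_enorm_pairing_le hε hr
    (D := (∫ ξ, ‖𝓕 (b : Eucl n → ℂ) ξ‖) + 1)
    (by have : 0 ≤ ∫ ξ, ‖𝓕 (b : Eucl n → ℂ) ξ‖ := integral_nonneg fun _ => norm_nonneg _
        linarith)
  refine ⟨C * C₁.toReal + 1, by positivity, ?_⟩
  intro l hl G g hG hsupp A hA hGA hg hgi hgf hFg E hE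
  have hw : IsWeight fun ξ => b (l⁻¹ • ξ) := (isWeight_schwartz hb).comp_smul hl
  set B : Eucl n → ℂ := fun ξ => b (l⁻¹ • ξ) with hB
  have hwD : ∫ ξ, ‖𝓕 B ξ‖ ≤ (∫ ξ, ‖𝓕 (b : Eucl n → ℂ) ξ‖) + 1 := by
    rw [hB, integral_norm_fourier_comp_smul _ hl]; linarith
  have hB1 : ∀ s ξ, B ξ * G s ξ = G s ξ := by
    intro s ξ
    by_cases h0 : G s ξ = 0
    · simp [h0]
    · rw [hB]
      dsimp only
      rw [hb1, one_mul]
      rw [norm_smul, norm_inv, Real.norm_of_nonneg hl.le, inv_mul_le_iff₀ hl, mul_comm]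
      exact hsupp s ξ h0
  clear_value B
  set a : ℝ → ℝ≥0∞ := fun s => (∫⁻ y, ‖g s y‖ₑ ^ (r / (r - 1))) ^ ((r - 1) / r) with ha
  have ham : Measurable a := by
    have : Measurable fun s => ∫⁻ y, ‖g s y‖ₑ ^ (r / (r - 1)) :=
      (hg.enorm.pow_const _).lintegral_prod_right'
    exact this.pow_const _
  have hgm : ∀ s, Measurable (g s) := fun s =>
    measurable_comp_prodMk hg measurable_const measurable_id
  have hHm : Measurable fun z : ℝ × Eucl n => wave ε (-z.1) 0 z.2 * G z.1 z.2 := by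
    refine Measurable.mul (Continuous.measurable ?_) hG
    exact continuous_wave ε continuous_fst.neg continuous_const continuous_snd
  have hHA : ∀ s ξ, ‖wave ε (-s) 0 ξ * G s ξ‖ ≤ A s := by
    intro s ξ
    rw [norm_mul, norm_wave, one_mul]
    exact hGA s ξ
  have hpt : ∀ s t, t ≠ s → ‖∫ ξ, B ξ * ((wave ε (-s) 0 ξ * G s ξ) *
      starRingEnd ℂ (wave ε (-t) 0 ξ * G t ξ))‖ₑ ≤
      ENNReal.ofReal C * (a s * (a t * (rieszKer q (t - s) + rieszKer q (s - t)))) := by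
    intro s t hts
    have e : ∀ ξ, B ξ * ((wave ε (-s) 0 ξ * G s ξ) * starRingEnd ℂ (wave ε (-t) 0 ξ * G t ξ)) =
        B ξ * (superpose ε (fun _ => t - s) (fun y => -y) (g s) volume ξ *
          starRingEnd ℂ (superpose ε (fun _ => 0) (fun y => -y) (g t) volume ξ)) := by
      intro ξ
      rw [superpose_neg_eq, superpose_neg_eq, hFg, hFg, wave_zero_zero, one_mul]
      have h1 : wave ε (t - s) 0 ξ = wave ε (-s) 0 ξ * starRingEnd ℂ (wave ε (-t) 0 ξ) := by
        rw [wave_mul_conj, sub_zero]; congr 1; ring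
      rw [h1, map_mul]; ring
    simp_rw [e]
    refine (hpair B hw hwD (t - s) (sub_ne_zero.2 hts) (g s) (g t) (hgm s) (hgi s) (hgm t) (hgi t)
      (hgf s)).trans_eq ?_
    rw [← hqr, ENNReal.ofReal_mul hC.le, ofReal_abs_rpow_eq_rieszKer hts]
    simp only [ha]; ring
  have hsq : ∫⁻ ξ, ‖∫ s in E, wave ε (-s) 0 ξ * G s ξ‖ₑ ^ (2 : ℝ) =
      ‖∫ ξ, B ξ * ((∫ s in E, wave ε (-s) 0 ξ * G s ξ) *
        starRingEnd ℂ (∫ s in E, wave ε (-s) 0 ξ * G s ξ))‖ₑ := by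
    set H : Eucl n → ℂ := fun ξ => ∫ s in E, wave ε (-s) 0 ξ * G s ξ with hH
    have hHme : Measurable H := (hHm.stronglyMeasurable.integral_prod_left'
      (μ := volume.restrict E)).measurable
    have hBH : ∀ ξ, B ξ * H ξ = H ξ := by
      intro ξ
      simp only [hH]
      rw [← integral_const_mul]
      congr 1; ext s
      rw [mul_left_comm, hB1]
    have hHb : ∀ ξ, ‖H ξ‖ ≤ ∫ s in E, A s := fun ξ =>
      (norm_integral_le_integral_norm _).trans (integral_mono_of_nonneg
        (Eventually.of_forall fun _ => norm_nonneg _) hA.integrableOn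
        (Eventually.of_forall fun s => hHA s ξ))
    have e : ∀ ξ, B ξ * (H ξ * starRingEnd ℂ (H ξ)) = ((‖H ξ‖ ^ 2 : ℝ) : ℂ) := by
      intro ξ
      rw [← mul_assoc, hBH, Complex.mul_conj, Complex.normSq_eq_norm_sq]
    change _ = ‖∫ ξ, B ξ * (H ξ * starRingEnd ℂ (H ξ))‖ₑ
    have hint : Integrable fun ξ => ‖H ξ‖ ^ 2 := by
      refine (hw.integrable.norm.mul_const ((∫ s in E, A s) ^ 2)).mono'
        (hHme.norm.pow_const 2).aestronglyMeasurable (Eventually.of_forall fun ξ => ?_)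
      rw [Real.norm_of_nonneg (by positivity)]
      by_cases h0 : H ξ = 0
      · rw [h0, norm_zero, zero_pow two_ne_zero]
        positivity
      · have : B ξ = 1 := mul_right_cancel₀ h0 ((hBH ξ).trans (one_mul _).symm)
        rw [this, norm_one, one_mul]
        exact pow_le_pow_left₀ (norm_nonneg _) (hHb ξ) 2
    simp_rw [e]
    rw [integral_complex_ofReal, ← ofReal_norm, Complex.norm_real, Real.norm_of_nonneg
      (integral_nonneg fun _ => by positivity), ofReal_integral_eq_lintegral_ofReal hint
      (Eventually.of_forall fun _ => by positivity)]
    refine lintegral_congr fun ξ => ?_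
    rw [ENNReal.ofReal_pow (norm_nonneg _), ofReal_norm, ENNReal.rpow_ofNat]
  rw [hsq]
  refine (enorm_integral_superposition_le (η := volume) (μ := volume.restrict E)
    (ν := volume.restrict E) hw.integrable hHm hHm hA.integrableOn hA.integrableOn hHA hHA).trans ?_
  have hα : Measurable (E.indicator a) := ham.indicator hE
  have hle : ∫⁻ s in E, (∫⁻ t in E, ‖∫ ξ, B ξ * ((wave ε (-s) 0 ξ * G s ξ) *
      starRingEnd ℂ (wave ε (-t) 0 ξ * G t ξ))‖ₑ) ≤
      ENNReal.ofReal C * ∫⁻ s, (∫⁻ t, E.indicator a s * (E.indicator a t *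
        (rieszKer q (t - s) + rieszKer q (s - t)))) := by
    rw [← lintegral_const_mul' _ _ ENNReal.ofReal_ne_top, ← lintegral_indicator hE]
    refine lintegral_mono fun s => ?_
    by_cases hs : s ∈ E
    · simp only [Set.indicator_of_mem hs]
      rw [← lintegral_const_mul' _ _ ENNReal.ofReal_ne_top, ← lintegral_indicator hE]
      refine lintegral_mono_ae ?_
      filter_upwards [(Set.countable_singleton s).ae_notMem volume] with t ht
      by_cases htE : t ∈ E
      · simp only [Set.indicator_of_mem htE]
        exact hpt s t (by simpa using ht)
      · simp only [Set.indicator_of_notMem htE]; exact zero_le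
    · simp only [Set.indicator_of_notMem hs]; exact zero_le
  refine hle.trans ((mul_le_mul_right (hform _ hα) _).trans ?_)
  rw [← mul_assoc]
  have hα2 : ∫⁻ s, E.indicator a s ^ (q / (q - 1)) = ∫⁻ s in E, a s ^ (q / (q - 1)) := by
    rw [← lintegral_indicator hE]
    refine lintegral_congr fun s => ?_
    by_cases hs : s ∈ E
    · simp [hs]
    · simp only [Set.indicator_of_notMem hs]
      have : 0 < q - 1 := by linarith
      exact ENNReal.zero_rpow_of_pos (by positivity)
  rw [hα2]
  refine mul_le_mul_left ?_ _
  rw [← ENNReal.ofReal_toReal hC₁, ← ENNReal.ofReal_mul hC.le,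
    ENNReal.toReal_ofReal ENNReal.toReal_nonneg]
  exact ENNReal.ofReal_le_ofReal (by linarith)

/-- The restriction of a space-time Schwartz function to a time slice. -/
def timeSlice (s : ℝ) : SchwartzMap (ℝ × Eucl n) ℂ →L[ℂ] SchwartzMap (Eucl n) ℂ :=
  SchwartzMap.compCLMOfAntilipschitz (K := 1) ℂ (g := fun y : Eucl n => ((s, y) : ℝ × Eucl n))
    (by
      have h : (fun y : Eucl n => ((s, y) : ℝ × Eucl n))
          = fun y => ContinuousLinearMap.inr ℝ ℝ (Eucl n) y + (s, 0) := by
        ext y <;> simp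
      rw [h]
      exact (ContinuousLinearMap.inr ℝ ℝ (Eucl n)).hasTemperateGrowth.add
        (Function.HasTemperateGrowth.const _))
    (AntilipschitzWith.of_le_mul_dist fun x y => by simp [Prod.dist_eq])

theorem timeSlice_apply (s : ℝ) (F : SchwartzMap (ℝ × Eucl n) ℂ) (y : Eucl n) :
    timeSlice s F y = F (s, y) := rfl

open LineDeriv in
theorem lineDerivOp_timeSlice (s : ℝ) (F : SchwartzMap (ℝ × Eucl n) ℂ) (m : Eucl n) :
    ∂_{m} (timeSlice s F) = timeSlice s (∂_{((0 : ℝ), m)} F) := by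
  ext y
  rw [timeSlice_apply, SchwartzMap.lineDerivOp_apply_eq_fderiv,
    SchwartzMap.lineDerivOp_apply_eq_fderiv]
  have h1 : HasFDerivAt (fun y : Eucl n => ((s, y) : ℝ × Eucl n))
      (ContinuousLinearMap.inr ℝ ℝ (Eucl n)) y := hasFDerivAt_prodMk_right s y
  have h2 : HasFDerivAt (timeSlice s F : Eucl n → ℂ)
      ((fderiv ℝ F (s, y)).comp (ContinuousLinearMap.inr ℝ ℝ (Eucl n))) y :=
    HasFDerivAt.comp y (F.differentiableAt (x := (s, y))).hasFDerivAt h1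
  rw [h2.fderiv]
  rfl

theorem exists_norm_timeSlice_le (F : SchwartzMap (ℝ × Eucl n) ℂ) :
    ∃ C : ℝ, 0 ≤ C ∧ ∀ s y, ‖F (s, y)‖ ≤ C * (1 + s ^ 2)⁻¹ * (1 + ‖y‖) ^ (-((n : ℝ) + 1)) := by
  set C := 2 ^ (n + 3) * (Finset.Iic (n + 3, 0)).sup
    (fun m => SchwartzMap.seminorm ℝ m.1 m.2) F with hC
  have h : ∀ z, (1 + ‖z‖) ^ (n + 3) * ‖F z‖ ≤ C := fun z => by
    simpa using SchwartzMap.one_add_le_sup_seminorm_apply (𝕜 := ℝ) (m := (n + 3, 0))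
      (le_refl (n + 3)) (le_refl 0) F z
  clear_value C
  have hC0 : 0 ≤ C := le_trans (by positivity) (h 0)
  refine ⟨C, hC0, fun s y => ?_⟩
  have h1 : |s| ≤ ‖((s, y) : ℝ × Eucl n)‖ := norm_fst_le ((s, y) : ℝ × Eucl n)
  have h2 : ‖y‖ ≤ ‖((s, y) : ℝ × Eucl n)‖ := norm_snd_le ((s, y) : ℝ × Eucl n)
  have h3 : (1 + s ^ 2) * (1 + ‖y‖) ^ (n + 1) ≤ (1 + ‖((s, y) : ℝ × Eucl n)‖) ^ (n + 3) := by
    rw [show n + 3 = 2 + (n + 1) by ring, pow_add (1 + ‖((s, y) : ℝ × Eucl n)‖) 2 (n + 1)]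
    gcongr
    nlinarith [abs_nonneg s, sq_abs s]
  rw [Real.rpow_neg (by positivity), ← Nat.cast_add_one, Real.rpow_natCast, mul_assoc, ← mul_inv,
    ← div_eq_mul_inv, le_div_iff₀ (by positivity), mul_comm]
  exact (mul_le_mul_of_nonneg_right h3 (norm_nonneg _)).trans (h _)

theorem norm_le_sum_abs_coord (x : Eucl n) : ‖x‖ ≤ ∑ i, |x i| := by
  rw [EuclideanSpace.norm_eq]
  refine Real.sqrt_le_iff.2 ⟨Finset.sum_nonneg fun _ _ => abs_nonneg _, ?_⟩
  exact Finset.sum_sq_le_sq_sum_of_nonneg fun i _ => abs_nonneg (x i)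

open LineDeriv in
theorem abs_coord_mul_norm_fourier_le (f : SchwartzMap (Eucl n) ℂ) (i : Fin n) (ξ : Eucl n) :
    |ξ i| * ‖𝓕 f ξ‖ ≤ ‖𝓕 (∂_{EuclideanSpace.single i (1 : ℝ)} f) ξ‖ := by
  have ht : (fun x : Eucl n => inner ℝ x (EuclideanSpace.single i (1 : ℝ))).HasTemperateGrowth :=
    Function.hasTemperateGrowth_inner_left _
  rw [SchwartzMap.fourier_lineDerivOp_eq, _root_.smul_apply,
    SchwartzMap.smulLeftCLM_apply_apply ht, norm_smul, norm_smul]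
  have h1 : (1 : ℝ) ≤ ‖(2 * Real.pi * Complex.I : ℂ)‖ := by
    simp [abs_of_pos Real.pi_pos]; nlinarith [Real.pi_gt_three]
  have h2 : ‖inner ℝ ξ (EuclideanSpace.single i (1 : ℝ))‖ = |ξ i| := by
    simp [EuclideanSpace.inner_single_right]
  rw [h2]
  exact le_mul_of_one_le_left (by positivity) h1

theorem exists_norm_pow_mul_fourier_timeSlice_le (k : ℕ) : ∀ F : SchwartzMap (ℝ × Eucl n) ℂ,
    ∃ C : ℝ, 0 ≤ C ∧ ∀ s ξ, ‖ξ‖ ^ k * ‖𝓕 (timeSlice s F) ξ‖ ≤ C * (1 + s ^ 2)⁻¹ := by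
  induction k with
  | zero =>
    intro F
    obtain ⟨C, hC, h⟩ := exists_norm_timeSlice_le F
    have hi : Integrable fun y : Eucl n => (1 + ‖y‖) ^ (-((n : ℝ) + 1)) :=
      integrable_one_add_norm (by simp)
    refine ⟨C * ∫ y : Eucl n, (1 + ‖y‖) ^ (-((n : ℝ) + 1)),
      mul_nonneg hC (integral_nonneg fun y => by positivity), fun s ξ => ?_⟩
    rw [pow_zero, one_mul, SchwartzMap.fourier_coe]
    refine (VectorFourier.norm_fourierIntegral_le_integral_norm _ _ _ _ _).trans ?_
    calc ∫ y, ‖timeSlice s F y‖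
        ≤ ∫ y : Eucl n, C * (1 + s ^ 2)⁻¹ * (1 + ‖y‖) ^ (-((n : ℝ) + 1)) :=
          integral_mono (timeSlice s F).integrable.norm (hi.const_mul _) fun y => h s y
      _ = _ := by rw [integral_const_mul]; ring
  | succ k ih =>
    intro F
    choose C hC h using fun i : Fin n =>
      ih (LineDeriv.lineDerivOp ((0 : ℝ), EuclideanSpace.single i (1 : ℝ)) F)
    refine ⟨∑ i, C i, Finset.sum_nonneg fun i _ => hC i, fun s ξ => ?_⟩
    calc ‖ξ‖ ^ (k + 1) * ‖𝓕 (timeSlice s F) ξ‖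
        = ‖ξ‖ * (‖ξ‖ ^ k * ‖𝓕 (timeSlice s F) ξ‖) := by ring
      _ ≤ (∑ i, |ξ i|) * (‖ξ‖ ^ k * ‖𝓕 (timeSlice s F) ξ‖) := by
          gcongr; exact norm_le_sum_abs_coord ξ
      _ = ∑ i, ‖ξ‖ ^ k * (|ξ i| * ‖𝓕 (timeSlice s F) ξ‖) := by
          rw [Finset.sum_mul]; exact Finset.sum_congr rfl fun i _ => by ring
      _ ≤ ∑ i, C i * (1 + s ^ 2)⁻¹ := by
          refine Finset.sum_le_sum fun i _ => ?_
          refine le_trans (mul_le_mul_of_nonneg_left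
            (abs_coord_mul_norm_fourier_le (timeSlice s F) i ξ) (by positivity)) ?_
          rw [lineDerivOp_timeSlice]
          exact h i s ξ
      _ = _ := by rw [Finset.sum_mul]

theorem exists_norm_fourier_timeSlice_le (F : SchwartzMap (ℝ × Eucl n) ℂ) :
    ∃ C : ℝ, 0 ≤ C ∧ ∀ s ξ,
      ‖𝓕 (timeSlice s F) ξ‖ ≤ C * (1 + s ^ 2)⁻¹ * (1 + ‖ξ‖) ^ (-((n : ℝ) + 1)) := by
  obtain ⟨C, hC, h⟩ := exists_norm_pow_mul_fourier_timeSlice_le 0 F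
  obtain ⟨D, hD, h'⟩ := exists_norm_pow_mul_fourier_timeSlice_le (n + 1) F
  refine ⟨2 ^ n * (C + D), by positivity, fun s ξ => ?_⟩
  have h3 : (1 + ‖ξ‖) ^ (n + 1) ≤ 2 ^ n * (1 ^ (n + 1) + ‖ξ‖ ^ (n + 1)) :=
    add_pow_le zero_le_one (norm_nonneg _) (n + 1)
  have h1 := h s ξ
  have h2 := h' s ξ
  rw [pow_zero, one_mul] at h1
  rw [Real.rpow_neg (by positivity), ← Nat.cast_add_one, Real.rpow_natCast,
    ← div_eq_mul_inv, le_div_iff₀ (by positivity), mul_comm]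
  calc (1 + ‖ξ‖) ^ (n + 1) * ‖𝓕 (timeSlice s F) ξ‖
      ≤ 2 ^ n * (1 ^ (n + 1) + ‖ξ‖ ^ (n + 1)) * ‖𝓕 (timeSlice s F) ξ‖ := by gcongr
    _ = 2 ^ n * (‖𝓕 (timeSlice s F) ξ‖ + ‖ξ‖ ^ (n + 1) * ‖𝓕 (timeSlice s F) ξ‖) := by
        rw [one_pow]; ring
    _ ≤ 2 ^ n * (C * (1 + s ^ 2)⁻¹ + D * (1 + s ^ 2)⁻¹) := by gcongr
    _ = _ := by ring

theorem continuous_fourier_timeSlice (F : SchwartzMap (ℝ × Eucl n) ℂ) :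
    Continuous fun z : ℝ × Eucl n => 𝓕 (timeSlice z.1 F) z.2 := by
  obtain ⟨C, hC, h⟩ := exists_norm_timeSlice_le F
  have hi : Integrable fun y : Eucl n => (1 + ‖y‖) ^ (-((n : ℝ) + 1)) :=
    integrable_one_add_norm (by simp)
  simp only [SchwartzMap.fourier_coe, Real.fourier_eq]
  refine continuous_of_dominated (bound := fun y => C * (1 + ‖y‖) ^ (-((n : ℝ) + 1)))
    (fun z => ?_) (fun z => ae_of_all _ fun y => ?_) (hi.const_mul _) (ae_of_all _ fun y => ?_)
  · refine Continuous.aestronglyMeasurable ?_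
    refine Continuous.smul ?_ (timeSlice z.1 F).continuous
    fun_prop
  · rw [Circle.norm_smul]
    refine (h z.1 y).trans ?_
    gcongr
    refine mul_le_of_le_one_right hC (inv_le_one_of_one_le₀ (by nlinarith [sq_nonneg z.1]))
  · refine Continuous.smul (by fun_prop) ?_
    exact F.continuous.comp (by fun_prop)

/-- The symbol of the Littlewood–Paley projection as a Schwartz function. -/
theorem exists_schwartz_psi {χ : ℝ → ℝ} (hχ : IsBump χ) (j : ℤ) :
    ∃ b : SchwartzMap (Eucl n) ℂ, (∀ ξ, b ξ = (psiR χ ((2 : ℝ) ^ (-j) * ‖ξ‖) : ℂ)) ∧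
      ∀ ξ, b ξ ≠ 0 → ‖ξ‖ ≤ 2 * (2 : ℝ) ^ j := by
  have h2 : (0 : ℝ) < 2 ^ (-j) := by positivity
  have hsupp : ∀ ξ : Eucl n, psiR χ ((2 : ℝ) ^ (-j) * ‖ξ‖) ≠ 0 → ‖ξ‖ ≤ 2 * (2 : ℝ) ^ j := by
    intro ξ h
    by_contra! hlt
    have h3 : 2 < (2 : ℝ) ^ (-j) * ‖ξ‖ := by
      rw [zpow_neg, ← div_eq_inv_mul, lt_div_iff₀ (by positivity)]; exact hlt
    refine h ?_
    have h4 : |(2 : ℝ) ^ (-j) * ‖ξ‖| = (2 : ℝ) ^ (-j) * ‖ξ‖ := abs_of_nonneg (by positivity)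
    rw [psiR, hχ.supp _ (by rw [abs_abs, h4]; exact h3.le),
      hχ.supp _ (by rw [abs_mul, h4, abs_two]; linarith), sub_zero]
  have hsmooth : ContDiff ℝ ((⊤ : ℕ∞) : WithTop ℕ∞) χ := contDiff_infty.2 hχ.smooth
  have hcd : ContDiff ℝ ((⊤ : ℕ∞) : WithTop ℕ∞)
      fun ξ : Eucl n => psiR χ ((2 : ℝ) ^ (-j) * ‖ξ‖) := by
    rw [contDiff_iff_contDiffAt]
    intro ξ
    by_cases hξ : ξ = 0
    · have hev : (fun ξ : Eucl n => psiR χ ((2 : ℝ) ^ (-j) * ‖ξ‖)) =ᶠ[𝓝 ξ] fun _ => 0 := by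
        have ho : {η : Eucl n | (2 : ℝ) ^ (-j) * ‖η‖ < 1 / 2} ∈ 𝓝 ξ := by
          refine (isOpen_lt (by fun_prop) (by fun_prop)).mem_nhds ?_
          simp [hξ]
        filter_upwards [ho] with η hη
        have hη' : (2 : ℝ) ^ (-j) * ‖η‖ < 1 / 2 := hη
        have h4 : |(2 : ℝ) ^ (-j) * ‖η‖| = (2 : ℝ) ^ (-j) * ‖η‖ := abs_of_nonneg (by positivity)
        rw [psiR, hχ.one _ (by rw [abs_abs, h4]; linarith),
          hχ.one _ (by rw [abs_mul, h4, abs_two]; linarith), sub_self]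
      exact contDiffAt_const.congr_of_eventuallyEq hev
    · have he : (fun ξ : Eucl n => psiR χ ((2 : ℝ) ^ (-j) * ‖ξ‖))
          = fun ξ => χ ((2 : ℝ) ^ (-j) * ‖ξ‖) - χ (2 * ((2 : ℝ) ^ (-j) * ‖ξ‖)) := by
        ext η
        rw [psiR, abs_of_nonneg (by positivity)]
      rw [he]
      have hn : ContDiffAt ℝ ((⊤ : ℕ∞) : WithTop ℕ∞) (fun η : Eucl n => (2 : ℝ) ^ (-j) * ‖η‖) ξ :=
        contDiffAt_const.mul (contDiffAt_norm ℝ hξ)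
      exact (hsmooth.contDiffAt.comp ξ hn).sub
        (hsmooth.contDiffAt.comp ξ (contDiffAt_const.mul hn))
  have hcs : HasCompactSupport fun ξ : Eucl n => ((psiR χ ((2 : ℝ) ^ (-j) * ‖ξ‖) : ℝ) : ℂ) := by
    refine HasCompactSupport.intro (isCompact_closedBall (0 : Eucl n) (2 * (2 : ℝ) ^ j))
      fun ξ hξ => ?_
    by_contra hne
    refine hξ ?_
    rw [mem_closedBall_zero_iff]
    exact hsupp ξ fun h => hne (by rw [h, Complex.ofReal_zero])
  refine ⟨hcs.toSchwartzMap (Complex.ofRealCLM.contDiff.comp hcd), fun ξ => rfl,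
    fun ξ hξ => hsupp ξ fun h => hξ ?_⟩
  change ((psiR χ ((2 : ℝ) ^ (-j) * ‖ξ‖) : ℝ) : ℂ) = 0
  rw [h, Complex.ofReal_zero]

/-- The spatial frequency profile of a forcing term accumulated over the time set `E`. -/
def duhamelSymbol (ε : Fin n → ℝ) (H : ℝ → Eucl n → ℂ) (E : Set ℝ) (ξ : Eucl n) : ℂ :=
  ∫ s in E, wave ε (-s) 0 ξ * H s ξ

section Symbol

variable {ε : Fin n → ℝ} {H : ℝ → Eucl n → ℂ} {A : ℝ → ℝ} {B : Eucl n → ℝ}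

theorem continuous_wave_neg_time (ε : Fin n → ℝ) :
    Continuous fun z : ℝ × Eucl n => wave ε (-z.1) 0 z.2 := by fun_prop

theorem measurable_wave_neg_mul {X : Type*} [MeasurableSpace X]
    (hH : Measurable fun z : ℝ × Eucl n => H z.1 z.2) {f : X → ℝ} {g : X → Eucl n}
    (hf : Measurable f) (hg : Measurable g) :
    Measurable fun x => wave ε (-(f x)) 0 (g x) * H (f x) (g x) := by
  have h1 : Measurable fun z : ℝ × Eucl n => wave ε (-z.1) 0 z.2 :=
    (continuous_wave_neg_time ε).measurable
  have h2 : Measurable fun x => wave ε (-(f x)) 0 (g x) := measurable_comp_prodMk h1 hf hg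
  have h3 : Measurable fun x => H (f x) (g x) := measurable_comp_prodMk hH hf hg
  exact h2.mul h3

theorem integrable_wave_mul_slice (hH : Measurable fun z : ℝ × Eucl n => H z.1 z.2)
    (hA : Integrable A) (hAB : ∀ s ξ, ‖H s ξ‖ ≤ A s * B ξ) (ξ : Eucl n) :
    Integrable fun s => wave ε (-s) 0 ξ * H s ξ := by
  refine (hA.mul_const (B ξ)).mono' (Measurable.aestronglyMeasurable ?_)
    (ae_of_all _ fun s => ?_)
  · exact measurable_wave_neg_mul hH measurable_id measurable_const
  · rw [norm_mul, norm_wave, one_mul]; exact hAB s ξ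

theorem measurable_duhamelSymbol (hH : Measurable fun z : ℝ × Eucl n => H z.1 z.2) (E : Set ℝ) :
    Measurable (duhamelSymbol ε H E) := by
  have h : Measurable fun z : Eucl n × ℝ => wave ε (-z.2) 0 z.1 * H z.2 z.1 :=
    measurable_wave_neg_mul hH measurable_snd measurable_fst
  exact (h.stronglyMeasurable.integral_prod_right (ν := volume.restrict E)).measurable

theorem norm_duhamelSymbol_le (hA : Integrable A) (hAB : ∀ s ξ, ‖H s ξ‖ ≤ A s * B ξ) (E : Set ℝ)
    (ξ : Eucl n) : ‖duhamelSymbol ε H E ξ‖ ≤ (∫ s in E, A s) * B ξ := by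
  rw [← integral_mul_const]
  refine norm_integral_le_of_norm_le (hA.restrict.mul_const (B ξ)) (ae_of_all _ fun s => ?_)
  rw [norm_mul, norm_wave, one_mul]; exact hAB s ξ

theorem integrable_duhamelSymbol (hH : Measurable fun z : ℝ × Eucl n => H z.1 z.2)
    (hA : Integrable A) (hB : Integrable B) (hAB : ∀ s ξ, ‖H s ξ‖ ≤ A s * B ξ) (E : Set ℝ) :
    Integrable (duhamelSymbol ε H E) :=
  (hB.const_mul _).mono' (measurable_duhamelSymbol hH E).aestronglyMeasurable
    (ae_of_all _ (norm_duhamelSymbol_le hA hAB E))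

theorem continuous_comp_prodMk_right {X Y Z : Type*} [TopologicalSpace X] [TopologicalSpace Y]
    [TopologicalSpace Z] {K : X × Y → Z} (hK : Continuous K) (s : X) :
    Continuous fun y => K (s, y) :=
  hK.comp (Continuous.prodMk_right s)

theorem continuous_duhamelSymbol (hH : Continuous fun z : ℝ × Eucl n => H z.1 z.2)
    (hA : Integrable A) (hA0 : ∀ s, 0 ≤ A s) (hAB : ∀ s ξ, ‖H s ξ‖ ≤ A s * B ξ)
    (hB : ∀ ξ, B ξ ≤ 1) (E : Set ℝ) : Continuous (duhamelSymbol ε H E) := by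
  unfold duhamelSymbol
  have hc : Continuous fun z : ℝ × Eucl n => wave ε (-z.1) 0 z.2 * H z.1 z.2 :=
    (continuous_wave_neg_time ε).mul hH
  refine continuous_of_dominated (bound := A) (fun ξ => ?_) (fun ξ => ae_of_all _ fun s => ?_)
    hA.restrict (ae_of_all _ fun s => ?_)
  · exact (integrable_wave_mul_slice hH.measurable hA hAB ξ).1.restrict
  · rw [norm_mul, norm_wave, one_mul]
    exact (hAB s ξ).trans (mul_le_of_le_one_right (hA0 s) (hB ξ))
  · exact continuous_comp_prodMk_right hc s

theorem ker_wave_mul (ε : Fin n → ℝ) (b : Eucl n → ℂ) (t s : ℝ) (x : Eucl n) :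
    ker ε (fun ξ => wave ε s 0 ξ * b ξ) t x = ker ε b (t + s) x := by
  unfold ker
  congr 1; ext ξ
  change wave ε s 0 ξ * b ξ * wave ε t x ξ = _
  rw [mul_comm (wave ε s 0 ξ), mul_assoc, wave_mul_wave, zero_add, add_comm]

/-- Fubini for the superposition of free waves. -/
theorem ker_duhamelSymbol_eq (hH : Measurable fun z : ℝ × Eucl n => H z.1 z.2)
    (hA : Integrable A) (hB : Integrable B) (hAB : ∀ s ξ, ‖H s ξ‖ ≤ A s * B ξ) (E : Set ℝ)
    (t : ℝ) (x : Eucl n) :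
    ker ε (duhamelSymbol ε H E) t x = ∫ s in E, ker ε (H s) (t - s) x := by
  have hi : Integrable (Function.uncurry fun (ξ : Eucl n) (s : ℝ) =>
      wave ε (-s) 0 ξ * H s ξ * wave ε t x ξ) (volume.prod (volume.restrict E)) := by
    refine (hB.mul_prod (hA.restrict (s := E))).mono' (Measurable.aestronglyMeasurable ?_)
      (ae_of_all _ fun z => ?_)
    · have h : Measurable fun z : Eucl n × ℝ => wave ε (-z.2) 0 z.1 * H z.2 z.1 :=
        measurable_wave_neg_mul hH measurable_snd measurable_fst
      have h2 : Continuous fun z : Eucl n × ℝ => wave ε t x z.1 := by fun_prop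
      exact h.mul h2.measurable
    · change ‖wave ε (-z.2) 0 z.1 * H z.2 z.1 * wave ε t x z.1‖ ≤ _
      rw [norm_mul, norm_mul, norm_wave, norm_wave, one_mul, mul_one, mul_comm]
      exact hAB _ _
  unfold ker duhamelSymbol
  simp_rw [← integral_mul_const]
  rw [integral_integral_swap hi]
  congr 1; ext s
  congr 1; ext ξ
  rw [mul_comm (wave ε (-s) 0 ξ), mul_assoc, wave_mul_wave, zero_add, neg_add_eq_sub]

theorem enorm_ker_le_sub (hH : Measurable fun z : ℝ × Eucl n => H z.1 z.2)
    (hA : Integrable A) (hB : Integrable B) (hAB : ∀ s ξ, ‖H s ξ‖ ≤ A s * B ξ) (E : Set ℝ)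
    (t : ℝ) (x : Eucl n) :
    ‖ker ε (duhamelSymbol ε H E) t x‖ ≤ (∫ s in E, A s) * ∫ ξ, B ξ := by
  refine (norm_ker_le _ _ _ _).trans ?_
  rw [← integral_const_mul]
  exact integral_mono (integrable_duhamelSymbol hH hA hB hAB E).norm (hB.const_mul _)
    (norm_duhamelSymbol_le hA hAB E)

end Symbol

theorem fourier_eq_zero_of_not_integrable {f : Eucl n → ℂ} (hf : ¬ Integrable f) : 𝓕 f = 0 := by
  ext w
  rw [Real.fourier_eq, Pi.zero_apply]
  refine integral_undef fun h => hf ?_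
  exact (VectorFourier.fourierIntegral_convergent_iff (L := innerₗ (Eucl n))
    Real.continuous_fourierChar continuous_inner w).1 h

theorem prop_eq_ker (ε : Fin n → ℝ) (t : ℝ) (φ : Eucl n → ℂ) (x : Eucl n) :
    prop ε t φ x = ker ε (𝓕 φ) t x := by
  rw [← zero_add t, ← ker_wave_mul, ker_zero_eq, zero_add]
  unfold prop mulOp
  refine congrArg (fun f : Eucl n → ℂ => 𝓕⁻ f x) (funext fun ξ => ?_)
  refine congrArg (· * 𝓕 φ ξ) ?_
  unfold wave
  rw [inner_zero_left]
  push_cast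
  ring_nf

theorem proj_eq_ker (ε : Fin n → ℝ) (χ : ℝ → ℝ) (j : ℤ) (f : Eucl n → ℂ) (x : Eucl n) :
    proj χ j f x = ker ε (fun ξ => (psiR χ ((2 : ℝ) ^ (-j) * ‖ξ‖) : ℂ) * 𝓕 f ξ) 0 x := by
  rw [ker_zero_eq]; rfl

/-- The Littlewood–Paley piece of the Duhamel term is controlled by a free wave whose profile is
accumulated between the times `0` and `t`. -/
theorem norm_projT_duhamel_le (ε : Fin n → ℝ) (χ : ℝ → ℝ) (j : ℤ)
    (F : SchwartzMap (ℝ × Eucl n) ℂ) (t : ℝ) (x : Eucl n) :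
    ‖projT χ j (duhamel ε fun z => F z) (t, x)‖ ≤
      ‖ker ε (duhamelSymbol ε
        (fun s ξ => (psiR χ ((2 : ℝ) ^ (-j) * ‖ξ‖) : ℂ) * 𝓕 (timeSlice s F) ξ)
        (Set.uIoc 0 t)) t x‖ := by
  obtain ⟨C, hC, hF⟩ := exists_norm_fourier_timeSlice_le F
  have hA : Integrable fun s : ℝ => C * (1 + s ^ 2)⁻¹ := integrable_inv_one_add_sq.const_mul C
  have hB : Integrable fun ξ : Eucl n => (1 + ‖ξ‖) ^ (-((n : ℝ) + 1)) :=
    integrable_one_add_norm (by simp)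
  have hB1 : ∀ ξ : Eucl n, (1 + ‖ξ‖) ^ (-((n : ℝ) + 1)) ≤ 1 := fun ξ =>
    Real.rpow_le_one_of_one_le_of_nonpos (by linarith [norm_nonneg ξ]) 
      (by linarith [n.cast_nonneg (α := ℝ)])
  have hcont := continuous_fourier_timeSlice F
  set h : Eucl n → ℂ := duhamelSymbol ε (fun s ξ => 𝓕 (timeSlice s F) ξ) (Set.uIoc 0 t) with hh
  have hhc : Continuous h := continuous_duhamelSymbol hcont hA (fun s => by positivity) hF hB1 _
  have hhi : Integrable h := integrable_duhamelSymbol hcont.measurable hA hB hF _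
  set σ : ℝ := if (0 : ℝ) ≤ t then 1 else -1 with hσ
  have hσ1 : ‖(σ : ℂ)‖ = 1 := by rw [hσ]; split_ifs <;> simp
  have hD : ∀ y, duhamel ε (fun z => F z) (t, y) = σ * ker ε h t y := by
    intro y
    unfold duhamel
    rw [intervalIntegral.intervalIntegral_eq_integral_uIoc, ← hσ, Complex.real_smul, hh,
      ker_duhamelSymbol_eq hcont.measurable hA hB hF]
    congr 1
    exact integral_congr_ae (ae_of_all _ fun s => prop_eq_ker ε (t - s) (timeSlice s F) y)
  have hwc : Continuous fun ξ => (σ : ℂ) * (wave ε t 0 ξ * h ξ) :=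
    continuous_const.mul ((by fun_prop : Continuous fun ξ : Eucl n => wave ε t 0 ξ).mul hhc)
  have hwi : Integrable fun ξ => (σ : ℂ) * (wave ε t 0 ξ * h ξ) := by
    refine hhi.norm.mono' hwc.aestronglyMeasurable (ae_of_all _ fun ξ => ?_)
    rw [norm_mul, norm_mul, norm_wave, hσ1, one_mul, one_mul]
  have hD' : (fun y => duhamel ε (fun z => F z) (t, y))
      = 𝓕⁻ fun ξ => (σ : ℂ) * (wave ε t 0 ξ * h ξ) := by
    ext y
    rw [hD, ← ker_zero_eq ε]
    have := ker_wave_mul ε h 0 t y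
    rw [zero_add] at this
    rw [← this]
    unfold ker
    rw [← integral_const_mul]
    congr 1; ext ξ; ring
  change ‖proj χ j (fun y => duhamel ε (fun z => F z) (t, y)) x‖ ≤ _
  by_cases hint : Integrable fun y => duhamel ε (fun z => F z) (t, y)
  · have hinv : 𝓕 (fun y => duhamel ε (fun z => F z) (t, y))
        = fun ξ => (σ : ℂ) * (wave ε t 0 ξ * h ξ) := by
      rw [hD']
      refine hwc.fourier_fourierInv_eq hwi ?_
      rw [hD'] at hint
      have := hint.comp_neg
      simpa only [Real.fourierInv_eq_fourier_neg, neg_neg] using this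
    rw [proj_eq_ker ε, hinv]
    have e1 : duhamelSymbol ε
        (fun s ξ => (psiR χ ((2 : ℝ) ^ (-j) * ‖ξ‖) : ℂ) * 𝓕 (timeSlice s F) ξ) (Set.uIoc 0 t)
        = fun ξ => (psiR χ ((2 : ℝ) ^ (-j) * ‖ξ‖) : ℂ) * h ξ := by
      ext ξ
      rw [hh, duhamelSymbol, duhamelSymbol, ← integral_const_mul]
      congr 1; ext s; ring
    have e2 := ker_wave_mul ε (fun ξ => (psiR χ ((2 : ℝ) ^ (-j) * ‖ξ‖) : ℂ) * h ξ) 0 t x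
    rw [zero_add] at e2
    have e3 : ker ε (fun ξ => (psiR χ ((2 : ℝ) ^ (-j) * ‖ξ‖) : ℂ) *
          ((σ : ℂ) * (wave ε t 0 ξ * h ξ))) 0 x = σ * ker ε (fun ξ => wave ε t 0 ξ *
          ((psiR χ ((2 : ℝ) ^ (-j) * ‖ξ‖) : ℂ) * h ξ)) 0 x := by
      unfold ker
      rw [← integral_const_mul]
      congr 1; ext ξ; ring
    rw [e1, ← e2, e3, norm_mul, hσ1, one_mul]
  · rw [proj_eq_ker ε, fourier_eq_zero_of_not_integrable hint]
    simp [ker]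

section WaveSup

variable {ε : Fin n → ℝ} {H : ℝ → Eucl n → ℂ} {A : ℝ → ℝ} {B : Eucl n → ℝ} {e : Eucl n}

theorem duhamelSymbol_Ioc_add (hH : Measurable fun z : ℝ × Eucl n => H z.1 z.2)
    (hA : Integrable A) (hAB : ∀ s ξ, ‖H s ξ‖ ≤ A s * B ξ) {a b c : ℝ} (hab : a ≤ b) (hbc : b ≤ c)
    (ξ : Eucl n) : duhamelSymbol ε H (Set.Ioc a c) ξ
      = duhamelSymbol ε H (Set.Ioc a b) ξ + duhamelSymbol ε H (Set.Ioc b c) ξ := by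
  have hi := integrable_wave_mul_slice (ε := ε) hH hA hAB ξ
  unfold duhamelSymbol
  rw [← Set.Ioc_union_Ioc_eq_Ioc hab hbc]
  exact setIntegral_union (Set.Ioc_disjoint_Ioc_of_le le_rfl) measurableSet_Ioc
    hi.integrableOn hi.integrableOn

theorem ker_duhamelSymbol_Ioc_add (hH : Measurable fun z : ℝ × Eucl n => H z.1 z.2)
    (hA : Integrable A) (hB : Integrable B) (hAB : ∀ s ξ, ‖H s ξ‖ ≤ A s * B ξ) {a b c : ℝ}
    (hab : a ≤ b) (hbc : b ≤ c) (t : ℝ) (x : Eucl n) :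
    ker ε (duhamelSymbol ε H (Set.Ioc a c)) t x
      = ker ε (duhamelSymbol ε H (Set.Ioc a b)) t x
        + ker ε (duhamelSymbol ε H (Set.Ioc b c)) t x := by
  unfold ker
  rw [← integral_add
    (integrable_mul_wave ε (integrable_duhamelSymbol hH hA hB hAB (Set.Ioc a b)) t x)
    (integrable_mul_wave ε (integrable_duhamelSymbol hH hA hB hAB (Set.Ioc b c)) t x)]
  congr 1; ext ξ
  rw [duhamelSymbol_Ioc_add hH hA hAB hab hbc, add_mul]

/-- The maximal function, over a sequence of points of the hyperplane and of times, of the wave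
generated by the part of the forcing term in the time set `E`. -/
def waveSup (ε : Fin n → ℝ) (H : ℝ → Eucl n → ℂ) (e : Eucl n) (c : ℕ → ℝ × hyperplane e)
    (E : Set ℝ) (r : ℝ) : ℝ≥0∞ :=
  ⨆ i, ‖ker ε (duhamelSymbol ε H E) (c i).1 (r • e + ((c i).2 : Eucl n))‖ₑ

theorem measurable_waveSup (hH : Measurable fun z : ℝ × Eucl n => H z.1 z.2)
    (hA : Integrable A) (hB : Integrable B) (hAB : ∀ s ξ, ‖H s ξ‖ ≤ A s * B ξ)
    (c : ℕ → ℝ × hyperplane e) (E : Set ℝ) : Measurable (waveSup ε H e c E) := by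
  unfold waveSup
  refine Measurable.iSup fun i => Measurable.enorm ?_
  exact measurable_ker_comp (integrable_duhamelSymbol hH hA hB hAB E) measurable_const
    (by fun_prop)

theorem waveSup_Ioc_self (c : ℕ → ℝ × hyperplane e) (a r : ℝ) :
    waveSup ε H e c (Set.Ioc a a) r = 0 := by
  simp [waveSup, duhamelSymbol, ker]

theorem waveSup_Ioc_le_add (hH : Measurable fun z : ℝ × Eucl n => H z.1 z.2)
    (hA : Integrable A) (hB : Integrable B) (hAB : ∀ s ξ, ‖H s ξ‖ ≤ A s * B ξ)
    (c : ℕ → ℝ × hyperplane e) {a b d : ℝ} (hab : a ≤ b) (hbd : b ≤ d) (r : ℝ) :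
    waveSup ε H e c (Set.Ioc a d) r
      ≤ waveSup ε H e c (Set.Ioc a b) r + waveSup ε H e c (Set.Ioc b d) r := by
  refine iSup_le fun i => ?_
  rw [ker_duhamelSymbol_Ioc_add hH hA hB hAB hab hbd]
  exact (enorm_add_le _ _).trans (add_le_add
    (le_iSup (fun i => ‖ker ε (duhamelSymbol ε H (Set.Ioc a b)) (c i).1
      (r • e + ((c i).2 : Eucl n))‖ₑ) i)
    (le_iSup (fun i => ‖ker ε (duhamelSymbol ε H (Set.Ioc b d)) (c i).1
      (r • e + ((c i).2 : Eucl n))‖ₑ) i))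

theorem enorm_ker_le_iSup {h : Eucl n → ℂ} (hh : Integrable h) {c : ℕ → ℝ × hyperplane e}
    (hc : DenseRange c) (r t : ℝ) (v : hyperplane e) :
    ‖ker ε h t (r • e + (v : Eucl n))‖ₑ
      ≤ ⨆ i, ‖ker ε h (c i).1 (r • e + ((c i).2 : Eucl n))‖ₑ := by
  have hcont : Continuous fun z : ℝ × hyperplane e => ‖ker ε h z.1 (r • e + (z.2 : Eucl n))‖ₑ := by
    have hg : Continuous fun z : ℝ × hyperplane e => ((z.1, r • e + (z.2 : Eucl n)) : ℝ × Eucl n) := by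
      fun_prop
    exact ((continuous_ker ε hh).comp hg).enorm
  have hcl : IsClosed {z : ℝ × hyperplane e | ‖ker ε h z.1 (r • e + (z.2 : Eucl n))‖ₑ
      ≤ ⨆ i, ‖ker ε h (c i).1 (r • e + ((c i).2 : Eucl n))‖ₑ} :=
    isClosed_le hcont continuous_const
  exact hc.induction_on (p := fun z => ‖ker ε h z.1 (r • e + (z.2 : Eucl n))‖ₑ
      ≤ ⨆ i, ‖ker ε h (c i).1 (r • e + ((c i).2 : Eucl n))‖ₑ) (t, v) hcl fun i =>
    le_iSup (fun i => ‖ker ε h (c i).1 (r • e + ((c i).2 : Eucl n))‖ₑ) i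

/-- The `k`-th point of the grid of mesh `1/(K+1)` starting at `-K`. -/
def gridPoint (K k : ℕ) : ℝ := -(K : ℝ) + k / ((K : ℝ) + 1)

theorem gridPoint_mono (K : ℕ) : Monotone (gridPoint K) := by
  intro k l h
  unfold gridPoint
  have : (k : ℝ) ≤ l := Nat.cast_le.2 h
  gcongr

theorem gridPoint_zero_time (K : ℕ) : gridPoint K (K * (K + 1)) = 0 := by
  unfold gridPoint
  push_cast
  rw [mul_div_assoc, div_self (by positivity)]; ring

/-- Every time in `[-K, K]` is close to a grid point on its left. -/
theorem exists_gridPoint_le {K : ℕ} {t : ℝ} (ht : |t| ≤ K) :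
    ∃ k ≤ 2 * K * (K + 1), gridPoint K k ≤ t ∧ t ≤ gridPoint K k + 1 / ((K : ℝ) + 1) := by
  obtain ⟨h1, h2⟩ := abs_le.1 ht
  have hK : (0 : ℝ) < (K : ℝ) + 1 := by positivity
  have h0 : 0 ≤ (t + K) * ((K : ℝ) + 1) := mul_nonneg (by linarith) hK.le
  refine ⟨⌊(t + K) * ((K : ℝ) + 1)⌋₊, ?_, ?_, ?_⟩
  · refine Nat.floor_le_of_le ?_
    push_cast
    have : t + K ≤ 2 * K := by linarith
    gcongr
  · have := Nat.floor_le h0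
    unfold gridPoint
    rw [neg_add_le_iff_le_add, div_le_iff₀ hK]
    linarith
  · have := (Nat.lt_floor_add_one ((t + K) * ((K : ℝ) + 1))).le
    unfold gridPoint
    have h3 : t + K ≤ (⌊(t + K) * ((K : ℝ) + 1)⌋₊ + 1) / ((K : ℝ) + 1) := by
      rw [le_div_iff₀ hK]; exact this
    rw [add_div] at h3
    linarith

/-- The discretized maximal function over the grid with parameter `K`. -/
def gridSup (ε : Fin n → ℝ) (H : ℝ → Eucl n → ℂ) (e : Eucl n) (c : ℕ → ℝ × hyperplane e)
    (K : ℕ) (r : ℝ) : ℝ≥0∞ :=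
  (Finset.Icc 0 (0 + 2 * K * (K + 1))).sup fun k =>
    waveSup ε H e c (Set.Ioc (gridPoint K 0) (gridPoint K k)) r

theorem enorm_ker_uIoc_le_gridSup (hH : Measurable fun z : ℝ × Eucl n => H z.1 z.2)
    (hA : Integrable A) (hB : Integrable B) (hAB : ∀ s ξ, ‖H s ξ‖ ≤ A s * B ξ)
    (hB0 : ∀ ξ, 0 ≤ B ξ) {M : ℝ} (hM : ∀ s, A s ≤ M) (hM0 : 0 ≤ M)
    {c : ℕ → ℝ × hyperplane e} (hc : DenseRange c) (r : ℝ) {t : ℝ} (v : hyperplane e)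
    {K : ℕ} (ht : |t| ≤ K) :
    ‖ker ε (duhamelSymbol ε H (Set.uIoc 0 t)) t (r • e + (v : Eucl n))‖ₑ
      ≤ 2 * gridSup ε H e c K r + ENNReal.ofReal (M * (∫ ξ, B ξ) * (1 / ((K : ℝ) + 1))) := by
  set x := r • e + (v : Eucl n) with hx
  have hint := fun E => integrable_duhamelSymbol (ε := ε) hH hA hB hAB E
  have hgrid : ∀ k ≤ 2 * K * (K + 1),
      ‖ker ε (duhamelSymbol ε H (Set.Ioc (gridPoint K 0) (gridPoint K k))) t x‖ₑ
        ≤ gridSup ε H e c K r := by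
    intro k hk
    refine (enorm_ker_le_iSup (hint _) hc r t v).trans ?_
    exact Finset.le_sup (f := fun k =>
      waveSup ε H e c (Set.Ioc (gridPoint K 0) (gridPoint K k)) r)
      (Finset.mem_Icc.2 ⟨Nat.zero_le _, by rwa [zero_add]⟩)
  have h0 : ‖ker ε (duhamelSymbol ε H (Set.Ioc (gridPoint K 0) 0)) t x‖ₑ
      ≤ gridSup ε H e c K r := by
    have := hgrid (K * (K + 1)) (by nlinarith)
    rwa [gridPoint_zero_time] at this
  obtain ⟨k, hk, h1, h2⟩ := exists_gridPoint_le ht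
  have hk0 : gridPoint K 0 ≤ gridPoint K k := gridPoint_mono K (Nat.zero_le k)
  have hg0 : gridPoint K 0 ≤ 0 := by
    rw [← gridPoint_zero_time K]; exact gridPoint_mono K (Nat.zero_le _)
  have hrem : ‖ker ε (duhamelSymbol ε H (Set.Ioc (gridPoint K k) t)) t x‖ₑ
      ≤ ENNReal.ofReal (M * (∫ ξ, B ξ) * (1 / ((K : ℝ) + 1))) := by
    rw [← ofReal_norm]
    refine ENNReal.ofReal_le_ofReal ((enorm_ker_le_sub hH hA hB hAB _ t x).trans ?_)
    have h3 : ∫ s in Set.Ioc (gridPoint K k) t, A s ≤ M * (1 / ((K : ℝ) + 1)) := by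
      calc ∫ s in Set.Ioc (gridPoint K k) t, A s
          ≤ ∫ s in Set.Ioc (gridPoint K k) t, M :=
            integral_mono hA.restrict (integrable_const _) hM
        _ = M * (t - gridPoint K k) := by
            rw [setIntegral_const, Real.volume_real_Ioc_of_le h1, smul_eq_mul, mul_comm]
        _ ≤ _ := by gcongr; linarith
    have h4 : 0 ≤ ∫ ξ, B ξ := integral_nonneg hB0
    calc _ ≤ M * (1 / ((K : ℝ) + 1)) * ∫ ξ, B ξ := by gcongr
      _ = _ := by ring
  have hT : ‖ker ε (duhamelSymbol ε H (Set.Ioc (gridPoint K 0) t)) t x‖ₑ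
      ≤ gridSup ε H e c K r + ENNReal.ofReal (M * (∫ ξ, B ξ) * (1 / ((K : ℝ) + 1))) := by
    rw [ker_duhamelSymbol_Ioc_add hH hA hB hAB hk0 h1]
    exact (enorm_add_le _ _).trans (add_le_add (hgrid k hk) hrem)
  have hsplit : ‖ker ε (duhamelSymbol ε H (Set.uIoc 0 t)) t x‖ₑ
      ≤ ‖ker ε (duhamelSymbol ε H (Set.Ioc (gridPoint K 0) 0)) t x‖ₑ
        + ‖ker ε (duhamelSymbol ε H (Set.Ioc (gridPoint K 0) t)) t x‖ₑ := by
    rcases le_total 0 t with h | h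
    · rw [Set.uIoc_of_le h, eq_sub_of_add_eq' (ker_duhamelSymbol_Ioc_add hH hA hB hAB hg0 h t x).symm,
        add_comm]
      exact enorm_sub_le
    · rw [Set.uIoc_of_ge h, eq_sub_of_add_eq'
        (ker_duhamelSymbol_Ioc_add hH hA hB hAB (hk0.trans h1) h t x).symm]
      exact enorm_sub_le
  calc _ ≤ _ := hsplit
    _ ≤ gridSup ε H e c K r + (gridSup ε H e c K r
        + ENNReal.ofReal (M * (∫ ξ, B ξ) * (1 / ((K : ℝ) + 1)))) := add_le_add h0 hT
    _ = _ := by ring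

theorem enorm_ker_uIoc_le_liminf (hH : Measurable fun z : ℝ × Eucl n => H z.1 z.2)
    (hA : Integrable A) (hB : Integrable B) (hAB : ∀ s ξ, ‖H s ξ‖ ≤ A s * B ξ)
    (hB0 : ∀ ξ, 0 ≤ B ξ) {M : ℝ} (hM : ∀ s, A s ≤ M) (hM0 : 0 ≤ M)
    {c : ℕ → ℝ × hyperplane e} (hc : DenseRange c) (r t : ℝ) (v : hyperplane e) :
    ‖ker ε (duhamelSymbol ε H (Set.uIoc 0 t)) t (r • e + (v : Eucl n))‖ₑ
      ≤ liminf (fun K => 2 * gridSup ε H e c K r) atTop := by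
  refine ENNReal.le_of_forall_pos_le_add fun δ hδ _ => ?_
  rw [← tsub_le_iff_right]
  refine le_liminf_of_le (by isBoundedDefault) ?_
  have hlim : Tendsto (fun K : ℕ => ENNReal.ofReal (M * (∫ ξ, B ξ) * (1 / ((K : ℝ) + 1)))) atTop
      (𝓝 0) := by
    have := (tendsto_one_div_add_atTop_nhds_zero_nat (𝕜 := ℝ)).const_mul (M * (∫ ξ, B ξ))
    rw [mul_zero] at this
    simpa using ENNReal.tendsto_ofReal this
  have hev := hlim.eventually_le_const (show (0 : ℝ≥0∞) < δ by exact_mod_cast hδ)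
  filter_upwards [hev, eventually_ge_atTop ⌈|t|⌉₊] with K hK1 hK2
  rw [tsub_le_iff_right]
  exact (enorm_ker_uIoc_le_gridSup hH hA hB hAB hB0 hM hM0 hc r v
    ((Nat.le_ceil _).trans (Nat.cast_le.2 hK2))).trans (add_le_add le_rfl hK1)

/-- Removal of the retardation: a bound for the maximal functions of the time blocks gives a bound
for the maximal function of the retarded integral. -/
theorem lintegral_iSup_ker_uIoc_le (hH : Measurable fun z : ℝ × Eucl n => H z.1 z.2)
    (hA : Integrable A) (hB : Integrable B) (hAB : ∀ s ξ, ‖H s ξ‖ ≤ A s * B ξ)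
    (hB0 : ∀ ξ, 0 ≤ B ξ) {M : ℝ} (hM : ∀ s, A s ≤ M) (hM0 : 0 ≤ M)
    {c : ℕ → ℝ × hyperplane e} (hc : DenseRange c) {p s : ℝ} (hp : 1 ≤ p) (hs : 0 < s)
    (hsp : s < p) {w : ℝ → ℝ≥0∞} (hw : ∫⁻ t, w t ≠ ∞) {D : ℝ≥0∞}
    (hD : ∀ a b, a ≤ b → (∫⁻ r, waveSup ε H e c (Set.Ioc a b) r ^ p) ^ (1 / p)
      ≤ D * (∫⁻ t in Set.Ioc a b, w t) ^ (1 / s)) :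
    (∫⁻ r : ℝ, (⨆ z : ℝ × hyperplane e,
        ‖ker ε (duhamelSymbol ε H (Set.uIoc 0 z.1)) z.1 (r • e + (z.2 : Eucl n))‖ₑ) ^ p) ^ (1 / p)
      ≤ 2 * (ENNReal.ofReal (1 / (1 - 2 ^ (1 / p - 1 / s))) * (D * (∫⁻ t, w t) ^ (1 / s))) := by
  have hp0 : 0 < p := by linarith
  have hgm : ∀ K, Measurable (gridSup ε H e c K) := fun K =>
    measurable_finset_sup _ fun k => measurable_waveSup hH hA hB hAB c _
  have hsum : ∀ K k l, k ≤ l → ∑ i ∈ Finset.Ico k l,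
      ∫⁻ t in Set.Ioc (gridPoint K i) (gridPoint K (i + 1)), w t
      = ∫⁻ t in Set.Ioc (gridPoint K k) (gridPoint K l), w t := by
    intro K k l hkl
    induction l, hkl using Nat.le_induction with
    | base => simp
    | succ l hkl ih =>
      rw [Finset.sum_Ico_succ_top hkl, ih, ← lintegral_union measurableSet_Ioc
        (Set.Ioc_disjoint_Ioc_of_le le_rfl), Set.Ioc_union_Ioc_eq_Ioc (gridPoint_mono K hkl)
        (gridPoint_mono K (Nat.le_succ l))]
  have hgrid : ∀ K, (∫⁻ r, gridSup ε H e c K r ^ p) ^ (1 / p)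
      ≤ ENNReal.ofReal (1 / (1 - 2 ^ (1 / p - 1 / s))) * (D * (∫⁻ t, w t) ^ (1 / s)) := by
    intro K
    refine (lintegral_sup_rpow_le_of_blocks hp hs hsp
      (N := fun k l r => waveSup ε H e c (Set.Ioc (gridPoint K k) (gridPoint K l)) r)
      (m := fun i => ∫⁻ t in Set.Ioc (gridPoint K i) (gridPoint K (i + 1)), w t) (B := D)
      (fun k l => measurable_waveSup hH hA hB hAB c _) (fun k r => waveSup_Ioc_self c _ r)
      (fun k l m hkl hlm r => waveSup_Ioc_le_add hH hA hB hAB c (gridPoint_mono K hkl)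
        (gridPoint_mono K hlm) r)
      (fun i => ne_top_of_le_ne_top hw (setLIntegral_le_lintegral _ _))
      (fun k l hkl => ?_) (2 * K * (K + 1)) 0).trans ?_
    · rw [hsum K k l hkl]; exact hD _ _ (gridPoint_mono K hkl)
    · refine mul_le_mul_right (mul_le_mul_right (ENNReal.rpow_le_rpow ?_ (by positivity)) _) _
      rw [hsum K _ _ (by omega)]
      exact setLIntegral_le_lintegral _ _
  set Q := ENNReal.ofReal (1 / (1 - 2 ^ (1 / p - 1 / s))) * (D * (∫⁻ t, w t) ^ (1 / s)) with hQ
  have hgrid' : ∀ K, ∫⁻ r, (2 * gridSup ε H e c K r) ^ p ≤ (2 * Q) ^ p := by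
    intro K
    have hm : Measurable fun r => gridSup ε H e c K r ^ p := (hgm K).pow_const p
    simp_rw [ENNReal.mul_rpow_of_nonneg _ _ hp0.le]
    rw [lintegral_const_mul _ hm]
    refine mul_le_mul_right ?_ _
    rw [← ENNReal.rpow_inv_le_iff hp0, ← one_div]
    exact hgrid K
  rw [one_div, ENNReal.rpow_inv_le_iff hp0]
  calc _ ≤ ∫⁻ r, liminf (fun K => (2 * gridSup ε H e c K r) ^ p) atTop := by
        refine lintegral_mono fun r => ?_
        have hmono : liminf (fun K => (2 * gridSup ε H e c K r) ^ p) atTop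
            = (liminf (fun K => 2 * gridSup ε H e c K r) atTop) ^ p :=
          ((ENNReal.monotone_rpow_of_nonneg hp0.le).map_liminf_of_continuousAt _
            (ENNReal.continuous_rpow_const.continuousAt)).symm
        rw [hmono]
        exact ENNReal.rpow_le_rpow (iSup_le fun z =>
          enorm_ker_uIoc_le_liminf hH hA hB hAB hB0 hM hM0 hc r z.1 z.2) hp0.le
    _ ≤ liminf (fun K => ∫⁻ r, (2 * gridSup ε H e c K r) ^ p) atTop :=
        lintegral_liminf_le fun K => ((hgm K).const_mul 2).pow_const p
    _ ≤ (2 * Q) ^ p := by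
        refine liminf_le_of_le (by isBoundedDefault) fun b hb => ?_
        obtain ⟨K, hK⟩ := hb.exists
        exact hK.trans (hgrid' K)

end WaveSup

/-- The spatial Fourier transform of the Littlewood–Paley piece of a time slice. -/
def pieceSymbol (χ : ℝ → ℝ) (j : ℤ) (F : SchwartzMap (ℝ × Eucl n) ℂ) (s : ℝ) (ξ : Eucl n) : ℂ :=
  (psiR χ ((2 : ℝ) ^ (-j) * ‖ξ‖) : ℂ) * 𝓕 (timeSlice s F) ξ

theorem exists_norm_pieceSymbol_le {χ : ℝ → ℝ} (hχ : IsBump χ) (j : ℤ)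
    (F : SchwartzMap (ℝ × Eucl n) ℂ) : ∃ M : ℝ, 0 ≤ M ∧ ∀ s ξ,
      ‖pieceSymbol χ j F s ξ‖ ≤ M * (1 + s ^ 2)⁻¹ * (1 + ‖ξ‖) ^ (-((n : ℝ) + 1)) := by
  obtain ⟨b, hb, -⟩ := exists_schwartz_psi (n := n) hχ j
  obtain ⟨C, hC, h⟩ := exists_norm_fourier_timeSlice_le F
  have h1 : ∀ ξ, ‖b ξ‖ ≤ SchwartzMap.seminorm ℝ 0 0 b := fun ξ => SchwartzMap.norm_le_seminorm ℝ b ξ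
  refine ⟨SchwartzMap.seminorm ℝ 0 0 b * C, mul_nonneg (apply_nonneg _ _) hC, fun s ξ => ?_⟩
  unfold pieceSymbol
  rw [← hb, norm_mul, mul_assoc, mul_assoc, ← mul_assoc C]
  exact mul_le_mul (h1 ξ) (h s ξ) (norm_nonneg _) (apply_nonneg _ _)

theorem continuous_pieceSymbol {χ : ℝ → ℝ} (hχ : IsBump χ) (j : ℤ)
    (F : SchwartzMap (ℝ × Eucl n) ℂ) :
    Continuous fun z : ℝ × Eucl n => pieceSymbol χ j F z.1 z.2 := by
  obtain ⟨b, hb, -⟩ := exists_schwartz_psi (n := n) hχ j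
  unfold pieceSymbol
  simp_rw [← hb]
  exact (b.continuous.comp continuous_snd).mul (continuous_fourier_timeSlice F)

theorem exists_schwartz_proj_timeSlice {χ : ℝ → ℝ} (hχ : IsBump χ) (j : ℤ)
    (F : SchwartzMap (ℝ × Eucl n) ℂ) (s : ℝ) : ∃ f : SchwartzMap (Eucl n) ℂ,
      (f : Eucl n → ℂ) = (fun x => projT χ j (fun z => F z) (s, x)) ∧
        ((𝓕 f : SchwartzMap (Eucl n) ℂ) : Eucl n → ℂ) = pieceSymbol χ j F s := by
  obtain ⟨b, hb, -⟩ := exists_schwartz_psi (n := n) hχ j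
  have h1 : (SchwartzMap.smulLeftCLM ℂ (b : Eucl n → ℂ) (𝓕 (timeSlice s F)) : Eucl n → ℂ)
      = pieceSymbol χ j F s := by
    ext ξ
    rw [SchwartzMap.smulLeftCLM_apply_apply b.hasTemperateGrowth, hb, smul_eq_mul]
    rfl
  refine ⟨𝓕⁻ (SchwartzMap.smulLeftCLM ℂ (b : Eucl n → ℂ) (𝓕 (timeSlice s F))), ?_, ?_⟩
  · rw [SchwartzMap.fourierInv_coe, h1]
    rfl
  · rw [FourierTransform.fourier_fourierInv_eq, h1]

theorem measurable_ker_slice (ε : Fin n → ℝ) {H : ℝ → Eucl n → ℂ}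
    (hH : Measurable fun z : ℝ × Eucl n => H z.1 z.2) :
    Measurable fun z : ℝ × Eucl n => ker ε (H z.1) 0 z.2 := by
  have h1 : Measurable fun w : (ℝ × Eucl n) × Eucl n => H w.1.1 w.2 :=
    measurable_comp_prodMk hH (measurable_fst.comp measurable_fst) measurable_snd
  have h2 : Continuous fun w : (ℝ × Eucl n) × Eucl n => wave ε 0 w.1.2 w.2 := by fun_prop
  have h3 : Measurable fun w : (ℝ × Eucl n) × Eucl n => H w.1.1 w.2 * wave ε 0 w.1.2 w.2 :=
    h1.mul h2.measurable
  exact (h3.stronglyMeasurable.integral_prod_right (ν := volume)).measurable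

theorem innerQ_top_le {e : Eucl n} {u : ℝ × Eucl n → ℂ} {f : ℝ → Eucl n → ℂ}
    (h : ∀ t x, ‖u (t, x)‖ ≤ ‖f t x‖) (r : ℝ) :
    innerQ ∞ e u r ≤ ⨆ z : ℝ × hyperplane e, ‖f z.1 (r • e + (z.2 : Eucl n))‖ₑ := by
  unfold innerQ
  rw [eLpNorm_exponent_top]
  refine essSup_le_of_ae_le _ (ae_of_all _ fun z => ?_)
  exact (enorm_le_iff_norm_le.2 (h _ _)).trans
    (le_iSup (fun z : ℝ × hyperplane e => ‖f z.1 (r • e + (z.2 : Eucl n))‖ₑ) z)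

theorem rpow_le_of_block_bounds {X Y W : ℝ≥0∞} {p C₁ C₂ a : ℝ} (hp : 0 < p)
    (hX : X ≤ ENNReal.ofReal C₁ * Y ^ (p / 2))
    (hY : Y ≤ ENNReal.ofReal C₂ * W ^ (2 * a)) :
    X ^ (1 / p) ≤ ENNReal.ofReal C₁ ^ (1 / p) * ENNReal.ofReal C₂ ^ ((1 : ℝ) / 2) * W ^ a := by
  have hp' : 0 ≤ 1 / p := by positivity
  calc X ^ (1 / p) ≤ (ENNReal.ofReal C₁ * Y ^ (p / 2)) ^ (1 / p) := ENNReal.rpow_le_rpow hX hp'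
    _ = ENNReal.ofReal C₁ ^ (1 / p) * Y ^ ((1 : ℝ) / 2) := by
        rw [ENNReal.mul_rpow_of_nonneg _ _ hp', ← ENNReal.rpow_mul]
        congr 2; field_simp
    _ ≤ ENNReal.ofReal C₁ ^ (1 / p) * (ENNReal.ofReal C₂ * W ^ (2 * a)) ^ ((1 : ℝ) / 2) :=
        mul_le_mul_right (ENNReal.rpow_le_rpow hY (by norm_num)) _
    _ = _ := by
        rw [ENNReal.mul_rpow_of_nonneg _ _ (by norm_num), ← ENNReal.rpow_mul, ← mul_assoc,
          show 2 * a * ((1 : ℝ) / 2) = a by ring]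

theorem conj_exponent_eq {q q' : ℝ} (hq : 2 < q) (h : 1 / q + 1 / q' = 1) : q' = q / (q - 1) := by
  have h0 : q' ≠ 0 := by
    rintro rfl
    have h1 : 1 / q = 1 := by simpa using h
    rw [div_eq_one_iff_eq (by linarith)] at h1
    linarith
  have h1 : q - 1 ≠ 0 := by linarith
  have h2 : q ≠ 0 := by linarith
  field_simp at h ⊢
  linarith

theorem mixNorm_ofReal_eq {q r : ℝ} (hq : 0 < q) (hr : 0 < r) (u : ℝ × Eucl n → ℂ) :
    mixNorm (ENNReal.ofReal q) (ENNReal.ofReal r) u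
      = (∫⁻ t, ((∫⁻ x, ‖u (t, x)‖ₑ ^ r) ^ (1 / r)) ^ q) ^ (1 / q) := by
  unfold mixNorm
  rw [if_neg ENNReal.ofReal_ne_top, ENNReal.toReal_ofReal hq.le]
  simp_rw [eLpNorm_eq_lintegral_rpow_enorm_toReal (ENNReal.ofReal_pos.2 hr).ne'
    ENNReal.ofReal_ne_top, ENNReal.toReal_ofReal hr.le]

/-- The maximal function estimate for the retarded integral at a fixed frequency scale. -/
theorem exists_retarded_maximal_estimate (hn : 2 ≤ n) {ε : Fin n → ℝ}
    (hε : ∀ i, ε i = 1 ∨ ε i = -1) {χ : ℝ → ℝ} (hχ : IsBump χ) {p : ℝ} (hp : 2 ≤ p)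
    (hnp : 6 ≤ (n : ℝ) * p) {q r : ℝ} (hq : 2 < q) (hr : 2 < r)
    (hqr : 2 / q = (n : ℝ) * (1 / 2 - 1 / r)) :
    ∃ C : ℝ, 0 < C ∧ ∀ (F : SchwartzMap (ℝ × Eucl n) ℂ) (j : ℤ) (e : Eucl n), ‖e‖ = 1 →
      (∫⁻ x : ℝ, (⨆ z : ℝ × hyperplane e, ‖ker ε (duhamelSymbol ε (pieceSymbol χ j F)
        (Set.uIoc 0 z.1)) z.1 (x • e + (z.2 : Eucl n))‖ₑ) ^ p) ^ (1 / p) ≤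
      ENNReal.ofReal (C * (2 : ℝ) ^ (((n : ℝ) / 2 - 1 / p) * j)) *
        mixNorm (ENNReal.ofReal (q / (q - 1))) (ENNReal.ofReal (r / (r - 1)))
          (projT χ j fun z => F z) := by
  obtain ⟨C₁, hC₁, hmax⟩ := exists_maximal_estimate hn hε hp hnp
  obtain ⟨C₂, hC₂, hdual⟩ := exists_dual_strichartz hε hq hr hqr
  have hp0 : 0 < p := by linarith
  have hq1 : 0 < q - 1 := by linarith
  have hr1 : 0 < r - 1 := by linarith
  have hκ0 : 0 < q / (q - 1) := div_pos (by linarith) hq1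
  have hκp : q / (q - 1) < p := by
    refine lt_of_lt_of_le ?_ hp
    rw [div_lt_iff₀ hq1]; linarith
  have hK : 0 < 1 / (1 - (2 : ℝ) ^ (1 / p - 1 / (q / (q - 1)))) := by
    refine one_div_pos.2 (sub_pos.2 (Real.rpow_lt_one_of_one_lt_of_neg one_lt_two ?_))
    exact sub_neg.2 (one_div_lt_one_div_of_lt hκ0 hκp)
  set K := 1 / (1 - (2 : ℝ) ^ (1 / p - 1 / (q / (q - 1)))) with hKdef
  refine ⟨2 * K * (C₁ ^ (1 / p) * C₂ ^ ((1 : ℝ) / 2)), by positivity, fun F j e he => ?_⟩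
  rw [mixNorm_ofReal_eq hκ0 (div_pos (by linarith) hr1)]
  set g : ℝ → Eucl n → ℂ := fun s x => projT χ j (fun z => F z) (s, x) with hg
  set w : ℝ → ℝ≥0∞ := fun s =>
    ((∫⁻ y, ‖g s y‖ₑ ^ (r / (r - 1))) ^ (1 / (r / (r - 1)))) ^ (q / (q - 1)) with hw
  change _ ≤ _ * (∫⁻ t, w t) ^ (1 / (q / (q - 1)))
  have hl : (0 : ℝ) < 2 ^ j := by positivity
  by_cases hwt : ∫⁻ t, w t = ∞
  · rw [hwt, ENNReal.top_rpow_of_pos (by positivity), ENNReal.mul_top]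
    · exact le_top
    · exact (ENNReal.ofReal_pos.2 (by positivity)).ne'
  obtain ⟨M, hM0, hM⟩ := exists_norm_pieceSymbol_le hχ j F
  have hHc := continuous_pieceSymbol hχ j F
  have hH := hHc.measurable
  have hA : Integrable fun s : ℝ => M * (1 + s ^ 2)⁻¹ := integrable_inv_one_add_sq.const_mul M
  have hB : Integrable fun ξ : Eucl n => (1 + ‖ξ‖) ^ (-((n : ℝ) + 1)) :=
    integrable_one_add_norm (by simp)
  have hA0 : ∀ s : ℝ, 0 ≤ M * (1 + s ^ 2)⁻¹ := fun s => by positivity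
  have hAM : ∀ s : ℝ, M * (1 + s ^ 2)⁻¹ ≤ M := fun s =>
    mul_le_of_le_one_right hM0 (inv_le_one_of_one_le₀ (by nlinarith [sq_nonneg s]))
  have hB1 : ∀ ξ : Eucl n, (1 + ‖ξ‖) ^ (-((n : ℝ) + 1)) ≤ 1 := fun ξ =>
    Real.rpow_le_one_of_one_le_of_nonpos (by linarith [norm_nonneg ξ])
      (by linarith [n.cast_nonneg (α := ℝ)])
  have hsupp : ∀ s ξ, pieceSymbol χ j F s ξ ≠ 0 → ‖ξ‖ ≤ 2 * (2 : ℝ) ^ j := by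
    obtain ⟨b, hb, hb2⟩ := exists_schwartz_psi (n := n) hχ j
    intro s ξ h
    refine hb2 ξ ?_
    rw [hb]
    exact left_ne_zero_of_mul h
  have hgm : Measurable fun z : ℝ × Eucl n => g z.1 z.2 := by
    have : (fun z : ℝ × Eucl n => g z.1 z.2)
        = fun z => ker ε (pieceSymbol χ j F z.1) 0 z.2 := by
      ext z
      exact proj_eq_ker ε χ j (timeSlice z.1 F) z.2
    rw [this]
    exact measurable_ker_slice ε hH
  have hgS := exists_schwartz_proj_timeSlice hχ j F
  have hρ : 1 ≤ r / (r - 1) := by rw [one_le_div hr1]; linarith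
  have hD : ∀ a b, a ≤ b → (∫⁻ x, waveSup ε (pieceSymbol χ j F) e
      (TopologicalSpace.denseSeq (ℝ × hyperplane e)) (Set.Ioc a b) x ^ p) ^ (1 / p)
      ≤ (ENNReal.ofReal (C₁ * ((2 : ℝ) ^ j) ^ ((n : ℝ) * (p / 2) - 1)) ^ (1 / p)
        * ENNReal.ofReal C₂ ^ ((1 : ℝ) / 2))
        * (∫⁻ t in Set.Ioc a b, w t) ^ (1 / (q / (q - 1))) := by
    intro a b _
    refine rpow_le_of_block_bounds hp0 (hmax _ hl (duhamelSymbol ε (pieceSymbol χ j F)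
      (Set.Ioc a b)) (measurable_duhamelSymbol hH _) (integrable_duhamelSymbol hH hA hB hM _)
      (fun ξ hξ => ?_) e he _) ?_
    · by_contra hlt
      refine hξ ?_
      unfold duhamelSymbol
      refine integral_eq_zero_of_ae (ae_of_all _ fun s => ?_)
      simp [not_imp_comm.1 (hsupp s ξ) hlt]
    · have := hdual _ hl (pieceSymbol χ j F) g hH hsupp _ hA
        (fun s ξ => (hM s ξ).trans (mul_le_of_le_one_right (hA0 s) (hB1 ξ))) hgm
        (fun s => by
          obtain ⟨f, hf, -⟩ := hgS s
          have := f.integrable (μ := volume)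
          rwa [hf] at this)
        (fun s => by
          obtain ⟨f, hf, -⟩ := hgS s
          have := (f.memLp (ENNReal.ofReal (r / (r - 1))) volume).eLpNorm_lt_top
          rw [hf, eLpNorm_eq_lintegral_rpow_enorm_toReal
            (ENNReal.ofReal_pos.2 (by linarith)).ne' ENNReal.ofReal_ne_top,
            ENNReal.toReal_ofReal (by linarith)] at this
          exact (ENNReal.rpow_lt_top_iff_of_pos (by positivity)).1 this |>.ne)
        (fun s => by
          obtain ⟨f, hf, hf'⟩ := hgS s
          rw [← hf', SchwartzMap.fourier_coe, hf])
        (Set.Ioc a b) measurableSet_Ioc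
      rw [one_div_div]
      simp only [hw, one_div_div]
      exact this
  refine (lintegral_iSup_ker_uIoc_le hH hA hB hM (fun ξ => by positivity) hAM hM0
    (TopologicalSpace.denseRange_denseSeq _) (by linarith) hκ0 hκp hwt hD).trans_eq ?_
  rw [← hKdef, ENNReal.ofReal_rpow_of_pos (by positivity), ENNReal.ofReal_rpow_of_pos hC₂,
    ← ENNReal.ofReal_mul (by positivity), ← mul_assoc (ENNReal.ofReal K),
    ← ENNReal.ofReal_mul hK.le, ← mul_assoc]
  congr 1
  rw [show (2 : ℝ≥0∞) = ENNReal.ofReal 2 by simp, ← ENNReal.ofReal_mul (by norm_num)]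
  congr 1
  have : (j : ℝ) * (((n : ℝ) * (p / 2) - 1) * (1 / p)) = ((n : ℝ) / 2 - 1 / p) * j := by
    field_simp
  rw [Real.mul_rpow hC₁.le (by positivity), ← Real.rpow_mul hl.le, ← Real.rpow_intCast,
    ← Real.rpow_mul two_pos.le]
  rw [this]; ring

end DNLS


/-- `2^{-(n/2-1/p)j}‖P_j∫_0^t W_±(t-s)F(s)ds‖_{L^{p,∞}_e}
≤ C‖P_j F‖_{L^{q'}_tL^{r'}_x}` for `p ≥ 2`, `np ≥ 6` and admissible `(q,r)`, `q,r > 2`. -/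
theorem duhamel_maximal_from_strichartz
    (n : ℕ) (hn : 2 ≤ n) (ε : Fin n → ℝ) (hε : ∀ i, ε i = 1 ∨ ε i = -1)
    (χ : ℝ → ℝ) (hχ : IsBump χ)
    (p : ℝ) (hp : 2 ≤ p) (hnp : 6 ≤ (n : ℝ) * p)
    (q r : ℝ) (hadm : Admissible n q r) (hq : 2 < q) (hr : 2 < r)
    (q' r' : ℝ) (hq' : 1 / q + 1 / q' = 1) (hr' : 1 / r + 1 / r' = 1) :
    ∃ C : ℝ, 0 < C ∧ ∀ (F : SchwartzMap (ℝ × Eucl n) ℂ) (j : ℤ) (e : Eucl n), ‖e‖ = 1 →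
      tp (-(((n : ℝ) / 2 - 1 / p)) * j) *
        aniNorm (ENNReal.ofReal p) ∞ e (projT χ j (duhamel ε (fun q'' => F q'')))
      ≤ ENNReal.ofReal C *
          mixNorm (ENNReal.ofReal q') (ENNReal.ofReal r') (projT χ j (fun q'' => F q'')) := by
  obtain ⟨C, hC, h⟩ := exists_retarded_maximal_estimate hn hε hχ hp hnp hq hr hadm.1
  rw [conj_exponent_eq hq hq', conj_exponent_eq hr hr']
  refine ⟨C, hC, fun F j e he => ?_⟩
  have hp0 : 0 < p := by linarith
  have hb : aniNorm (ENNReal.ofReal p) ∞ e (projT χ j (duhamel ε fun z => F z)) ≤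
      (∫⁻ x : ℝ, (⨆ z : ℝ × hyperplane e, ‖ker ε (duhamelSymbol ε (pieceSymbol χ j F)
        (Set.uIoc 0 z.1)) z.1 (x • e + (z.2 : Eucl n))‖ₑ) ^ p) ^ (1 / p) := by
    unfold aniNorm
    rw [if_neg ENNReal.ofReal_ne_top, ENNReal.toReal_ofReal hp0.le]
    refine ENNReal.rpow_le_rpow (lintegral_mono fun x => ?_) (by positivity)
    exact ENNReal.rpow_le_rpow (innerQ_top_le
      (f := fun t => ker ε (duhamelSymbol ε (pieceSymbol χ j F) (Set.uIoc 0 t)) t)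
      (norm_projT_duhamel_le ε χ j F) x) hp0.le
  have hs : tp (-((n : ℝ) / 2 - 1 / p) * j) *
      ENNReal.ofReal (C * (2 : ℝ) ^ (((n : ℝ) / 2 - 1 / p) * j)) = ENNReal.ofReal C := by
    unfold tp
    rw [← ENNReal.ofReal_mul (by positivity), mul_left_comm, ← Real.rpow_add two_pos, neg_mul,
      neg_add_cancel, Real.rpow_zero, mul_one]
  rw [← hs, mul_assoc]
  exact mul_le_mul_right (hb.trans (h F j e he)) _
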